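/- arXiv:2107.09994 — 3 statements merged into one kernel-verified Lean document; each statement's English description precedes it below -/
import Mathlib

section
/- Let G be a simple finite graph with chromatic number χ(G) ≤ 5. Then the total chromatic number of G satisfies χ''(G) ≤ Δ(G) + 3, where Δ(G) is the maximum degree of G. -/
open SimpleGraph

/-- The total graph `T(G)` of a simple graph `G`: its vertices are the vertices and edges
of `G`, with two elements adjacent iff they are adjacent or incident in `G`. -/
def totalGraph {V : Type*} (G : SimpleGraph V) : SimpleGraph (V ⊕ G.edgeSet) :=
  SimpleGraph.fromRel fun x y =>
    match x, y with
    | Sum.inl u, Sum.inl v => G.Adj u v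
    | Sum.inl u, Sum.inr e => u ∈ (e : Sym2 V)
    | Sum.inr e, Sum.inl u => u ∈ (e : Sym2 V)
    | Sum.inr e, Sum.inr f => ∃ u, u ∈ (e : Sym2 V) ∧ u ∈ (f : Sym2 V)

/-- `cv`, `ce` form a total coloring of `G`: adjacent vertices get distinct colors, edges
sharing an endpoint get distinct colors, and every edge gets a color distinct from the colors
of both of its endpoints. -/
def IsTotalColoring {V : Type*} (G : SimpleGraph V) (cv : V → ℕ) (ce : Sym2 V → ℕ) : Prop :=
  (∀ ⦃u v⦄, G.Adj u v → cv u ≠ cv v) ∧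
  (∀ ⦃u v w⦄, G.Adj u v → G.Adj u w → v ≠ w → ce s(u, v) ≠ ce s(u, w)) ∧
  (∀ ⦃u v⦄, G.Adj u v → ce s(u, v) ≠ cv u ∧ ce s(u, v) ≠ cv v)

/-- The total chromatic number `χ''(G)`: the least `k` such that `G` has a total coloring
using colors `0, …, k-1`. -/
noncomputable def totalChromaticNumber {V : Type*} (G : SimpleGraph V) : ℕ :=
  sInf {k | ∃ cv ce, IsTotalColoring G cv ce ∧ (∀ v, cv v < k) ∧ ∀ e ∈ G.edgeSet, ce e < k}

/-- `H` has a minor isomorphic to `K`: there are pairwise disjoint nonempty branch sets,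
one for each vertex of `K`, each inducing a connected subgraph of `H`, with an edge of `H`
between the branch sets of any two adjacent vertices of `K`. -/
def HasMinor {W U : Type*} (H : SimpleGraph W) (K : SimpleGraph U) : Prop :=
  ∃ B : U → Set W,
    (∀ i, (B i).Nonempty) ∧
    (Pairwise fun i j => Disjoint (B i) (B j)) ∧
    (∀ i, (H.induce (B i)).Connected) ∧
    ∀ ⦃i j⦄, K.Adj i j → ∃ u ∈ B i, ∃ v ∈ B j, H.Adj u v

/-- `H` has a clique minor of order `t` (a `K_t`-minor): `t` pairwise disjoint nonempty
vertex subsets, each inducing a connected subgraph, with an edge between every pair. -/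
def HasCliqueMinor {W : Type*} (H : SimpleGraph W) (t : ℕ) : Prop :=
  ∃ B : Fin t → Set W,
    (∀ i, (B i).Nonempty) ∧
    (Pairwise fun i j => Disjoint (B i) (B j)) ∧
    (∀ i, (H.induce (B i)).Connected) ∧
    Pairwise fun i j => ∃ u ∈ B i, ∃ v ∈ B j, H.Adj u v

/-- The Hadwiger number `η(H)`: the largest `t` such that `H` has a `K_t`-minor. -/
noncomputable def hadwigerNumber {W : Type*} (H : SimpleGraph W) : ℕ :=
  sSup {t | HasCliqueMinor H t}

/-- A graph is `c`-vertex-connected if it has more than `c` vertices and deleting any set of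
fewer than `c` vertices leaves a connected graph. -/
def IsKConnected {V : Type*} [Fintype V] (c : ℕ) (G : SimpleGraph V) : Prop :=
  c < Fintype.card V ∧
    ∀ S : Finset V, S.card < c → (G.induce ((S : Set V)ᶜ)).Connected

/-- `G` is planar (Wagner's characterization): `G` has neither a `K₅`-minor nor a
`K₃,₃`-minor. -/
def IsPlanar {V : Type*} (G : SimpleGraph V) : Prop :=
  ¬ HasMinor G (⊤ : SimpleGraph (Fin 5)) ∧
  ¬ HasMinor G (completeBipartiteGraph (Fin 3) (Fin 3))

/-- `c` is a proper edge coloring of `G`: edges sharing an endpoint get distinct colors. -/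
def IsProperEdgeColoring {V : Type*} (G : SimpleGraph V) (c : Sym2 V → ℕ) : Prop :=
  ∀ ⦃u v w⦄, G.Adj u v → G.Adj u w → v ≠ w → c s(u, v) ≠ c s(u, w)

/-- The chromatic index `χ'(G)`: the least `k` such that `G` has a proper edge coloring
using colors `0, …, k-1`. -/
noncomputable def chromaticIndex {V : Type*} (G : SimpleGraph V) : ℕ :=
  sInf {k | ∃ c : Sym2 V → ℕ, IsProperEdgeColoring G c ∧ ∀ e ∈ G.edgeSet, c e < k}

/-- `G` is `k`-edge-choosable: for every assignment of a list of `k` colors to each edge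
there is a proper edge coloring choosing each edge's color from its list. -/
def EdgeChoosable {V : Type*} (G : SimpleGraph V) (k : ℕ) : Prop :=
  ∀ L : Sym2 V → Finset ℕ, (∀ e ∈ G.edgeSet, (L e).card = k) →
    ∃ c : Sym2 V → ℕ, IsProperEdgeColoring G c ∧ ∀ e ∈ G.edgeSet, c e ∈ L e

/-- The edge choosability `ch'(G)`: the least `k` such that `G` is `k`-edge-choosable. -/
noncomputable def edgeChoosability {V : Type*} (G : SimpleGraph V) : ℕ :=
  sInf {k | EdgeChoosable G k}

/-- The subdivision of `H`: every edge `uv` is replaced by a path `u – w_{uv} – v` through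
a new vertex `w_{uv}` corresponding to that edge. -/
def subdivision {V : Type*} (H : SimpleGraph V) : SimpleGraph (V ⊕ H.edgeSet) :=
  SimpleGraph.fromRel fun x y =>
    match x, y with
    | Sum.inl u, Sum.inr e => u ∈ (e : Sym2 V)
    | _, _ => False

/-- The square `G²` of `G`: two distinct vertices are adjacent iff their distance in `G`
is at most `2`, i.e. they are adjacent or have a common neighbour. -/
def squareGraph {V : Type*} (G : SimpleGraph V) : SimpleGraph V :=
  SimpleGraph.fromRel fun u v => G.Adj u v ∨ ∃ w, G.Adj u w ∧ G.Adj w v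

open Finset

section Degrees

open Classical in
/-- The number of neighbours of `v`, free of decidability instances. -/
noncomputable def nbrCount {V : Type*} [Fintype V] (G : SimpleGraph V) (v : V) : ℕ :=
  (univ.filter fun u => G.Adj v u).card

lemma nbrCount_eq_degree {V : Type*} [Fintype V] (G : SimpleGraph V) (v : V)
    [Fintype (G.neighborSet v)] : nbrCount G v = G.degree v := by
  classical
  rw [nbrCount, ← SimpleGraph.card_neighborFinset_eq_degree]
  congr 1
  ext u
  simp

lemma nbrCount_mono {V : Type*} [Fintype V] {G H : SimpleGraph V} (h : G ≤ H) (v : V) :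
    nbrCount G v ≤ nbrCount H v := by
  classical
  unfold nbrCount
  apply card_le_card
  intro u
  simp only [mem_filter, mem_univ, true_and]
  exact fun hu => h hu

lemma nbrCount_eq_zero {V : Type*} [Fintype V] {G : SimpleGraph V} {v : V}
    (h : ∀ u, ¬ G.Adj v u) : nbrCount G v = 0 := by
  classical
  exact card_eq_zero.2 (filter_eq_empty_iff.2 fun u _ => h u)

/-- A connected graph of maximum degree two has at most two vertices of degree at most one. -/
lemma not_reachable_three_ends {V : Type*} [Fintype V] (K : SimpleGraph V)
    (h2 : ∀ v, nbrCount K v ≤ 2) {x y z : V} (hxy : x ≠ y) (hxz : x ≠ z) (hyz : y ≠ z)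
    (hx : nbrCount K x ≤ 1) (hy : nbrCount K y ≤ 1) (hz : nbrCount K z ≤ 1)
    (rxy : K.Reachable x y) (rxz : K.Reachable x z) : False := by
  classical
  set C := K.connectedComponentMk x with hC
  have hconn := C.connected_toSimpleGraph
  have h1 := hconn.card_vert_le_card_edgeSet_add_one
  have hsum := C.toSimpleGraph.sum_degrees_eq_twice_card_edges
  have hle : ∀ w : C, C.toSimpleGraph.degree w ≤ nbrCount K w.1 := by
    intro w
    rw [← nbrCount_eq_degree]
    unfold nbrCount
    apply card_le_card_of_injOn Subtype.val
    · intro u hu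
      simp only [coe_filter, mem_univ, true_and, Set.mem_ofPred_eq] at hu ⊢
      exact hu
    · exact Subtype.val_injective.injOn
  have mx : x ∈ C := rfl
  have my : y ∈ C := SimpleGraph.ConnectedComponent.sound rxy.symm
  have mz : z ∈ C := SimpleGraph.ConnectedComponent.sound rxz.symm
  have key : ∀ w : C, C.toSimpleGraph.degree w + ((if w = ⟨x, mx⟩ then 1 else 0) +
      (if w = ⟨y, my⟩ then 1 else 0) + (if w = ⟨z, mz⟩ then 1 else 0)) ≤ 2 := by
    rintro ⟨w, hw⟩
    have a := hle ⟨w, hw⟩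
    have b := h2 w
    simp only [Subtype.mk.injEq] at a ⊢
    by_cases e1 : w = x
    · subst e1; simp [hxy, hxz]; omega
    by_cases e2 : w = y
    · subst e2; simp [e1, hyz]; omega
    by_cases e3 : w = z
    · subst e3; simp [e1, e2]; omega
    simp [e1, e2, e3]; omega
  have hs := Finset.sum_le_sum fun w (_ : w ∈ (univ : Finset C)) => key w
  simp only [sum_add_distrib, sum_ite_eq', mem_univ, if_true, sum_const, card_univ,
    smul_eq_mul] at hs
  rw [hsum] at hs
  rw [Nat.card_eq_fintype_card, Nat.card_eq_fintype_card, ← SimpleGraph.edgeFinset_card] at h1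
  omega

end Degrees

section EdgeColoring

variable {V C : Type*}

/-- Edges of `G` sharing an endpoint get distinct colors under `c`. -/
def EdgeProper (G : SimpleGraph V) (c : Sym2 V → C) : Prop :=
  ∀ ⦃u v w⦄, G.Adj u v → G.Adj u w → v ≠ w → c s(u, v) ≠ c s(u, w)

/-- No edge of `G` at `v` has color `a`. -/
def Misses (G : SimpleGraph V) (c : Sym2 V → C) (v : V) (a : C) : Prop :=
  ∀ ⦃u⦄, G.Adj v u → c s(v, u) ≠ a

lemma exists_misses [Fintype V] [Fintype C] (G : SimpleGraph V) (c : Sym2 V → C) (v : V)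
    (h : nbrCount G v < Fintype.card C) : ∃ a, Misses G c v a := by
  classical
  by_contra! hn
  simp only [Misses, not_forall, not_not] at hn
  have : (univ : Finset C) ⊆ (univ.filter fun u => G.Adj v u).image fun u => c s(v, u) := by
    intro a _
    obtain ⟨u, hu, e⟩ := hn a
    exact mem_image.2 ⟨u, by simpa using hu, e⟩
  have := (card_le_card this).trans card_image_le
  rw [card_univ] at this
  unfold nbrCount at h
  omega

open Classical in
lemma EdgeProper.update {G K : SimpleGraph V} {c : Sym2 V → C} (hc : EdgeProper K c) {x y : V}
    {a : C} (hx : Misses K c x a) (hy : Misses K c y a)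
    (hGK : ∀ ⦃u v⦄, G.Adj u v → K.Adj u v ∨ s(u, v) = s(x, y)) :
    EdgeProper G (Function.update c s(x, y) a) := by
  intro u v w huv huw hvw
  by_cases e1 : s(u, v) = s(x, y)
  · have e2 : s(u, w) ≠ s(x, y) := by
      rw [← e1]; intro h; exact hvw (Sym2.congr_right.1 h).symm
    rw [Function.update_of_ne e2, e1, Function.update_self]
    have hK := (hGK huw).resolve_right e2
    rcases Sym2.eq_iff.1 e1 with ⟨rfl, rfl⟩ | ⟨rfl, rfl⟩
    · exact (hx hK).symm
    · exact (hy hK).symm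
  · rw [Function.update_of_ne e1]
    have hK := (hGK huv).resolve_right e1
    by_cases e2 : s(u, w) = s(x, y)
    · rw [e2, Function.update_self]
      rcases Sym2.eq_iff.1 e2 with ⟨rfl, rfl⟩ | ⟨rfl, rfl⟩
      · exact hx hK
      · exact hy hK
    · rw [Function.update_of_ne e2]
      exact hc hK ((hGK huw).resolve_right e2) hvw

/-- The subgraph of edges colored `a` or `b`. -/
def kempe (G : SimpleGraph V) (c : Sym2 V → C) (a b : C) : SimpleGraph V where
  Adj u v := G.Adj u v ∧ (c s(u, v) = a ∨ c s(u, v) = b)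
  symm := ⟨fun u v h => ⟨h.1.symm, by rw [Sym2.eq_swap]; exact h.2⟩⟩
  loopless := ⟨fun u h => h.1.ne rfl⟩

lemma kempe_nbrCount_le_two [Fintype V] {G : SimpleGraph V} {c : Sym2 V → C}
    (hc : EdgeProper G c) (a b : C) (v : V) : nbrCount (kempe G c a b) v ≤ 2 := by
  classical
  unfold nbrCount
  refine (card_le_card_of_injOn (t := {a, b}) (fun u => c s(v, u)) ?_ ?_).trans card_le_two
  · intro u hu
    simpa using (mem_filter.1 hu).2.2
  · intro u hu w hw e
    by_contra hne
    exact hc (mem_filter.1 hu).2.1 (mem_filter.1 hw).2.1 hne e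

lemma kempe_nbrCount_le_one [Fintype V] {G : SimpleGraph V} {c : Sym2 V → C}
    (hc : EdgeProper G c) {a b : C} {v : V} (h : Misses G c v a ∨ Misses G c v b) :
    nbrCount (kempe G c a b) v ≤ 1 := by
  classical
  unfold nbrCount
  rw [card_le_one]
  intro u hu w hw
  by_contra hne
  have hu := (mem_filter.1 hu).2
  have hw := (mem_filter.1 hw).2
  have := hc hu.1 hw.1 hne
  rcases h with h | h
  · exact this ((hu.2.resolve_left (h hu.1)).trans (hw.2.resolve_left (h hw.1)).symm)
  · exact this ((hu.2.resolve_right (h hu.1)).trans (hw.2.resolve_right (h hw.1)).symm)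

open Classical in
/-- Exchange the colors `a` and `b` on all edges meeting `S`. -/
noncomputable def kempeSwap (c : Sym2 V → C) (a b : C) (S : Set V) (e : Sym2 V) : C :=
  if ∃ v ∈ S, v ∈ e then Equiv.swap a b (c e) else c e

open Classical in
lemma kempeSwap_of_mem (c : Sym2 V → C) (a b : C) {S : Set V} {u : V} (hu : u ∈ S) (v : V) :
    kempeSwap c a b S s(u, v) = Equiv.swap a b (c s(u, v)) :=
  if_pos ⟨u, hu, by simp⟩

lemma kempeSwap_of_notMem {G : SimpleGraph V} {c : Sym2 V → C} {a b : C} {S : Set V}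
    (hS : ∀ ⦃u v⦄, u ∈ S → (kempe G c a b).Adj u v → v ∈ S) {u v : V} (hu : u ∉ S)
    (huv : G.Adj u v) : kempeSwap c a b S s(u, v) = c s(u, v) := by
  classical
  unfold kempeSwap
  split_ifs with h
  · obtain ⟨w, hw, hm⟩ := h
    rcases Sym2.mem_iff.1 hm with rfl | rfl
    · exact absurd hw hu
    · apply Equiv.swap_apply_of_ne_of_ne
      · exact fun e => hu (hS hw ⟨huv.symm, Or.inl (by rw [Sym2.eq_swap]; exact e)⟩)
      · exact fun e => hu (hS hw ⟨huv.symm, Or.inr (by rw [Sym2.eq_swap]; exact e)⟩)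
  · rfl

lemma EdgeProper.swap_kempe {G : SimpleGraph V} {c : Sym2 V → C} (hc : EdgeProper G c) {a b : C}
    {S : Set V} (hS : ∀ ⦃u v⦄, u ∈ S → (kempe G c a b).Adj u v → v ∈ S) :
    EdgeProper G (kempeSwap c a b S) := by
  classical
  intro u v w huv huw hvw
  by_cases hu : u ∈ S
  · rw [kempeSwap_of_mem c a b hu, kempeSwap_of_mem c a b hu]
    exact fun h => hc huv huw hvw ((Equiv.swap a b).injective h)
  · rw [kempeSwap_of_notMem hS hu huv, kempeSwap_of_notMem hS hu huw]
    exact hc huv huw hvw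

lemma Misses.kempeSwap_notMem {G : SimpleGraph V} {c : Sym2 V → C} {a b d : C} {S : Set V}
    (hS : ∀ ⦃u v⦄, u ∈ S → (kempe G c a b).Adj u v → v ∈ S) {v : V} (hv : v ∉ S)
    (h : Misses G c v d) : Misses G (kempeSwap c a b S) v d := by
  intro u hu
  rw [kempeSwap_of_notMem hS hv hu]
  exact h hu

open Classical in
lemma Misses.kempeSwap_mem {G : SimpleGraph V} {c : Sym2 V → C} {a b d : C} {S : Set V} {v : V}
    (hv : v ∈ S) (h : Misses G c v (Equiv.swap a b d)) : Misses G (kempeSwap c a b S) v d := by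
  intro u hu
  rw [kempeSwap_of_mem c a b hv]
  intro e
  apply h hu
  rw [← e, Equiv.swap_apply_self]

/-- A Vizing fan at `x` with vertices `y 0, …, y k`, for a coloring `c` of `K`. -/
def IsFan (K : SimpleGraph V) (c : Sym2 V → C) (x : V) (y : ℕ → V) (k : ℕ) : Prop :=
  Set.InjOn y (Set.Iic k) ∧
    ∀ i < k, K.Adj x (y (i + 1)) ∧ Misses K c (y i) (c s(x, y (i + 1)))

lemma IsFan.inj {K : SimpleGraph V} {c : Sym2 V → C} {x : V} {y : ℕ → V} {k : ℕ}
    (h : IsFan K c x y k) {i j : ℕ} (hi : i ≤ k) (hj : j ≤ k) (e : y i = y j) : i = j :=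
  h.1 hi hj e

lemma IsFan.rotate {G : SimpleGraph V} {x : V} {a : C} (k : ℕ) :
    ∀ (c : Sym2 V → C) (y : ℕ → V), G.Adj x (y 0) →
      EdgeProper (G.deleteEdges {s(x, y 0)}) c → IsFan (G.deleteEdges {s(x, y 0)}) c x y k →
      Misses (G.deleteEdges {s(x, y 0)}) c x a →
      Misses (G.deleteEdges {s(x, y 0)}) c (y k) a → ∃ c' : Sym2 V → C, EdgeProper G c' := by
  classical
  induction k with
  | zero =>
    intro c y hxy hc _ hx hy
    refine ⟨_, hc.update hx hy ?_⟩
    intro u v huv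
    by_cases e : s(u, v) = s(x, y 0)
    · exact Or.inr e
    · exact Or.inl (by simpa [SimpleGraph.deleteEdges_adj, huv] using e)
  | succ k ih =>
    intro c y hxy hc hf hx hy
    have h01 : y 0 ≠ y 1 := fun h => by
      have := hf.inj (i := 0) (j := 1) (by omega) (by omega) h
      omega
    obtain ⟨hadj1, hmiss0⟩ := hf.2 0 (by omega)
    simp only [zero_add] at hadj1 hmiss0
    have hG1 : G.Adj x (y 1) := ((SimpleGraph.deleteEdges_adj).1 hadj1).1
    have adj' : ∀ {u v}, (G.deleteEdges {s(x, y 1)}).Adj u v →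
        (G.deleteEdges {s(x, y 0)}).Adj u v ∨ s(u, v) = s(x, y 0) := by
      intro u v huv
      by_cases e : s(u, v) = s(x, y 0)
      · exact Or.inr e
      · refine Or.inl (SimpleGraph.deleteEdges_adj.2 ⟨(SimpleGraph.deleteEdges_adj.1 huv).1, ?_⟩)
        simpa using e
    have hK : EdgeProper (G.deleteEdges {s(x, y 0), s(x, y 1)}) c := by
      intro u v w huv huw
      refine hc ?_ ?_
      · exact SimpleGraph.deleteEdges_anti (by simp) huv
      · exact SimpleGraph.deleteEdges_anti (by simp) huw
    have off : ∀ {v w : V}, v ≠ y 0 → v ≠ x → s(v, w) ≠ s(x, y 0) := by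
      intro v w h1 h2 e
      rcases Sym2.eq_iff.1 e with h | h
      · exact h2 h.1
      · exact h1 h.1
    have offx : ∀ {w : V}, w ≠ y 0 → s(x, w) ≠ s(x, y 0) :=
      fun h e => h (Sym2.congr_right.1 e)
    refine ih (Function.update c s(x, y 0) (c s(x, y 1))) (fun i => y (i + 1)) hG1 ?_ ⟨?_, ?_⟩
      ?_ ?_
    · refine hK.update ?_ ?_ ?_
      · intro u hu
        have h := SimpleGraph.deleteEdges_adj.1 hu
        refine hc (SimpleGraph.deleteEdges_anti (by simp) hu) hadj1 ?_
        rintro rfl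
        exact h.2 (by simp)
      · intro u hu
        exact hmiss0 (SimpleGraph.deleteEdges_anti (by simp) hu)
      · intro u v huv
        rcases adj' huv with h | h
        · left
          have h1 := SimpleGraph.deleteEdges_adj.1 huv
          have h2 := SimpleGraph.deleteEdges_adj.1 h
          refine SimpleGraph.deleteEdges_adj.2 ⟨h1.1, ?_⟩
          simp only [Set.mem_singleton_iff, Set.mem_insert_iff] at h1 h2 ⊢
          tauto
        · exact Or.inr h
    · intro i hi j hj e
      have hi : i ≤ k := hi
      have hj : j ≤ k := hj
      have := hf.inj (i := i + 1) (j := j + 1) (by omega) (by omega) e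
      omega
    · intro i hi
      obtain ⟨h1, h2⟩ := hf.2 (i + 1) (by omega)
      have hne : y (i + 2) ≠ y 0 := fun h => by
        have := hf.inj (i := i + 2) (j := 0) (by omega) (by omega) h
        omega
      have hne1 : y (i + 2) ≠ y 1 := fun h => by
        have := hf.inj (i := i + 2) (j := 1) (by omega) (by omega) h
        omega
      have hne0 : y (i + 1) ≠ y 0 := fun h => by
        have := hf.inj (i := i + 1) (j := 0) (by omega) (by omega) h
        omega
      have hxne : y (i + 1) ≠ x := by
        have := (hf.2 i (by omega)).1.ne
        exact this.symm
      refine ⟨SimpleGraph.deleteEdges_adj.2 ⟨(SimpleGraph.deleteEdges_adj.1 h1).1, ?_⟩, ?_⟩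
      · simp only [Set.mem_singleton_iff]
        exact fun e => hne1 (Sym2.congr_right.1 e)
      · intro u hu
        rw [Function.update_of_ne (offx hne), Function.update_of_ne (off hne0 hxne)]
        exact h2 ((adj' hu).resolve_right (off hne0 hxne))
    · intro u hu
      rcases adj' hu with h | h
      · have : u ≠ y 0 := by
          rintro rfl
          exact (SimpleGraph.deleteEdges_adj.1 h).2 rfl
        rw [Function.update_of_ne (offx this)]
        exact hx h
      · rw [h, Function.update_self]
        exact hx hadj1
    · have hne0 : y (k + 1) ≠ y 0 := fun h => by
        have := hf.inj (i := k + 1) (j := 0) (by omega) (by omega) h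
        omega
      have hxne : y (k + 1) ≠ x := ((hf.2 k (by omega)).1.ne).symm
      intro u hu
      rw [Function.update_of_ne (off hne0 hxne)]
      exact hy ((adj' hu).resolve_right (off hne0 hxne))

/-- Vizing's fan argument: an edge `x y` can be added to a proper edge coloring if every
neighbour of `x` has degree less than the number of colors. -/
lemma EdgeProper.extend_edge [Fintype V] [Fintype C] {G : SimpleGraph V} {x y₀ : V}
    (hxy : G.Adj x y₀) {c : Sym2 V → C} (hc : EdgeProper (G.deleteEdges {s(x, y₀)}) c)
    (hx : nbrCount G x ≤ Fintype.card C)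
    (hnbr : ∀ ⦃v⦄, G.Adj x v → nbrCount G v < Fintype.card C) :
    ∃ c' : Sym2 V → C, EdgeProper G c' := by
  classical
  set K := G.deleteEdges {s(x, y₀)} with hK
  have hKG : K ≤ G := SimpleGraph.deleteEdges_le _
  have hnot : ¬ K.Adj x y₀ := by simp [hK, SimpleGraph.deleteEdges_adj]
  obtain ⟨a, ha⟩ : ∃ a, Misses K c x a := by
    apply exists_misses
    refine lt_of_lt_of_le ?_ hx
    unfold nbrCount
    apply card_lt_card
    refine ⟨fun u hu => ?_, fun h => ?_⟩
    · simp only [mem_filter, mem_univ, true_and] at hu ⊢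
      exact hKG hu
    · have := @h y₀ (by simpa using hxy)
      simp only [mem_filter, mem_univ, true_and] at this
      exact hnot this
  -- a fan with the largest possible number of vertices
  let P : ℕ → Prop := fun k => ∃ y : ℕ → V, y 0 = y₀ ∧ IsFan K c x y k
  have hP0 : P 0 := ⟨fun _ => y₀, rfl, by
    intro i hi j hj _
    simp only [Set.mem_Iic, nonpos_iff_eq_zero] at hi hj
    rw [hi, hj], by simp⟩
  have hPb : ∀ k, P k → k ≤ Fintype.card V := by
    rintro k ⟨y, _, hf⟩
    have : (range (k + 1)).card ≤ (univ : Finset V).card :=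
      card_le_card_of_injOn y (by simp) (hf.1.mono (by
        intro i hi
        simp only [coe_range, Set.mem_Iio, Set.mem_Iic] at hi ⊢
        omega))
    rw [card_range, card_univ] at this
    omega
  set k := Nat.findGreatest P (Fintype.card V) with hk
  obtain ⟨y, hy0, hf⟩ : P k := Nat.findGreatest_spec (Nat.zero_le _) hP0
  have hmax : ¬ P (k + 1) := fun h => by
    have := Nat.le_findGreatest (hPb _ h) h
    omega
  have hadj : ∀ i ≤ k, G.Adj x (y i) := by
    intro i hi
    rcases i with _ | i
    · rw [hy0]; exact hxy
    · exact hKG (hf.2 i (by omega)).1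
  subst hy0
  have hsub : ∀ j ≤ k, IsFan K c x y j := fun j hj =>
    ⟨hf.1.mono (Set.Iic_subset_Iic.2 hj), fun i hi => hf.2 i (by omega)⟩
  obtain ⟨b, hb⟩ : ∃ b, Misses K c (y k) b :=
    exists_misses _ _ _ (lt_of_le_of_lt (nbrCount_mono hKG _) (hnbr (hadj k le_rfl)))
  by_cases hxb : Misses K c x b
  · exact IsFan.rotate k c y hxy hc hf hxb hb
  simp only [Misses, not_forall, not_not] at hxb
  obtain ⟨z, hz, hzb⟩ := hxb
  have hab : a ≠ b := fun h => ha hz (hzb.trans h.symm)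
  obtain ⟨j, hj, rfl⟩ : ∃ j ≤ k, y j = z := by
    by_contra! hn
    apply hmax
    refine ⟨Function.update y (k + 1) z, by rw [Function.update_of_ne (by omega)], ?_, ?_⟩
    · intro i hi l hl e
      simp only [Set.mem_Iic] at hi hl
      by_cases h1 : i = k + 1 <;> by_cases h2 : l = k + 1
      · omega
      · subst h1
        rw [Function.update_self, Function.update_of_ne h2] at e
        exact absurd e.symm (hn l (by omega))
      · subst h2
        rw [Function.update_self, Function.update_of_ne h1] at e
        exact absurd e (hn i (by omega))
      · rw [Function.update_of_ne h1, Function.update_of_ne h2] at e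
        exact hf.inj (by omega) (by omega) e
    · intro i hi
      rw [Function.update_of_ne (by omega : i ≠ k + 1)]
      by_cases h1 : i = k
      · subst h1
        rw [Function.update_self, hzb]
        exact ⟨hz, hb⟩
      · rw [Function.update_of_ne (by omega)]
        exact hf.2 i (by omega)
  obtain ⟨j, rfl⟩ : ∃ i, j = i + 1 := by
    refine ⟨j - 1, ?_⟩
    rcases j with _ | j
    · exact absurd hz hnot
    · rfl
  have hjb : Misses K c (y j) b := hzb ▸ (hf.2 j (by omega)).2
  have finish : ∀ (S : Set V), (∀ ⦃u v⦄, u ∈ S → (kempe K c a b).Adj u v → v ∈ S) → x ∉ S →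
      ∀ l ≤ k, y l ∈ S → Misses K c (y l) b → (∀ i < l, i = j → y i ∉ S) →
      ∃ c' : Sym2 V → C, EdgeProper G c' := by
    intro S hS hxS l hl hlS hlb hij
    refine IsFan.rotate (a := a) l (kempeSwap c a b S) y hxy (hc.swap_kempe hS)
      ⟨(hsub l hl).1, ?_⟩ (Misses.kempeSwap_notMem hS hxS ha)
      (Misses.kempeSwap_mem hlS (by rwa [Equiv.swap_apply_left]))
    intro i hi
    obtain ⟨h1, h2⟩ := hf.2 i (by omega)
    refine ⟨h1, ?_⟩
    rw [kempeSwap_of_notMem hS hxS h1]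
    by_cases hiS : y i ∈ S
    · apply Misses.kempeSwap_mem hiS
      rw [Equiv.swap_apply_of_ne_of_ne (ha h1)]
      · exact h2
      · intro e
        have hne : y (i + 1) = y (j + 1) := by
          by_contra hne
          exact hc h1 hz hne (e.trans hzb.symm)
        have := hf.inj (i := i + 1) (j := j + 1) (by omega) (by omega) hne
        exact hij i hi (by omega) hiS
    · exact Misses.kempeSwap_notMem hS hiS h2
  have closed : ∀ v, ∀ ⦃u w⦄, u ∈ {u | (kempe K c a b).Reachable v u} →
      (kempe K c a b).Adj u w → w ∈ {u | (kempe K c a b).Reachable v u} :=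
    fun v u w hu huw => SimpleGraph.Reachable.trans hu huw.reachable
  by_cases hr : (kempe K c a b).Reachable x (y j)
  · have hjk : y j ≠ y k := fun h => by
      have := hf.inj (i := j) (j := k) (by omega) (by omega) h
      omega
    have hno : ¬ (kempe K c a b).Reachable x (y k) := fun h =>
      not_reachable_three_ends _ (kempe_nbrCount_le_two hc a b) (hadj j (by omega)).ne
        (hadj k le_rfl).ne hjk (kempe_nbrCount_le_one hc (Or.inl ha))
        (kempe_nbrCount_le_one hc (Or.inr hjb)) (kempe_nbrCount_le_one hc (Or.inr hb)) hr h
    refine finish _ (closed (y k)) (fun h => hno (SimpleGraph.Reachable.symm h)) k le_rfl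
      (SimpleGraph.Reachable.refl _) hb ?_
    rintro i _ rfl h
    exact hno (hr.trans (SimpleGraph.Reachable.symm h))
  · exact finish _ (closed (y j)) (fun h => hr (SimpleGraph.Reachable.symm h)) j (by omega)
      (SimpleGraph.Reachable.refl _) hjb (fun i hi e => by omega)

/-- A graph with maximum degree at most `D`, whose vertices of degree `D` are independent, has
a proper edge coloring with `D` colors. -/
lemma exists_edgeProper_of_independent_core [Fintype V] [Fintype C] [Nonempty C] (G : SimpleGraph V)
    (hdeg : ∀ v, nbrCount G v ≤ Fintype.card C)
    (hcore : ∀ ⦃u v⦄, G.Adj u v → nbrCount G u = Fintype.card C →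
      nbrCount G v < Fintype.card C) :
    ∃ c : Sym2 V → C, EdgeProper G c := by
  classical
  induction hn : G.edgeSet.ncard using Nat.strong_induction_on generalizing G with
  | _ n ih =>
  by_cases hG : ∃ x y, G.Adj x y
  · obtain ⟨x, y, hxy, hnb⟩ : ∃ x y, G.Adj x y ∧
        ∀ ⦃v⦄, G.Adj x v → nbrCount G v < Fintype.card C := by
      by_cases hx : ∃ x y, G.Adj x y ∧ nbrCount G x = Fintype.card C
      · obtain ⟨x, y, h, hx⟩ := hx
        exact ⟨x, y, h, fun v hv => hcore hv hx⟩
      · push Not at hx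
        obtain ⟨x, y, h⟩ := hG
        exact ⟨x, y, h, fun v hv => lt_of_le_of_ne (hdeg v) (hx v x hv.symm)⟩
    have hle : G.deleteEdges {s(x, y)} ≤ G := SimpleGraph.deleteEdges_le _
    have hlt : (G.deleteEdges {s(x, y)}).edgeSet.ncard < n := by
      rw [← hn]
      refine Set.ncard_lt_ncard ?_ (Set.toFinite _)
      rw [SimpleGraph.edgeSet_ssubset_edgeSet]
      refine lt_of_le_of_ne hle fun h => ?_
      have : (G.deleteEdges {s(x, y)}).Adj x y := by rw [h]; exact hxy
      simp [SimpleGraph.deleteEdges_adj] at this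
    obtain ⟨c, hc⟩ := ih _ hlt (G.deleteEdges {s(x, y)})
      (fun v => (nbrCount_mono hle v).trans (hdeg v))
      (fun u v huv hu => lt_of_le_of_lt (nbrCount_mono hle v)
        (hcore (hle huv) (le_antisymm (hdeg u) (hu ▸ nbrCount_mono hle u)))) rfl
    exact EdgeProper.extend_edge hxy hc (hdeg x) hnb
  · push Not at hG
    exact ⟨fun _ => Classical.arbitrary C, fun u v w huv => absurd huv (hG u v)⟩

end EdgeColoring

section DegreeConstrained

lemma nbrCount_sup_edge {V : Type*} [Fintype V] [DecidableEq V] {H : SimpleGraph V} {a b : V}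
    (hab : a ≠ b) (h : ¬ H.Adj a b) (v : V) :
    nbrCount (H ⊔ SimpleGraph.edge a b) v =
      nbrCount H v + ((if v = a then 1 else 0) + if v = b then 1 else 0) := by
  classical
  have h' : ¬ H.Adj b a := fun k => h k.symm
  unfold nbrCount
  by_cases va : v = a
  · subst va
    trans (insert b (univ.filter fun u => H.Adj v u)).card
    · congr 1
      ext u
      simp only [mem_filter, mem_univ, true_and, mem_insert, SimpleGraph.sup_adj,
        SimpleGraph.edge_adj]
      grind
    rw [card_insert_of_notMem (by simpa using h)]
    simp [hab]
  by_cases vb : v = b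
  · subst vb
    trans (insert a (univ.filter fun u => H.Adj v u)).card
    · congr 1
      ext u
      simp only [mem_filter, mem_univ, true_and, mem_insert, SimpleGraph.sup_adj,
        SimpleGraph.edge_adj]
      grind
    rw [card_insert_of_notMem (by simpa using h')]
    simp [va]
  · simp only [va, vb, if_false, add_zero]
    congr 1
    ext u
    simp only [mem_filter, mem_univ, true_and, SimpleGraph.sup_adj, SimpleGraph.edge_adj]
    grind

lemma nbrCount_deleteEdge_add {V : Type*} [Fintype V] [DecidableEq V] {H : SimpleGraph V}
    {a b : V} (h : H.Adj a b) (v : V) :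
    nbrCount (H.deleteEdges {s(a, b)}) v +
      ((if v = a then 1 else 0) + if v = b then 1 else 0) = nbrCount H v := by
  rw [← nbrCount_sup_edge h.ne (by simp [SimpleGraph.deleteEdges_adj])]
  congr 1
  ext u w
  simp only [SimpleGraph.sup_adj, SimpleGraph.deleteEdges_adj, SimpleGraph.edge_adj,
    Set.mem_singleton_iff, Sym2.eq_iff]
  have := h.symm
  have := h.ne
  grind

lemma nbrCount_sdiff_add {V : Type*} [Fintype V] {G H : SimpleGraph V} (h : H ≤ G) (v : V) :
    nbrCount (G \ H) v + nbrCount H v = nbrCount G v := by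
  classical
  unfold nbrCount
  rw [← card_union_of_disjoint]
  · congr 1
    ext u
    simp only [mem_union, mem_filter, mem_univ, true_and, SimpleGraph.sdiff_adj]
    have := @h v u
    grind
  · rw [Finset.disjoint_left]
    intro u
    simp only [mem_filter, mem_univ, true_and, SimpleGraph.sdiff_adj]
    grind

lemma sum_nbrCount_le {V : Type*} [Fintype V] (K : SimpleGraph V) (A B : Finset V)
    (h : ∀ ⦃a x⦄, a ∈ A → K.Adj a x → x ∈ B) :
    ∑ a ∈ A, nbrCount K a ≤ ∑ x ∈ B, nbrCount K x := by
  classical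
  unfold nbrCount
  rw [← card_sigma, ← card_sigma]
  refine card_le_card_of_injOn (fun p => ⟨p.2, p.1⟩) ?_ ?_
  · rintro ⟨a, x⟩ hp
    simp only [coe_sigma, coe_filter, mem_univ, true_and, Set.mem_sigma_iff, mem_coe,
      Set.mem_ofPred_eq] at hp ⊢
    exact ⟨h hp.1 hp.2, hp.2.symm⟩
  · rintro ⟨a, x⟩ _ ⟨b, y⟩ _ e
    simp only [Sigma.mk.injEq, heq_eq_eq] at e ⊢
    exact ⟨e.2, e.1⟩

/-- `H` is a subgraph of `G` with degrees at most `f` and, subject to this, the least total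
deficiency with respect to the demands `g`. -/
def IsLeastDeficient {V : Type*} [Fintype V] (G : SimpleGraph V) (g f : V → ℕ)
    (H : SimpleGraph V) : Prop :=
  H ≤ G ∧ (∀ v, nbrCount H v ≤ f v) ∧
    ∀ H' ≤ G, (∀ v, nbrCount H' v ≤ f v) →
      ∑ v, (g v - nbrCount H v) ≤ ∑ v, (g v - nbrCount H' v)

/-- A chain of alternating edges of `G \ H` and `H`. -/
def IsAltChain {V : Type*} (G H : SimpleGraph V) (w u : ℕ → V) (n : ℕ) : Prop :=
  ∀ i < n, G.Adj (w i) (u i) ∧ ¬ H.Adj (w i) (u i) ∧ H.Adj (u i) (w (i + 1))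

lemma IsLeastDeficient.of_le {V : Type*} [Fintype V] {G H H' : SimpleGraph V} {g f : V → ℕ}
    (hH : IsLeastDeficient G g f H) (hG : H' ≤ G) (hf : ∀ v, nbrCount H' v ≤ f v)
    (h : ∀ v, g v - nbrCount H' v ≤ g v - nbrCount H v) :
    IsLeastDeficient G g f H' ∧ ∀ v, g v - nbrCount H' v = g v - nbrCount H v := by
  have hle := sum_le_sum fun v (_ : v ∈ univ) => h v
  refine ⟨⟨hG, hf, fun K hK hKf => hle.trans (hH.2.2 K hK hKf)⟩, fun v => ?_⟩
  exact (sum_eq_sum_iff_of_le fun v _ => h v).1 (le_antisymm hle (hH.2.2 H' hG hf)) v (mem_univ v)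

lemma IsLeastDeficient.altChain {V : Type*} [Fintype V] {G : SimpleGraph V} {g f : V → ℕ}
    (hgf : ∀ v, g v < f v) (n : ℕ) :
    ∀ (H : SimpleGraph V) (w u : ℕ → V), IsLeastDeficient G g f H →
      nbrCount H (w 0) < g (w 0) → IsAltChain G H w u n →
      nbrCount H (w n) ≤ g (w n) ∧
        ∀ x, G.Adj (w n) x → ¬ H.Adj (w n) x → f x ≤ nbrCount H x := by
  classical
  induction n using Nat.strong_induction_on with
  | _ n ih =>
  intro H w u hH h0 hch
  have hpre : ∀ {i}, i ≤ n → IsAltChain G H w u i := fun hi j hj => hch j (by omega)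
  by_cases hrep : ∃ i < n, w i = w n
  · obtain ⟨i, hi, e⟩ := hrep
    rw [← e]
    exact ih i hi H w u hH h0 (hpre hi.le)
  push Not at hrep
  rcases n with _ | m
  · refine ⟨h0.le, fun x hx hx' => ?_⟩
    by_contra! hlt
    have hd := nbrCount_sup_edge hx.ne hx'
    have := (hH.of_le (H' := H ⊔ SimpleGraph.edge (w 0) x)
      (sup_le hH.1 (by rw [SimpleGraph.edge_le_iff]; exact Or.inr hx)) ?_ ?_).2 (w 0)
    · have h1 := hd (w 0)
      rw [if_pos rfl] at h1
      omega
    · intro v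
      have h1 := hd v
      have := hH.2.1 v
      have := hgf v
      have := hx.ne
      split_ifs at h1 <;> grind
    · intro v
      have h1 := hd v
      omega
  have hw : ∀ i ≤ m, nbrCount H (w i) ≤ g (w i) := fun i hi =>
    (ih i (by omega) H w u hH h0 (hpre (by omega))).1
  have hu : ∀ i ≤ m, f (u i) ≤ nbrCount H (u i) := fun i hi =>
    (ih i (by omega) H w u hH h0 (hpre (by omega))).2 (u i) (hch i (by omega)).1
      (hch i (by omega)).2.1
  obtain ⟨e1, e2, e3⟩ := hch m (by omega)
  have hdel := nbrCount_deleteEdge_add e3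
  set D := H.deleteEdges {s(u m, w (m + 1))} with hD
  have hDH : D ≤ H := SimpleGraph.deleteEdges_le _
  have hDadj : ∀ i < m, D.Adj (u i) (w (i + 1)) := by
    intro i hi
    rw [hD, SimpleGraph.deleteEdges_adj]
    refine ⟨(hch i (by omega)).2.2, ?_⟩
    rw [Set.mem_singleton_iff, Sym2.eq_iff]
    rintro (⟨-, h⟩ | ⟨-, h⟩)
    · exact hrep (i + 1) (by omega) h
    · have h1 := hw (i + 1) (by omega)
      have h2 := hu m le_rfl
      have h3 := hgf (u m)
      rw [h] at h1
      omega
  have hne : u m ≠ w (m + 1) := e3.ne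
  have tight : nbrCount H (w (m + 1)) ≤ g (w (m + 1)) := by
    by_contra! hlt
    have hopt := (hH.of_le (H' := D) (hDH.trans hH.1)
      (fun v => (nbrCount_mono hDH v).trans (hH.2.1 v)) (by
        intro v
        have h1 := hdel v
        have h2 := hu m le_rfl
        have h3 := hgf (u m)
        split_ifs at h1 <;> grind))
    have h4 := hopt.2 (w 0)
    have := (ih m (by omega) D w u hopt.1 (by omega)
      (fun i hi => ⟨(hch i (by omega)).1, fun k => (hch i (by omega)).2.1 (hDH k), hDadj i hi⟩)).2
      (u m) e1 (fun k => e2 (hDH k))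
    have h1 := hdel (u m)
    rw [if_pos rfl] at h1
    have := hH.2.1 (u m)
    omega
  refine ⟨tight, fun x hx hx' => ?_⟩
  by_contra! hlt
  have hxu : x ≠ u m := by
    rintro rfl
    exact hx' e3.symm
  have hadd := nbrCount_sup_edge (H := D) hx.ne (fun k => hx' (hDH k))
  set H1 := D ⊔ SimpleGraph.edge (w (m + 1)) x with hH1
  have hcount : ∀ v, nbrCount H1 v + (if v = u m then 1 else 0) =
      nbrCount H v + if v = x then 1 else 0 := by
    intro v
    have h1 := hdel v
    have h2 := hadd v
    omega
  have hopt := hH.of_le (H' := H1)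
    (sup_le (hDH.trans hH.1) (by rw [SimpleGraph.edge_le_iff]; exact Or.inr hx)) (by
      intro v
      have h1 := hcount v
      have := hH.2.1 v
      split_ifs at h1 <;> grind) (by
      intro v
      have h1 := hcount v
      have h2 := hu m le_rfl
      have h3 := hgf (u m)
      split_ifs at h1 <;> grind)
  have h4 := hopt.2 (w 0)
  have := (ih m (by omega) H1 w u hopt.1 (by omega) (by
      intro i hi
      refine ⟨(hch i (by omega)).1, ?_, Or.inl (hDadj i hi)⟩
      rintro (k | k)
      · exact (hch i (by omega)).2.1 (hDH k)
      · rw [SimpleGraph.edge_adj] at k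
        rcases k.1 with ⟨k, -⟩ | ⟨-, k⟩
        · exact hrep i (by omega) k
        · have h1 := hu i (by omega)
          have h2 := hgf (u i)
          rw [k] at h1 h2
          omega)).2
      (u m) e1 (by
      rintro (k | k)
      · exact e2 (hDH k)
      · rw [SimpleGraph.edge_adj] at k
        rcases k.1 with ⟨k, -⟩ | ⟨-, k⟩
        · exact hrep m (by omega) k
        · exact hne k)
  have h1 := hcount (u m)
  rw [if_pos rfl, if_neg hxu.symm] at h1
  have := hH.2.1 (u m)
  omega

/-- A graph has a subgraph whose degrees lie between `g` and `f` as soon as some ratio `p / q ≤ 1`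
separates `g` and `f` in the sense that `g ≤ (p / q) * deg ≤ f` and `g < f`. -/
theorem exists_subgraph_nbrCount_between {V : Type*} [Fintype V] (G : SimpleGraph V)
    (g f : V → ℕ) (hgf : ∀ v, g v < f v) {p q : ℕ} (hq : 0 < q) (hpq : p ≤ q)
    (hg : ∀ v, q * g v ≤ p * nbrCount G v) (hf : ∀ v, p * nbrCount G v ≤ q * f v) :
    ∃ H ≤ G, ∀ v, g v ≤ nbrCount H v ∧ nbrCount H v ≤ f v := by
  classical
  obtain ⟨H, hH⟩ : ∃ H, IsLeastDeficient G g f H := by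
    obtain ⟨H, hH, hmin⟩ := Set.exists_min_image
      {H : SimpleGraph V | H ≤ G ∧ ∀ v, nbrCount H v ≤ f v}
      (fun H => ∑ v, (g v - nbrCount H v)) (Set.toFinite _) ⟨⊥, bot_le, by simp [nbrCount]⟩
    exact ⟨H, hH.1, hH.2, fun K h1 h2 => hmin K ⟨h1, h2⟩⟩
  refine ⟨H, hH.1, fun v₀ => ⟨?_, hH.2.1 v₀⟩⟩
  by_contra! h0
  set A : Finset V := univ.filter fun v => ∃ (n : ℕ) (w u : ℕ → V),
    w 0 = v₀ ∧ IsAltChain G H w u n ∧ w n = v with hA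
  set B : Finset V := univ.filter fun x => ∃ a ∈ A, (G \ H).Adj a x with hB
  have hchain : ∀ a ∈ A, nbrCount H a ≤ g a ∧
      ∀ x, (G \ H).Adj a x → f x ≤ nbrCount H x := by
    intro a ha
    obtain ⟨n, w, u, rfl, hch, rfl⟩ := (mem_filter.1 ha).2
    obtain ⟨h1, h2⟩ := IsLeastDeficient.altChain hgf n H w u hH h0 hch
    exact ⟨h1, fun x hx => h2 x hx.1 hx.2⟩
  have hv₀ : v₀ ∈ A := mem_filter.2 ⟨mem_univ _, 0, fun _ => v₀, fun _ => v₀, rfl,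
    fun i hi => absurd hi (by omega), rfl⟩
  have hsat : ∀ x ∈ B, f x ≤ nbrCount H x := by
    intro x hx
    obtain ⟨a, ha, hax⟩ := (mem_filter.1 hx).2
    exact (hchain a ha).2 x hax
  have hAB := sum_nbrCount_le (G \ H) A B fun a x ha hax => mem_filter.2 ⟨mem_univ _, a, ha, hax⟩
  have hBA := sum_nbrCount_le H B A (by
    intro x y hx hxy
    obtain ⟨a, ha, hax⟩ := (mem_filter.1 hx).2
    obtain ⟨n, w, u, h1, hch, rfl⟩ := (mem_filter.1 ha).2
    refine mem_filter.2 ⟨mem_univ _, n + 1, Function.update w (n + 1) y, Function.update u n x,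
      by simp [Function.update, h1], fun i hi => ?_, by simp⟩
    rcases Nat.lt_succ_iff_lt_or_eq.1 hi with hi | rfl
    · rw [Function.update_of_ne (by omega), Function.update_of_ne (by omega),
        Function.update_of_ne (by omega)]
      exact hch i hi
    · rw [Function.update_of_ne (by omega), Function.update_self, Function.update_self]
      exact ⟨hax.1, hax.2, hxy⟩)
  have h1 : q * ∑ a ∈ A, nbrCount H a < p * ∑ a ∈ A, nbrCount G a := by
    rw [mul_sum, mul_sum]
    refine sum_lt_sum (fun a ha => (Nat.mul_le_mul_left q (hchain a ha).1).trans (hg a))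
      ⟨v₀, hv₀, lt_of_lt_of_le (Nat.mul_lt_mul_of_pos_left h0 hq) (hg v₀)⟩
  have h2 : p * ∑ x ∈ B, nbrCount G x ≤ q * ∑ x ∈ B, nbrCount H x := by
    rw [mul_sum, mul_sum]
    exact sum_le_sum fun x hx => (hf x).trans (Nat.mul_le_mul_left q (hsat x hx))
  simp only [← nbrCount_sdiff_add hH.1, sum_add_distrib] at h1 h2
  obtain ⟨r, rfl⟩ := Nat.exists_eq_add_of_le hpq
  have := Nat.mul_le_mul_left p hAB
  have := Nat.mul_le_mul_left r hBA
  nlinarith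

end DegreeConstrained

section Bipartite

variable {V C : Type*}

/-- König's edge coloring theorem: a bipartite graph has a proper edge coloring with as many
colors as its maximum degree. -/
theorem exists_edgeProper_of_bipartite [Fintype V] [Fintype C] [Nonempty C] (G : SimpleGraph V)
    (side : V → Prop) (hside : ∀ ⦃u v⦄, G.Adj u v → (side u ↔ ¬ side v))
    (hdeg : ∀ v, nbrCount G v ≤ Fintype.card C) :
    ∃ c : Sym2 V → C, EdgeProper G c := by
  classical
  induction hn : G.edgeSet.ncard using Nat.strong_induction_on generalizing G with
  | _ n ih =>
  by_cases hG : ∃ x y, G.Adj x y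
  swap
  · push Not at hG
    exact ⟨fun _ => Classical.arbitrary C, fun u v w huv => absurd huv (hG u v)⟩
  obtain ⟨x, y, hxy⟩ := hG
  have hcount := nbrCount_deleteEdge_add hxy
  set K := G.deleteEdges {s(x, y)} with hK
  have hle : K ≤ G := SimpleGraph.deleteEdges_le _
  have hlt : K.edgeSet.ncard < n := by
    rw [← hn]
    refine Set.ncard_lt_ncard ?_ (Set.toFinite _)
    rw [SimpleGraph.edgeSet_ssubset_edgeSet]
    refine lt_of_le_of_ne hle fun h => ?_
    have : K.Adj x y := by rw [h]; exact hxy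
    simp [hK, SimpleGraph.deleteEdges_adj] at this
  obtain ⟨c, hc⟩ := ih _ hlt K (fun u v huv => hside (hle huv))
    (fun v => (nbrCount_mono hle v).trans (hdeg v)) rfl
  obtain ⟨a, ha⟩ := exists_misses K c x (by
    have h1 := hcount x
    have h2 := hdeg x
    rw [if_pos rfl] at h1
    omega)
  obtain ⟨b, hb⟩ := exists_misses K c y (by
    have h1 := hcount y
    have h2 := hdeg y
    rw [if_pos rfl] at h1
    omega)
  let R : V → V → Prop := fun u v => K.Adj u v ∧ c s(u, v) = if side u ↔ side x then b else a
  let S : Set V := {v | Relation.ReflTransGen R x v}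
  have hS : ∀ ⦃u v⦄, u ∈ S → (kempe K c a b).Adj u v → v ∈ S := by
    intro u v hu huv
    by_cases hR : R u v
    · exact Relation.ReflTransGen.tail hu hR
    have hcol : c s(u, v) = if side u ↔ side x then a else b := by
      have h1 := huv.2
      have h2 : ¬ c s(u, v) = if side u ↔ side x then b else a := fun h => hR ⟨huv.1, h⟩
      split_ifs at h2 ⊢ <;> tauto
    rcases Relation.ReflTransGen.cases_tail hu with rfl | ⟨w, hw, hwu⟩
    · rw [if_pos Iff.rfl] at hcol
      exact absurd hcol (ha huv.1)
    · have hcol' : c s(u, w) = if side u ↔ side x then a else b := by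
        rw [Sym2.eq_swap, hwu.2]
        have := hside (hle hwu.1)
        split_ifs <;> tauto
      by_contra hv
      have hne : v ≠ w := by
        rintro rfl
        exact hv hw
      exact hc huv.1 hwu.1.symm hne (hcol.trans hcol'.symm)
  have hyS : y ∉ S := by
    intro hy
    have hs := hside hxy
    rcases Relation.ReflTransGen.cases_tail hy with h | ⟨w, hw, hwy⟩
    · exact hxy.ne h.symm
    · have h1 := hside (hle hwy.1)
      have h2 := hwy.2
      rw [if_pos (by tauto), Sym2.eq_swap] at h2
      exact hb hwy.1.symm h2
  have hxS : x ∈ S := Relation.ReflTransGen.refl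
  refine ⟨_, (hc.swap_kempe hS).update (a := b)
    (Misses.kempeSwap_mem hxS (by rwa [Equiv.swap_apply_right]))
    (Misses.kempeSwap_notMem hS hyS hb) fun u v huv => ?_⟩
  rw [hK, SimpleGraph.deleteEdges_adj, Set.mem_singleton_iff]
  tauto

end Bipartite

section ListColoring

variable {W C : Type*}

open Classical in
/-- The number of neighbours of `w` in the finite set `S`. -/
noncomputable def nbrIn (Q : SimpleGraph W) (S : Finset W) (w : W) : ℕ :=
  (S.filter fun x => Q.Adj w x).card

/-- The subgraph induced on `S` has a proper coloring with colors from the lists `L`. -/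
def ListColorable (Q : SimpleGraph W) (L : W → Finset C) (S : Finset W) : Prop :=
  ∃ col : W → C, (∀ w ∈ S, col w ∈ L w) ∧ ∀ x ∈ S, ∀ y ∈ S, Q.Adj x y → col x ≠ col y

lemma nbrIn_mono (Q : SimpleGraph W) {S T : Finset W} (h : S ⊆ T) (w : W) :
    nbrIn Q S w ≤ nbrIn Q T w := by
  classical
  exact card_le_card (filter_subset_filter _ h)

lemma nbrIn_erase_add_one [DecidableEq W] {Q : SimpleGraph W} {S : Finset W} {e w : W}
    (he : e ∈ S) (h : Q.Adj w e) : nbrIn Q (S.erase e) w + 1 = nbrIn Q S w := by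
  classical
  unfold nbrIn
  rw [← card_erase_add_one (s := S.filter fun x => Q.Adj w x) (a := e) (by simp [he, h])]
  congr 2
  ext u
  simp only [mem_filter, mem_erase]
  tauto

/-- Greedy list coloring: it suffices that no list is shorter than the degree, and that each
component contains a vertex whose list is longer than its degree. -/
lemma listColorable_of_nbrIn_le [Nonempty C] (Q : SimpleGraph W) (L : W → Finset C)
    (S : Finset W) (hle : ∀ w ∈ S, nbrIn Q S w ≤ (L w).card)
    (hlt : ∀ D ⊆ S, D.Nonempty → (∀ x ∈ D, ∀ y ∈ S, Q.Adj x y → y ∈ D) →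
      ∃ w ∈ D, nbrIn Q S w < (L w).card) : ListColorable Q L S := by
  classical
  induction hn : S.card generalizing S with
  | zero =>
    rw [card_eq_zero] at hn
    subst hn
    exact ⟨fun _ => Classical.arbitrary C, by simp, by simp⟩
  | succ n ih =>
    obtain ⟨e, he, hes⟩ := hlt S subset_rfl (card_pos.1 (by omega)) fun _ _ y hy _ => hy
    have hsub : S.erase e ⊆ S := erase_subset _ _
    obtain ⟨col, h1, h2⟩ := ih (S.erase e)
      (fun w hw => (nbrIn_mono Q hsub w).trans (hle w (hsub hw))) (by
        intro D hD hDn hcl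
        by_cases h : ∃ x ∈ D, Q.Adj x e
        · obtain ⟨x, hx, hxe⟩ := h
          have a := nbrIn_erase_add_one he hxe
          have b := hle x (hsub (hD hx))
          exact ⟨x, hx, by omega⟩
        · push Not at h
          obtain ⟨w, hw, hw'⟩ := hlt D (hD.trans hsub) hDn fun x hx y hy hxy =>
            hcl x hx y (mem_erase.2 ⟨fun k => h x hx (k ▸ hxy), hy⟩) hxy
          exact ⟨w, hw, (nbrIn_mono Q hsub w).trans_lt hw'⟩)
      (by rw [card_erase_of_mem he]; omega)
    obtain ⟨α, hα, hα'⟩ : ∃ α ∈ L e, α ∉ (S.filter fun x => Q.Adj e x).image col :=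
      exists_mem_notMem_of_card_lt_card (card_image_le.trans_lt hes)
    have hα2 : ∀ x ∈ S, Q.Adj e x → col x ≠ α := fun x hx hex k =>
      hα' (mem_image.2 ⟨x, mem_filter.2 ⟨hx, hex⟩, k⟩)
    refine ⟨Function.update col e α, fun w hw => ?_, fun x hx y hy hxy => ?_⟩
    · by_cases hwe : w = e
      · subst hwe
        simpa using hα
      · rw [Function.update_of_ne hwe]
        exact h1 w (mem_erase.2 ⟨hwe, hw⟩)
    · by_cases hxe : x = e
      · subst hxe
        rw [Function.update_self, Function.update_of_ne hxy.ne.symm]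
        exact (hα2 y hy hxy).symm
      · rw [Function.update_of_ne hxe]
        by_cases hye : y = e
        · subst hye
          rw [Function.update_self]
          exact hα2 x hx hxy.symm
        · rw [Function.update_of_ne hye]
          exact h2 x (mem_erase.2 ⟨hxe, hx⟩) y (mem_erase.2 ⟨hye, hy⟩) hxy

lemma even_sum_nbrIn (Q : SimpleGraph W) (D : Finset W) : Even (∑ w ∈ D, nbrIn Q D w) := by
  classical
  have h := (Q.induce (D : Set W)).sum_degrees_eq_twice_card_edges
  rw [← sum_coe_sort]
  refine ⟨#(Q.induce (D : Set W)).edgeFinset, ?_⟩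
  rw [← two_mul, ← h]
  refine sum_congr rfl fun w _ => ?_
  rw [← SimpleGraph.card_neighborFinset_eq_degree, nbrIn, eq_comm]
  refine card_bij (fun x _ => x.1) ?_ (fun _ _ _ _ => Subtype.ext) ?_
  · intro x hx
    rw [SimpleGraph.mem_neighborFinset] at hx
    exact mem_filter.2 ⟨x.2, hx⟩
  · intro x hx
    obtain ⟨h1, h2⟩ := mem_filter.1 hx
    exact ⟨⟨x, h1⟩, by rw [SimpleGraph.mem_neighborFinset]; exact h2, rfl⟩

/-- A graph of maximum degree two can be colored from lists of size two as soon as, for each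
pair `P` of colors, the vertices with list `P` can be colored. -/
lemma listColorable_of_nbrIn_le_two [DecidableEq C] [Nonempty C] (Q : SimpleGraph W)
    (L : W → Finset C) (S : Finset W) (hdeg : ∀ w ∈ S, nbrIn Q S w ≤ 2)
    (hL : ∀ w ∈ S, 2 ≤ (L w).card)
    (hP : ∀ P : Finset C, P.card = 2 → ListColorable Q L (S.filter fun w => L w = P)) :
    ListColorable Q L S := by
  classical
  induction hn : S.card using Nat.strong_induction_on generalizing S with
  | _ n ih =>
  have hrec : ∀ T, T ⊂ S → ListColorable Q L T := fun T hT =>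
    ih T.card (hn ▸ card_lt_card hT) T
      (fun w hw => (nbrIn_mono Q hT.1 w).trans (hdeg w (hT.1 hw))) (fun w hw => hL w (hT.1 hw))
      (fun P hPc => by
        obtain ⟨col, h1, h2⟩ := hP P hPc
        have hs := filter_subset_filter (fun w => L w = P) hT.1
        exact ⟨col, fun w hw => h1 w (hs hw), fun x hx y hy => h2 x (hs hx) y (hs hy)⟩) rfl
  by_cases hconn : ∃ D ⊂ S, D.Nonempty ∧ ∀ x ∈ D, ∀ y ∈ S, Q.Adj x y → y ∈ D
  · obtain ⟨D, hDS, hDn, hcl⟩ := hconn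
    obtain ⟨c₁, h1, h2⟩ := hrec D hDS
    obtain ⟨c₂, h3, h4⟩ := hrec (S \ D) (sdiff_ssubset hDS.1 hDn)
    refine ⟨fun w => if w ∈ D then c₁ w else c₂ w, fun w hw => ?_, fun x hx y hy hxy => ?_⟩
    · by_cases hwD : w ∈ D
      · simpa [hwD] using h1 w hwD
      · simpa [hwD] using h3 w (mem_sdiff.2 ⟨hw, hwD⟩)
    · by_cases hxD : x ∈ D
      · have hyD := hcl x hxD y hy hxy
        simpa [hxD, hyD] using h2 x hxD y hyD hxy
      · have hyD : y ∉ D := fun k => hxD (hcl y k x hx hxy.symm)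
        simpa [hxD, hyD] using h4 x (mem_sdiff.2 ⟨hx, hxD⟩) y (mem_sdiff.2 ⟨hy, hyD⟩) hxy
  have hconn' : ∀ D ⊆ S, D.Nonempty → (∀ x ∈ D, ∀ y ∈ S, Q.Adj x y → y ∈ D) → D = S := by
    intro D hD hDn hcl
    by_contra hne
    exact hconn ⟨D, hD.ssubset_of_ne hne, hDn, hcl⟩
  by_cases hst : ∃ w ∈ S, nbrIn Q S w < (L w).card
  · refine listColorable_of_nbrIn_le Q L S (fun w hw => (hdeg w hw).trans (hL w hw)) ?_
    intro D hD hDn hcl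
    rwa [hconn' D hD hDn hcl]
  push Not at hst
  have hd2 : ∀ w ∈ S, nbrIn Q S w = 2 := fun w hw =>
    le_antisymm (hdeg w hw) ((hL w hw).trans (hst w hw))
  have hL2 : ∀ w ∈ S, (L w).card = 2 := fun w hw =>
    le_antisymm ((hst w hw).trans (hdeg w hw)) (hL w hw)
  by_cases hsame : ∀ e ∈ S, ∀ f ∈ S, Q.Adj e f → L e = L f
  · rcases S.eq_empty_or_nonempty with rfl | ⟨w₀, hw₀⟩
    · exact ⟨fun _ => Classical.arbitrary C, by simp, by simp⟩
    · have hall := hconn' (S.filter fun w => L w = L w₀) (filter_subset _ _)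
        ⟨w₀, mem_filter.2 ⟨hw₀, rfl⟩⟩ fun x hx y hy hxy => by
          obtain ⟨h1, h2⟩ := mem_filter.1 hx
          exact mem_filter.2 ⟨hy, (hsame x h1 y hy hxy).symm.trans h2⟩
      have := hP (L w₀) (hL2 w₀ hw₀)
      rwa [hall] at this
  push Not at hsame
  obtain ⟨e, he, f, hf, hef, hne⟩ := hsame
  obtain ⟨α, hα, hα'⟩ : ∃ α ∈ L e, α ∉ L f := by
    by_contra! h
    exact hne (eq_of_subset_of_card_le h (by rw [hL2 e he, hL2 f hf]))
  set L' : W → Finset C := fun w => if Q.Adj e w then (L w).erase α else L w with hL'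
  have hL'sub : ∀ w, L' w ⊆ L w := by
    intro w
    simp only [hL']
    split_ifs
    · exact erase_subset _ _
    · exact subset_rfl
  have hsub : S.erase e ⊆ S := erase_subset _ _
  have hdeg1 : ∀ w ∈ S, Q.Adj e w → nbrIn Q (S.erase e) w = 1 := by
    intro w hw hew
    have h1 := nbrIn_erase_add_one he hew.symm
    have h2 := hd2 w hw
    omega
  obtain ⟨col, h1, h2⟩ := listColorable_of_nbrIn_le Q L' (S.erase e) (by
    intro w hw
    by_cases hew : Q.Adj e w
    · rw [hdeg1 w (hsub hw) hew]
      simp only [hL', if_pos hew]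
      have := pred_card_le_card_erase (s := L w) (a := α)
      have := hL2 w (hsub hw)
      omega
    · simp only [hL', if_neg hew]
      exact (nbrIn_mono Q hsub w).trans
        ((hd2 w (hsub hw)).trans (hL2 w (hsub hw)).symm).le) (by
    intro D hD hDn hcl
    by_cases hfD : f ∈ D
    · refine ⟨f, hfD, ?_⟩
      rw [hdeg1 f hf hef]
      simp only [hL', if_pos hef, erase_eq_of_notMem hα', hL2 f hf, Nat.one_lt_two]
    exfalso
    by_cases hnb : ∃ x ∈ D, Q.Adj e x
    swap
    · push Not at hnb
      have := hconn' D (hD.trans hsub) hDn fun x hx y hy hxy =>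
        hcl x hx y (mem_erase.2 ⟨fun k => hnb x hx (k ▸ hxy.symm), hy⟩) hxy
      rw [← this] at he
      simpa using hD he
    obtain ⟨x, hx, hex⟩ := hnb
    have huniq : ∀ y ∈ D, Q.Adj e y → y = x := by
      intro y hy hey
      by_contra hyx
      have h3 : ({f, x, y} : Finset W).card ≤ nbrIn Q S e := by
        refine card_le_card fun z hz => ?_
        simp only [mem_insert, mem_singleton] at hz
        rcases hz with rfl | rfl | rfl
        · exact mem_filter.2 ⟨hf, hef⟩
        · exact mem_filter.2 ⟨hsub (hD hx), hex⟩
        · exact mem_filter.2 ⟨hsub (hD hy), hey⟩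
      rw [hd2 e he, card_eq_three.2 ⟨f, x, y, fun k => hfD (k ▸ hx), fun k => hfD (k ▸ hy),
        Ne.symm hyx, rfl⟩] at h3
      omega
    have hDdeg : ∀ w ∈ D, nbrIn Q D w + (if w = x then 1 else 0) = 2 := by
      intro w hw
      have hDw : nbrIn Q D w = nbrIn Q (S.erase e) w := by
        unfold nbrIn
        congr 1
        ext z
        simp only [mem_filter]
        exact ⟨fun k => ⟨hD k.1, k.2⟩, fun k => ⟨hcl w hw z k.1 k.2, k.2⟩⟩
      rw [hDw]
      split_ifs with hwx
      · subst hwx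
        rw [hdeg1 w (hsub (hD hw)) hex]
      · rw [← hd2 w (hsub (hD hw))]
        unfold nbrIn
        rw [add_zero]
        congr 1
        ext z
        simp only [mem_filter, mem_erase]
        refine ⟨fun k => ⟨k.1.2, k.2⟩, fun k => ⟨⟨?_, k.1⟩, k.2⟩⟩
        rintro rfl
        exact hwx (huniq w hw k.2.symm)
    have hsum := sum_congr rfl hDdeg
    rw [sum_add_distrib, sum_ite_eq' D x, if_pos hx, sum_const, smul_eq_mul] at hsum
    obtain ⟨r, hr⟩ := even_sum_nbrIn Q D
    omega)
  refine ⟨Function.update col e α, fun w hw => ?_, fun x hx y hy hxy => ?_⟩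
  · by_cases hwe : w = e
    · subst hwe
      simpa using hα
    · rw [Function.update_of_ne hwe]
      exact hL'sub w (h1 w (mem_erase.2 ⟨hwe, hw⟩))
  · have hcol : ∀ y ∈ S, Q.Adj e y → col y ≠ α := by
      intro y hy hey k
      have := h1 y (mem_erase.2 ⟨hey.ne.symm, hy⟩)
      simp only [hL', if_pos hey, mem_erase] at this
      exact this.1 k
    by_cases hxe : x = e
    · subst hxe
      rw [Function.update_self, Function.update_of_ne hxy.ne.symm]
      exact (hcol y hy hxy).symm
    · rw [Function.update_of_ne hxe]
      by_cases hye : y = e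
      · subst hye
        rw [Function.update_self]
        exact hcol x hx hxy.symm
      · rw [Function.update_of_ne hye]
        exact h2 x (mem_erase.2 ⟨hxe, hx⟩) y (mem_erase.2 ⟨hye, hy⟩) hxy

end ListColoring

section TotalColoring

variable {V : Type*} [Fintype V]

/-- Every graph of maximum degree at most `Δ` has a subgraph of small degrees whose complement
has maximum degree less than `Δ`, with vertices of degree `Δ - 1` pairwise nonadjacent and outside
the given independent set `I`. -/
lemma exists_subgraph_of_independent (G : SimpleGraph V) (I : V → Prop)
    (hI : ∀ ⦃u v⦄, G.Adj u v → I u → ¬ I v) {Δ : ℕ} (hΔ : 2 ≤ Δ)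
    (hdeg : ∀ v, nbrCount G v ≤ Δ) :
    ∃ H ≤ G,
      (∀ v, nbrCount G v + 1 ≤ Δ + nbrCount H v) ∧
      (∀ v, I v → nbrCount G v + 2 ≤ Δ + nbrCount H v) ∧
      (∀ v, ¬ I v → nbrCount H v ≤ 2) ∧
      (∀ v, I v → nbrCount H v ≤ 3) ∧
      (∀ ⦃v a⦄, I v → nbrCount H v = 3 → H.Adj v a → nbrCount H a ≤ 1) ∧
      (∀ ⦃u w⦄, ¬ I u → ¬ I w → (G \ H).Adj u w → nbrCount H u ≤ 1 → 2 ≤ nbrCount H w) := by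
  classical
  let g : V → ℕ := fun v => if I v then nbrCount G v + 2 - Δ else nbrCount G v + 1 - Δ
  let f : V → ℕ := fun v => if I v then 3 else 2
  obtain ⟨H, ⟨hHG, hH⟩, hmin⟩ := Set.exists_min_image
    {H : SimpleGraph V | H ≤ G ∧ ∀ v, g v ≤ nbrCount H v ∧ nbrCount H v ≤ f v}
    (fun H => ∑ v, (if I v then 3 else -1 : ℤ) * nbrCount H v) (Set.toFinite _) (by
      refine exists_subgraph_nbrCount_between G g f (fun v => ?_) (p := 2) (q := Δ) (by omega) hΔ
        (fun v => ?_) (fun v => ?_)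
      · have := hdeg v
        simp only [g, f]
        split_ifs <;> omega
      · have := hdeg v
        by_cases h : I v
        · obtain h2 | h2 | h2 : nbrCount G v + 2 - Δ = 0 ∨ nbrCount G v + 1 = Δ ∨
            nbrCount G v = Δ := by omega
          · simp [g, h, h2]
          · have h3 : nbrCount G v + 2 - Δ = 1 := by omega
            simp only [g, h, h3, if_true]
            omega
          · have h3 : nbrCount G v + 2 - Δ = 2 := by omega
            simp only [g, h, h3, if_true]
            omega
        · obtain h2 | h2 : nbrCount G v + 1 - Δ = 0 ∨ nbrCount G v = Δ := by omega
          · simp [g, h, h2]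
          · have h3 : nbrCount G v + 1 - Δ = 1 := by omega
            simp only [g, h, h3, if_false]
            omega
      · have := hdeg v
        simp only [f]
        split_ifs <;> omega)
  have hdrop : ∀ H' ≤ G, (∀ v, g v ≤ nbrCount H' v ∧ nbrCount H' v ≤ f v) →
      ∑ v, (if I v then 3 else -1 : ℤ) * nbrCount H v ≤
        ∑ v, (if I v then 3 else -1 : ℤ) * nbrCount H' v := fun H' h1 h2 => hmin H' ⟨h1, h2⟩
  refine ⟨H, hHG, fun v => ?_, fun v hv => ?_, fun v hv => ?_, fun v hv => ?_,
    fun v a hv h3 hva => ?_, fun u w hu hw huw hu1 => ?_⟩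
  · have := (hH v).1
    simp only [g] at this
    split_ifs at this <;> omega
  · have := (hH v).1
    simp only [g, if_pos hv] at this
    omega
  · simpa only [f, if_neg hv] using (hH v).2
  · simpa only [f, if_pos hv] using (hH v).2
  · by_contra! ha
    have hIa : ¬ I a := hI (hHG hva) hv
    have hcount := nbrCount_deleteEdge_add hva
    set D := H.deleteEdges {s(v, a)} with hD
    have hDH : D ≤ H := SimpleGraph.deleteEdges_le _
    have hle := hdrop D (hDH.trans hHG) fun x => by
      refine ⟨?_, (nbrCount_mono hDH x).trans (hH x).2⟩
      have h1 := hcount x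
      have h2 := (hH x).1
      by_cases hxv : x = v
      · subst hxv
        have h4 := hdeg x
        simp only [if_true, hva.ne, if_false] at h1
        simp only [g, if_pos hv]
        omega
      by_cases hxa : x = a
      · subst hxa
        have h4 := hdeg x
        simp only [if_true, hxv, if_false] at h1
        simp only [g, if_neg hIa]
        omega
      · simp only [hxv, hxa, if_false] at h1
        omega
    simp only [← hcount, Nat.cast_add, Nat.cast_ite, Nat.cast_one, Nat.cast_zero, mul_add,
      sum_add_distrib, mul_ite, mul_one, mul_zero, sum_ite_eq', mem_univ, if_true, if_pos hv,
      if_neg hIa] at hle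
    omega
  · by_contra! hw1
    have hcount := nbrCount_sup_edge huw.ne huw.2
    have hle := hdrop (H ⊔ SimpleGraph.edge u w)
      (sup_le hHG (by rw [SimpleGraph.edge_le_iff]; exact Or.inr huw.1)) fun x => by
        have h1 := hcount x
        have h2 := hH x
        refine ⟨by omega, ?_⟩
        by_cases hxu : x = u
        · subst hxu
          simp only [if_true, huw.ne, if_false] at h1
          simp only [f, if_neg hu]
          omega
        by_cases hxw : x = w
        · subst hxw
          simp only [if_true, hxu, if_false] at h1
          simp only [f, if_neg hw]
          omega
        · simp only [hxu, hxw, if_false] at h1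
          omega
    simp only [hcount, Nat.cast_add, Nat.cast_ite, Nat.cast_one, Nat.cast_zero, mul_add,
      sum_add_distrib, mul_ite, mul_one, mul_zero, sum_ite_eq', mem_univ, if_true, if_neg hu,
      if_neg hw] at hle
    omega

/-- The graph on unordered pairs in which distinct pairs with a common element are adjacent. -/
def touchGraph (V : Type*) : SimpleGraph (Sym2 V) where
  Adj e f := e ≠ f ∧ ∃ u, u ∈ e ∧ u ∈ f
  symm := ⟨fun _ _ h => ⟨h.1.symm, h.2.imp fun _ k => k.symm⟩⟩
  loopless := ⟨fun _ h => h.1 rfl⟩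

open Classical in
lemma nbrIn_touchGraph_le {H : SimpleGraph V} {u v : V} (h : H.Adj u v) :
    nbrIn (touchGraph V) (univ.filter fun e => e ∈ H.edgeSet) s(u, v) + 2 ≤
      nbrCount H u + nbrCount H v := by
  have hsub : ((univ.filter fun e => e ∈ H.edgeSet).filter fun e =>
      (touchGraph V).Adj s(u, v) e) ⊆
      ((univ.filter fun x => H.Adj u x).erase v).image (fun x => s(u, x)) ∪
        ((univ.filter fun x => H.Adj v x).erase u).image (fun x => s(v, x)) := by
    intro e he
    simp only [mem_filter, mem_univ, true_and] at he
    obtain ⟨heH, hne, w, hw, hwe⟩ := he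
    obtain ⟨x, rfl⟩ := Sym2.mem_iff_exists.1 hwe
    rw [SimpleGraph.mem_edgeSet] at heH
    rw [mem_union, mem_image, mem_image]
    rcases Sym2.mem_iff.1 hw with rfl | rfl
    · exact Or.inl ⟨x, mem_erase.2 ⟨fun k => hne (by rw [k]), by simpa using heH⟩, rfl⟩
    · exact Or.inr ⟨x, mem_erase.2 ⟨fun k => hne (by rw [k, Sym2.eq_swap]), by simpa using heH⟩,
        rfl⟩
  have h1 := (card_le_card hsub).trans (card_union_le _ _)
  have h2 := card_image_le (s := (univ.filter fun x => H.Adj u x).erase v)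
    (f := fun x => s(u, x))
  have h3 := card_image_le (s := (univ.filter fun x => H.Adj v x).erase u)
    (f := fun x => s(v, x))
  have h4 := card_erase_add_one (s := univ.filter fun x => H.Adj u x) (a := v) (by simpa using h)
  have h5 := card_erase_add_one (s := univ.filter fun x => H.Adj v x) (a := u)
    (by simpa using h.symm)
  unfold nbrIn nbrCount
  omega

/-- A graph of small degrees properly colored with `Fin 5` has a proper edge coloring avoiding
the color `4` and the colors of the endpoints. -/
lemma exists_edgeProper_of_coloring (H : SimpleGraph V) (c : V → Fin 5)
    (hc : ∀ ⦃u v⦄, H.Adj u v → c u ≠ c v) (h2 : ∀ v, c v ≠ 4 → nbrCount H v ≤ 2)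
    (h3 : ∀ v, c v = 4 → nbrCount H v ≤ 3)
    (hstar : ∀ ⦃v a⦄, c v = 4 → nbrCount H v = 3 → H.Adj v a → nbrCount H a ≤ 1) :
    ∃ col : Sym2 V → Fin 5, EdgeProper H col ∧
      ∀ ⦃u v⦄, H.Adj u v → col s(u, v) ≠ 4 ∧ col s(u, v) ≠ c u := by
  classical
  let L : Sym2 V → Finset (Fin 5) := fun e => univ.filter fun i => i ≠ 4 ∧ ∀ v ∈ e, c v ≠ i
  have hL : ∀ u v, L s(u, v) = ({4, c u, c v} : Finset (Fin 5))ᶜ := by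
    intro u v
    ext i
    simp only [L, mem_filter, mem_univ, true_and, Sym2.mem_iff, forall_eq_or_imp, forall_eq,
      mem_compl, mem_insert, mem_singleton]
    tauto
  have hdeg : ∀ ⦃u v⦄, H.Adj u v → nbrCount H u + nbrCount H v ≤ 4 := by
    have key : ∀ ⦃u v⦄, H.Adj u v → c v ≠ 4 → nbrCount H u + nbrCount H v ≤ 4 := by
      intro u v huv hv
      have e1 := h2 v hv
      by_cases hu : c u = 4
      · have e2 := h3 u hu
        by_cases e3 : nbrCount H u = 3
        · have := hstar hu e3 huv
          omega
        · omega
      · have := h2 u hu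
        omega
    intro u v huv
    by_cases hv : c v = 4
    · rw [add_comm]
      exact key huv.symm fun h => hc huv (h.trans hv.symm)
    · exact key huv hv
  obtain ⟨col, hcol, hcol'⟩ : ListColorable (touchGraph V) L
      (univ.filter fun e => e ∈ H.edgeSet) := by
    refine listColorable_of_nbrIn_le_two _ _ _ ?_ ?_ ?_
    · intro e he
      induction e using Sym2.ind with
      | _ u v =>
      have huv : H.Adj u v := by simpa using he
      have := hdeg huv
      have := nbrIn_touchGraph_le huv
      omega
    · intro e he
      induction e using Sym2.ind with
      | _ u v =>
      rw [hL, card_compl, Fintype.card_fin]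
      have := card_le_three (a := (4 : Fin 5)) (b := c u) (c := c v)
      omega
    · intro P hP
      let K : SimpleGraph V :=
        { Adj := fun u v => H.Adj u v ∧ L s(u, v) = P
          symm := ⟨fun u v h => ⟨h.1.symm, by rw [Sym2.eq_swap]; exact h.2⟩⟩
          loopless := ⟨fun u h => h.1.ne rfl⟩ }
      have hKH : K ≤ H := fun u v h => h.1
      have hPc : ∀ ⦃u v⦄, K.Adj u v → ({4, c u, c v} : Finset (Fin 5)) = Pᶜ := by
        intro u v h
        rw [← h.2, hL, compl_compl]
      have hK4 : ∀ ⦃u v⦄, K.Adj u v → c u ≠ 4 := by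
        intro u v h h4
        have h5 := congrArg Finset.card (hPc h)
        rw [card_compl, hP, Fintype.card_fin, h4, insert_eq_of_mem (by simp)] at h5
        have := card_le_two (a := (4 : Fin 5)) (b := c v)
        omega
      obtain ⟨p, hp⟩ : P.Nonempty := card_pos.1 (by omega)
      have : Nonempty P := ⟨⟨p, hp⟩⟩
      by_cases hne : ∃ x y, K.Adj x y
      swap
      · push Not at hne
        refine ⟨fun _ => p, fun e he => ?_, fun e he => ?_⟩ <;>
        · exfalso
          obtain ⟨h1, h2⟩ := mem_filter.1 he
          induction e using Sym2.ind with
          | _ u v => exact hne u v ⟨by simpa using h1, h2⟩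
      obtain ⟨x, y, hxy⟩ := hne
      obtain ⟨k, hk⟩ := exists_edgeProper_of_bipartite (C := P) K (fun v => c v = c x) (by
        intro u v huv
        have e1 := hc huv.1
        have e2 := hc hxy.1
        have e3 := hK4 huv
        have e4 := hK4 huv.symm
        have e5 := hK4 hxy
        have e6 := hK4 hxy.symm
        have e7 := (hPc huv).trans (hPc hxy).symm
        have m1 : c u ∈ ({4, c x, c y} : Finset (Fin 5)) := by rw [← e7]; simp
        have m2 : c v ∈ ({4, c x, c y} : Finset (Fin 5)) := by rw [← e7]; simp
        simp only [mem_insert, mem_singleton] at m1 m2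
        grind) (by
        intro v
        rw [Fintype.card_coe, hP]
        by_cases hv : c v = 4
        · rw [nbrCount_eq_zero fun u h => hK4 h hv]
          exact Nat.zero_le 2
        · exact (nbrCount_mono hKH v).trans (h2 v hv))
      refine ⟨fun e => k e, fun e he => ?_, fun e he f hf hef => ?_⟩
      · rw [(mem_filter.1 he).2]
        exact (k e).2
      · obtain ⟨hne, w, hwe, hwf⟩ := hef
        obtain ⟨u, rfl⟩ := Sym2.mem_iff_exists.1 hwe
        obtain ⟨v, rfl⟩ := Sym2.mem_iff_exists.1 hwf
        simp only [mem_filter, mem_univ, true_and, SimpleGraph.mem_edgeSet] at he hf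
        exact fun h => hk (u := w) (v := u) (w := v) he hf (fun h' => hne (by rw [h']))
          (Subtype.ext h)
  refine ⟨col, fun u v w huv huw hvw => ?_, fun u v huv => ?_⟩
  · exact hcol' _ (by simpa using huv) _ (by simpa using huw)
      ⟨fun h => hvw (Sym2.congr_right.1 h), u, by simp, by simp⟩
  · have := hcol s(u, v) (by simpa using huv)
    rw [hL, mem_compl, mem_insert, mem_insert] at this
    tauto

lemma totalChromaticNumber_le_three (G : SimpleGraph V) (h : ∀ v, nbrCount G v ≤ 1) :
    totalChromaticNumber G ≤ 3 := by
  classical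
  obtain ⟨col, -, hcol⟩ := listColorable_of_nbrIn_le G (fun _ => (univ : Finset (Fin 2))) univ
    (fun w _ => (h w).trans (by simp))
    (fun D _ ⟨w, hw⟩ _ => ⟨w, hw, (h w).trans_lt (by simp)⟩)
  refine Nat.sInf_le ⟨fun v => col v, fun _ => 2, ⟨fun u v huv => ?_, fun u v w huv huw hvw => ?_,
    fun u v _ => ⟨(col u).2.ne', (col v).2.ne'⟩⟩,
    fun v => (col v).2.trans (Nat.lt_succ_self 2), fun _ _ => Nat.lt_succ_self 2⟩
  · exact fun k => hcol u (mem_univ u) v (mem_univ v) huv (Fin.ext k)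
  · have := h u
    unfold nbrCount at this
    exact absurd (card_le_one.1 this v (by simpa using huv) w (by simpa using huw)) hvw

end TotalColoring

/-- every simple finite graph with chromatic number at most `5` has total
chromatic number at most `Δ(G) + 3`. -/
theorem weakTCC_of_five_colorable {V : Type*} [Fintype V] (G : SimpleGraph V)
    [DecidableRel G.Adj] (h : G.chromaticNumber ≤ 5) :
    totalChromaticNumber G ≤ G.maxDegree + 3 := by
  classical
  have hdeg : ∀ v, nbrCount G v ≤ G.maxDegree := fun v => by
    rw [nbrCount_eq_degree]
    exact G.degree_le_maxDegree v
  by_cases hΔ : G.maxDegree ≤ 1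
  · exact (totalChromaticNumber_le_three G fun v => (hdeg v).trans hΔ).trans (by omega)
  push Not at hΔ
  obtain ⟨c⟩ : G.Colorable 5 := SimpleGraph.chromaticNumber_le_iff_colorable.1 (by exact_mod_cast h)
  have hc : ∀ ⦃u v⦄, G.Adj u v → c u ≠ c v := fun u v huv => c.valid huv
  obtain ⟨H, hHG, hlow, hlowI, hup, hupI, hstar, hind⟩ := exists_subgraph_of_independent G
    (fun v => c v = 4) (fun u v huv hu hv => hc huv (hu.trans hv.symm)) hΔ hdeg
  generalize G.maxDegree = Δ at *
  have hF := nbrCount_sdiff_add hHG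
  obtain ⟨col, hcol, hcol'⟩ := exists_edgeProper_of_coloring H c (fun u v huv => hc (hHG huv))
    hup hupI hstar
  have : Nonempty (Fin (Δ - 1)) := ⟨⟨0, by omega⟩⟩
  obtain ⟨cF, hcF⟩ := exists_edgeProper_of_independent_core (C := Fin (Δ - 1)) (G \ H)
    (fun v => by
      rw [Fintype.card_fin]
      have := hF v
      have := hlow v
      omega)
    (fun u v huv hu => by
      rw [Fintype.card_fin] at hu ⊢
      have e1 := hF u
      have e2 := hF v
      have e3 := hdeg u
      have e4 := hdeg v
      by_cases h4u : c u = 4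
      · have := hlowI u h4u
        omega
      by_cases h4v : c v = 4
      · have := hlowI v h4v
        omega
      have := hind h4u h4v huv (by omega)
      omega)
  have hm : ∀ v, ∃ a, c v = 4 → Misses (G \ H) cF v a := by
    intro v
    by_cases hv : c v = 4
    · obtain ⟨a, ha⟩ := exists_misses (G \ H) cF v (by
        rw [Fintype.card_fin]
        have := hF v
        have := hlowI v hv
        omega)
      exact ⟨a, fun _ => ha⟩
    · exact ⟨Classical.arbitrary _, fun k => absurd k hv⟩
  choose m hm using hm
  have hlt4 : ∀ i : Fin 5, i ≠ 4 → (i : ℕ) < 4 := by decide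
  let cv : V → ℕ := fun v => if c v = 4 then 4 + m v else c v
  let ce : Sym2 V → ℕ := fun e => if e ∈ H.edgeSet then col e else 4 + cF e
  have hinc : ∀ ⦃u v⦄, G.Adj u v → ce s(u, v) ≠ cv u := by
    intro u v huv
    simp only [ce, cv, SimpleGraph.mem_edgeSet]
    by_cases hH : H.Adj u v
    · obtain ⟨e1, e2⟩ := hcol' hH
      have := hlt4 _ e1
      rw [if_pos hH]
      split_ifs with hu
      · omega
      · exact fun k => e2 (Fin.ext k)
    · rw [if_neg hH]
      split_ifs with hu
      · exact fun k => hm u hu ⟨huv, hH⟩ (Fin.ext (by omega))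
      · have := hlt4 _ hu
        omega
  refine Nat.sInf_le ⟨cv, ce, ⟨fun u v huv => ?_, fun u v w huv huw hvw => ?_, fun u v huv =>
    ⟨hinc huv, by rw [Sym2.eq_swap]; exact hinc huv.symm⟩⟩, fun v => ?_, fun e _ => ?_⟩
  · have hne := hc huv
    simp only [cv]
    split_ifs with hu hv hv
    · exact absurd (hu.trans hv.symm) hne
    · have := hlt4 _ hv
      omega
    · have := hlt4 _ hu
      omega
    · exact fun k => hne (Fin.ext k)
  · simp only [ce, SimpleGraph.mem_edgeSet]
    split_ifs with h1 h2 h2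
    · exact fun k => hcol h1 h2 hvw (Fin.ext k)
    · have := hlt4 _ (hcol' h1).1
      omega
    · have := hlt4 _ (hcol' h2).1
      omega
    · exact fun k => hcF ⟨huv, h1⟩ ⟨huw, h2⟩ hvw (Fin.ext (by omega))
  · have := (m v).2
    simp only [cv]
    split_ifs with hv
    · omega
    · have := hlt4 _ hv
      omega
  · have := (cF e).2
    have := (col e).2
    simp only [ce]
    split_ifs <;> omega
end

section
/- Let G be a simple finite graph with chromatic number χ(G) ≤ 4. Then the total chromatic number of G satisfies χ''(G) ≤ Δ(G) + 3, where Δ(G) is the maximum degree of G. -/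
open SimpleGraph

theorem exists_choice_ne_apply {T C : Type*} (s : T → T) (b : T → Bool) (hb : ∀ t, b (s t) = !b t)
    (L : T → Finset C) (hL : ∀ t, (L t).card = 2) :
    ∃ c : T → C, ∀ t, c t ∈ L t ∧ c t ≠ c (s t) := by
  classical
  cases isEmpty_or_nonempty T with
  | inl hT => exact ⟨isEmptyElim, isEmptyElim⟩
  | inr hT =>
  have : Nonempty C := by
    obtain ⟨x, -, -, -⟩ := Finset.card_eq_two.1 (hL hT.some)
    exact ⟨x⟩
  have hq : ∀ l : Finset C, ∃ q : Bool → C, l.card = 2 →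
      Function.Injective q ∧ ∀ x, x ∈ l ↔ ∃ β, q β = x := by
    intro l
    by_cases h : l.card = 2
    · obtain ⟨x, y, hxy, rfl⟩ := Finset.card_eq_two.1 h
      refine ⟨fun β => if β then x else y, fun _ => ⟨?_, ?_⟩⟩
      · intro β β' h
        cases β <;> cases β' <;> simp_all [eq_comm]
      · intro z
        simp [eq_comm, or_comm]
    · exact ⟨fun _ => this.some, fun h' => absurd h' h⟩
  choose q hq using hq
  have hz : ∀ t, ∃ z, L t ≠ L (s t) → q (L t) z ∉ L (s t) := by
    intro t
    by_contra! h
    refine (h true).1 (Finset.eq_of_subset_of_card_le (fun x hx => ?_) (by rw [hL, hL]))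
    obtain ⟨β, rfl⟩ := ((hq _ (hL t)).2 x).1 hx
    exact (h β).2
  choose z hz using hz
  let γ : T → Bool := fun t =>
    if h : ∃ n, L (s^[n] t) ≠ L (s (s^[n] t)) then
      (z (s^[Nat.find h] t) ^^ b (s^[Nat.find h] t)) else false
  have hγ_ne : ∀ t, L t ≠ L (s t) → γ t = (z t ^^ b t) := by
    intro t ht
    have h : ∃ n, L (s^[n] t) ≠ L (s (s^[n] t)) := ⟨0, ht⟩
    have h0 : Nat.find h = 0 := (Nat.find_eq_zero h).2 ht
    simp only [γ, dif_pos h, h0, Function.iterate_zero, id]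
  have hγ_eq : ∀ t, L t = L (s t) → γ t = γ (s t) := by
    intro t ht
    by_cases h : ∃ n, L (s^[n] (s t)) ≠ L (s (s^[n] (s t)))
    · have h' : ∃ n, L (s^[n] t) ≠ L (s (s^[n] t)) := by
        obtain ⟨n, hn⟩ := h
        exact ⟨n + 1, hn⟩
      have h0 : Nat.find h' = Nat.find h + 1 := Nat.find_comp_succ h' h (not_not.2 ht)
      simp only [γ, dif_pos h, dif_pos h', h0, Function.iterate_succ, Function.comp]
    · have h' : ¬ ∃ n, L (s^[n] t) ≠ L (s (s^[n] t)) := by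
        rintro ⟨_ | n, hn⟩
        · exact hn ht
        · exact h ⟨n, hn⟩
      simp only [γ, dif_neg h, dif_neg h']
  refine ⟨fun t => q (L t) (γ t ^^ b t), fun t => ⟨((hq _ (hL t)).2 _).2 ⟨_, rfl⟩, ?_⟩⟩
  by_cases ht : L t = L (s t)
  · intro h
    have h' : q (L t) (γ t ^^ b t) = q (L t) (γ (s t) ^^ b (s t)) := by
      rw [ht]
      simpa only [ht] using h
    have := (hq _ (hL t)).1 h'
    rw [← hγ_eq t ht, hb] at this
    simp at this
  · intro h
    apply hz t ht
    have h1 : (γ t ^^ b t) = z t := by rw [hγ_ne t ht]; simp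
    rw [← h1]
    exact ((hq _ (hL (s t))).2 _).2 ⟨_, h.symm⟩

theorem exists_bipartition_of_involutive {W : Type*} {m₁ m₂ : W → W}
    (h₁ : Function.Involutive m₁) (h₂ : Function.Involutive m₂)
    (hf₁ : ∀ w, m₁ w ≠ w) (hf₂ : ∀ w, m₂ w ≠ w) :
    ∃ b : W → Bool, (∀ w, b (m₁ w) = !b w) ∧ ∀ w, b (m₂ w) = !b w := by
  classical
  set x₁ : Equiv.Perm W := h₁.toPerm with hx₁
  set x₂ : Equiv.Perm W := h₂.toPerm with hx₂
  have e₁ : x₁⁻¹ = x₁ := rfl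
  have e₂ : x₂⁻¹ = x₂ := rfl
  set p : Equiv.Perm W := x₂ * x₁ with hp
  have hconj : x₁ * p * x₁⁻¹ = p⁻¹ := by
    rw [hp, mul_inv_rev, mul_assoc, mul_inv_cancel_right, e₁, e₂]
  have hzpow : ∀ (n : ℤ) w, x₁ ((p ^ n) w) = (p ^ (-n)) (x₁ w) := by
    intro n w
    have : x₁ * p ^ n = p ^ (-n) * x₁ := by
      rw [zpow_neg, ← inv_zpow, ← hconj, conj_zpow, inv_mul_cancel_right]
    exact congrArg (· w) this
  have hne : ∀ w, ¬ p.SameCycle w (x₁ w) := by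
    rintro w ⟨n, hn⟩
    obtain ⟨k, rfl | rfl⟩ := Int.even_or_odd' n
    · apply hf₁ ((p ^ k) w)
      change x₁ _ = _
      rw [hzpow, ← hn, ← Equiv.Perm.mul_apply, ← zpow_add]
      congr 2
      ring
    · apply hf₂ (x₁ ((p ^ k) w))
      change p ((p ^ k) w) = x₁ _
      rw [hzpow, ← hn, ← Equiv.Perm.mul_apply, ← Equiv.Perm.mul_apply, ← zpow_add, ← zpow_one_add]
      congr 2
      ring
  let Q := Quotient (Equiv.Perm.SameCycle.setoid p)
  obtain ⟨_, -⟩ := exists_wellFoundedLT Q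
  let c : W → Q := Quotient.mk _
  have hc : ∀ w w', c w = c w' ↔ p.SameCycle w w' := fun w w' => Quotient.eq
  have hc₁ : ∀ w w', c w = c w' → c (x₁ w) = c (x₁ w') := by
    intro w w' h
    rw [hc] at h ⊢
    rw [← Equiv.Perm.sameCycle_inv, ← hconj, Equiv.Perm.sameCycle_conj]
    simpa using h
  have hc₂ : ∀ w, c (x₂ w) = c (x₁ w) := by
    intro w
    rw [eq_comm, hc]
    exact ⟨1, by simp [hp, hx₁, h₁ w]⟩
  have hlt : ∀ w, decide (c (x₁ w) < c w) = !decide (c w < c (x₁ w)) := by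
    intro w
    have := mt (hc w (x₁ w)).1 (hne w)
    rcases lt_or_gt_of_ne this with h | h
    · simp [h, h.le]
    · simp [h, h.le]
  refine ⟨fun w => decide (c w < c (x₁ w)), fun w => ?_, fun w => ?_⟩
  · have : x₁ (x₁ w) = w := h₁ w
    rw [← hlt]
    change decide (c (x₁ w) < c (x₁ (x₁ w))) = _
    rw [this]
  · have : x₁ (x₁ w) = w := h₁ w
    rw [← hlt]
    change decide (c (x₂ w) < c (x₁ (x₂ w))) = _
    rw [hc₂, hc₁ _ _ (hc₂ w), this]

theorem exists_choice_ne_of_fixedPointFree {W C : Type*} {m₁ m₂ : W → W}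
    (h₁ : Function.Involutive m₁) (h₂ : Function.Involutive m₂)
    (hf₁ : ∀ w, m₁ w ≠ w) (hf₂ : ∀ w, m₂ w ≠ w) (L₁ L₂ : W → Finset C)
    (hL₁ : ∀ w, (L₁ w).card = 2) (hL₂ : ∀ w, (L₂ w).card = 2)
    (hm₁ : ∀ w, L₁ (m₁ w) = L₁ w) (hm₂ : ∀ w, L₂ (m₂ w) = L₂ w) :
    ∃ a₁ a₂ : W → C, ∀ w, a₁ w ∈ L₁ w ∧ a₂ w ∈ L₂ w ∧ a₁ (m₁ w) = a₁ w ∧ a₂ (m₂ w) = a₂ w ∧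
      a₁ w ≠ a₂ w := by
  obtain ⟨b, hb₁, hb₂⟩ := exists_bipartition_of_involutive h₁ h₂ hf₁ hf₂
  obtain ⟨c, hc⟩ := exists_choice_ne_apply (T := W × Bool)
    (fun t => if t.2 then (m₂ (m₁ t.1), false) else (t.1, true)) (fun t => t.2)
    (by rintro ⟨w, _ | _⟩ <;> rfl) (fun t => if t.2 then L₁ t.1 else L₂ t.1)
    (by rintro ⟨w, _ | _⟩ <;> simp [hL₁, hL₂])
  refine ⟨fun w => if b w then c (w, true) else c (m₁ w, true),
    fun w => if b w then c (w, false) else c (m₂ w, false), fun w => ?_⟩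
  have i₁ := h₁ w
  have i₂ := h₂ w
  have c1 := hc (w, true)
  have c2 := hc (w, false)
  have c3 := hc (m₁ w, true)
  have c4 := hc (m₂ w, false)
  cases hbw : b w
  · simp_all
  · simp_all [ne_comm (a := c (w, true))]

/-- The union of the two matchings given by `m₁` and `m₂` is 2-edge-choosable. -/
theorem exists_choice_ne_of_involutive {V C : Type*} {m₁ m₂ : V → V}
    (h₁ : Function.Involutive m₁) (h₂ : Function.Involutive m₂) (L₁ L₂ : V → Finset C)
    (hL₁ : ∀ v, (L₁ v).card = 2) (hL₂ : ∀ v, (L₂ v).card = 2)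
    (hm₁ : ∀ v, L₁ (m₁ v) = L₁ v) (hm₂ : ∀ v, L₂ (m₂ v) = L₂ v) :
    ∃ a₁ a₂ : V → C, ∀ v, a₁ v ∈ L₁ v ∧ a₂ v ∈ L₂ v ∧ a₁ (m₁ v) = a₁ v ∧ a₂ (m₂ v) = a₂ v ∧
      a₁ v ≠ a₂ v := by
  classical
  let M : (V → V) → V × Bool → V × Bool := fun m w => (m w.1, if m w.1 = w.1 then !w.2 else w.2)
  have hM : ∀ m : V → V, Function.Involutive m → Function.Involutive (M m) := by
    rintro m hm ⟨v, β⟩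
    by_cases h : m v = v
    · simp [M, h]
    · simp [M, h, hm v, Ne.symm h]
  have hMf : ∀ (m : V → V) (w), M m w ≠ w := by
    rintro m ⟨v, β⟩
    by_cases h : m v = v <;> simp [M, h]
  obtain ⟨a₁, a₂, h⟩ := exists_choice_ne_of_fixedPointFree (hM _ h₁) (hM _ h₂) (hMf m₁) (hMf m₂)
    (fun w => L₁ w.1) (fun w => L₂ w.1) (fun w => hL₁ _) (fun w => hL₂ _) (fun w => hm₁ _)
    (fun w => hm₂ _)
  refine ⟨fun v => a₁ (v, false), fun v => a₂ (v, false), fun v => ?_⟩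
  obtain ⟨h1, h2, h3, h4, h5⟩ := h (v, false)
  refine ⟨h1, h2, ?_, ?_, h5⟩
  · by_cases hv : m₁ v = v
    · rw [hv]
    · simpa [M, hv] using h3
  · by_cases hv : m₂ v = v
    · rw [hv]
    · simpa [M, hv] using h4

theorem card_fixed_le_two {V : Type*} [Fintype V] [DecidableEq V] {a b : V → V}
    {L : SimpleGraph V} (hadj : ∀ u v, L.Adj u v → v = a u ∨ v = b u) (K : L.ConnectedComponent)
    [DecidablePred (· ∈ K.supp)] :
    (Finset.univ.filter fun v => v ∈ K.supp ∧ a v = v).card ≤ 2 := by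
  classical
  have hconn := K.connected_toSimpleGraph
  have h1 := hconn.card_vert_le_card_edgeSet_add_one
  have h2 := K.toSimpleGraph.sum_degrees_eq_twice_card_edges
  have h3 : ∀ v : K, K.toSimpleGraph.degree v + (if a v = v then 1 else 0) ≤ 2 := by
    intro v
    have hsub : (K.toSimpleGraph.neighborFinset v).map (Function.Embedding.subtype _) ⊆
        ({a v, b v} : Finset V).erase v := by
      intro w hw
      simp only [Finset.mem_map, SimpleGraph.mem_neighborFinset] at hw
      obtain ⟨w, hw, rfl⟩ := hw
      have hw' : L.Adj v w := hw
      have := hadj _ _ hw'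
      have h3 := hw'.ne'
      simpa [h3] using this
    have := Finset.card_le_card hsub
    rw [Finset.card_map, SimpleGraph.card_neighborFinset_eq_degree] at this
    split_ifs with h
    · rw [h, Finset.erase_insert_eq_erase] at this
      have h4 := Finset.card_erase_le (s := {b v}) (a := (v : V))
      simp only [Finset.card_singleton] at h4
      omega
    · exact (this.trans (Finset.card_erase_le)).trans Finset.card_le_two
  have h4 := Finset.sum_le_sum (s := Finset.univ) fun v _ => h3 v
  rw [Finset.sum_add_distrib, h2] at h4
  have h5 : (Finset.univ.filter fun v => v ∈ K.supp ∧ a v = v).card =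
      ∑ v : K, if a v = v then 1 else 0 := by
    rw [Finset.sum_boole, Nat.cast_id, ← Finset.card_map (Function.Embedding.subtype _)]
    congr 1
    ext v
    simp only [Finset.mem_filter, Finset.mem_univ, true_and, Finset.mem_map, Subtype.exists,
      Function.Embedding.subtype_apply, exists_and_right, exists_eq_right, exists_prop]
    exact ⟨fun h => ⟨h.1, h.2⟩, fun ⟨h, h'⟩ => ⟨h, h'⟩⟩
  rw [h5]
  simp only [Finset.sum_const, Finset.card_univ, smul_eq_mul] at h4
  rw [Nat.card_eq_fintype_card, Nat.card_eq_fintype_card, ← SimpleGraph.edgeFinset_card] at h1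
  omega

/-- Some component of the union of the matchings `a` and `b` contains at most two vertices of `A`,
but more vertices of `A` than of `B`. -/
theorem exists_closed_excess {V : Type*} [Fintype V] [DecidableEq V] {a b : V → V}
    (ha : Function.Involutive a) (hb : Function.Involutive b) (A B : Finset V)
    (hA : ∀ v ∈ A, a v = v) (hAB : B.card < A.card) :
    ∃ K : Finset V, (∀ v, a v ∈ K ↔ v ∈ K) ∧ (∀ v, b v ∈ K ↔ v ∈ K) ∧
      (B ∩ K).card < (A ∩ K).card ∧ (A ∩ K).card ≤ 2 := by
  classical
  set L := SimpleGraph.fromRel fun u v => a u = v ∨ b u = v with hL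
  have hadj : ∀ u v, L.Adj u v → v = a u ∨ v = b u := by
    intro u v h
    rw [hL, SimpleGraph.fromRel_adj] at h
    obtain ⟨-, (h | h) | (h | h)⟩ := h
    · exact .inl h.symm
    · exact .inr h.symm
    · exact .inl (by rw [← h, ha])
    · exact .inr (by rw [← h, hb])
  have hmap : ∀ X : Finset V, X.card = ∑ K : L.ConnectedComponent,
      (X ∩ Finset.univ.filter fun v => v ∈ K.supp).card := by
    intro X
    rw [Finset.card_eq_sum_card_fiberwise (f := L.connectedComponentMk) (t := Finset.univ)
      (by intro x _; simp)]
    refine Finset.sum_congr rfl fun K _ => congrArg _ ?_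
    ext v
    simp
  rw [hmap A, hmap B] at hAB
  obtain ⟨K, -, hK⟩ := Finset.exists_lt_of_sum_lt hAB
  have hmk : ∀ v w, L.Adj v w ∨ v = w → (w ∈ K.supp ↔ v ∈ K.supp) := by
    rintro v w (h | rfl)
    · rw [K.mem_supp_iff, K.mem_supp_iff, SimpleGraph.ConnectedComponent.sound h.reachable]
    · rfl
  refine ⟨Finset.univ.filter (· ∈ K.supp), fun v => ?_, fun v => ?_, hK, ?_⟩
  · simpa using hmk v (a v) (by
      by_cases h : v = a v
      · exact .inr h
      · exact .inl (by simp [hL, h]))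
  · simpa using hmk v (b v) (by
      by_cases h : v = b v
      · exact .inr h
      · exact .inl (by simp [hL, h]))
  · refine (Finset.card_le_card ?_).trans (card_fixed_le_two hadj K)
    intro v hv
    simp only [Finset.mem_inter, Finset.mem_filter, Finset.mem_univ, true_and] at hv ⊢
    exact ⟨hv.2, hA v hv.1⟩

theorem exists_eq_one_or_add_three_le {ι : Type*} (C : Finset ι) (y : ι → ℕ)
    (hodd : Odd (∑ i ∈ C, y i)) (hlt : ∑ i ∈ C, y i < 2 * C.card) :
    (∃ i ∈ C, y i = 1) ∨ ∃ i ∈ C, ∃ j ∈ C, y j + 3 ≤ y i := by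
  by_contra! h
  obtain ⟨h1, h2⟩ := h
  obtain ⟨i, hi, hyi⟩ : ∃ i ∈ C, Odd (y i) := by
    by_contra! h
    refine Nat.not_even_iff_odd.2 hodd (Finset.even_sum _ fun i hi => ?_)
    exact Nat.not_odd_iff_even.1 (h i hi)
  have h3 : ∀ j ∈ C, 2 ≤ y j := by
    intro j hj
    have := h1 i hi
    have := h1 j hj
    have := h2 i hi j hj
    obtain ⟨k, hk⟩ := hyi
    omega
  have := Finset.card_nsmul_le_sum C y 2 h3
  rw [smul_eq_mul] at this
  have : C.sum y = ∑ i ∈ C, y i := rfl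
  omega

/-- At every vertex `u` of `N`, a set `S u` of colors missing at `u` is reserved, consisting of two
colors, or of a single one if `u = u₀`. The color classes are given as involutions `m i`. -/
structure IsReservation {V ι : Type*} [DecidableEq V] (C : Finset ι) (N : Finset V) (u₀ : V)
    (m : ι → V → V) (S : V → Finset ι) : Prop where
  involutive : ∀ i, Function.Involutive (m i)
  subset : ∀ u ∈ N, S u ⊆ C
  fixed : ∀ u ∈ N, ∀ i ∈ S u, m i u = u
  card_eq : ∀ u ∈ N, (S u).card = if u = u₀ then 1 else 2

theorem IsReservation.exists_kempe_change {V ι : Type*} [Fintype V] [DecidableEq V] [DecidableEq ι]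
    {C : Finset ι} {N : Finset V} {u₀ : V} {m : ι → V → V} {S : V → Finset ι}
    (h : IsReservation C N u₀ m S) {i j : ι} (hi : i ∈ C) (hj : j ∈ C)
    (hij : (N.filter (j ∈ S ·)).card + 3 ≤ (N.filter (i ∈ S ·)).card) :
    ∃ m' S', IsReservation C N u₀ m' S' ∧
      (∀ u v, (C.filter (m' · u = v)).card = (C.filter (m · u = v)).card) ∧
      ∑ l ∈ C, (N.filter (l ∈ S' ·)).card ^ 2 < ∑ l ∈ C, (N.filter (l ∈ S ·)).card ^ 2 := by
  obtain ⟨K, hKi, hKj, hlt, hle⟩ := exists_closed_excess (h.involutive i) (h.involutive j)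
    (N.filter (i ∈ S ·)) (N.filter (j ∈ S ·))
    (fun v hv => h.fixed v (Finset.mem_filter.1 hv).1 i (Finset.mem_filter.1 hv).2) (by omega)
  have hne : i ≠ j := by rintro rfl; omega
  set σ := Equiv.swap i j with hσ
  have hσi : σ i = j := Equiv.swap_apply_left i j
  have hσj : σ j = i := Equiv.swap_apply_right i j
  have hσl : ∀ l, l ≠ i → l ≠ j → σ l = l := fun l => Equiv.swap_apply_of_ne_of_ne
  have hσσ : ∀ l, σ (σ l) = l := fun l => Equiv.swap_apply_self i j l
  have hσC : ∀ l, σ l ∈ C ↔ l ∈ C := by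
    intro l
    by_cases h1 : l = i
    · simp [h1, hσi, hi, hj]
    by_cases h2 : l = j
    · simp [h2, hσj, hi, hj]
    rw [hσl l h1 h2]
  let m' : ι → V → V := fun l u => if u ∈ K then m (σ l) u else m l u
  let S' : V → Finset ι := fun u => if u ∈ K then (S u).map σ.toEmbedding else S u
  have hS' : ∀ l u, l ∈ S' u ↔ if u ∈ K then σ l ∈ S u else l ∈ S u := by
    intro l u
    by_cases hu : u ∈ K
    · simp only [S', if_pos hu, Finset.mem_map_equiv]
      rfl
    · simp only [S', if_neg hu]
  refine ⟨m', S', ⟨?_, ?_, ?_, ?_⟩, ?_, ?_⟩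
  · intro l u
    by_cases h1 : l = i
    · subst h1
      by_cases hu : u ∈ K
      · simp [m', hu, hσi, hKj, h.involutive j u]
      · simp [m', hu, hKi, h.involutive l u]
    by_cases h2 : l = j
    · subst h2
      by_cases hu : u ∈ K
      · simp [m', hu, hσj, hKi, h.involutive i u]
      · simp [m', hu, hKj, h.involutive l u]
    simp only [m', hσl l h1 h2, ite_self, h.involutive l u]
  · intro u hu l hl
    rw [hS'] at hl
    split_ifs at hl
    · exact (hσC l).1 (h.subset u hu hl)
    · exact h.subset u hu hl
  · intro u hu l hl
    rw [hS'] at hl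
    split_ifs at hl with hK
    · simp only [m', if_pos hK, h.fixed u hu _ hl]
    · simp only [m', if_neg hK, h.fixed u hu _ hl]
  · intro u hu
    rw [← h.card_eq u hu]
    by_cases hK : u ∈ K
    · simp only [S', if_pos hK, Finset.card_map]
    · simp only [S', if_neg hK]
  · intro u v
    by_cases hK : u ∈ K
    · simp only [m', if_pos hK]
      exact Finset.card_equiv σ fun l => by simp [hσC]
    · simp only [m', if_neg hK]
  · have hcard : ∀ (T : V → Finset ι) (l), (N.filter (l ∈ T ·)).card =
        (N.filter (l ∈ T ·) ∩ K).card + (N.filter (l ∈ T ·) \ K).card := fun T l =>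
      (Finset.card_inter_add_card_sdiff _ _).symm
    have hin : ∀ l, N.filter (l ∈ S' ·) ∩ K = N.filter (σ l ∈ S ·) ∩ K := by
      intro l
      ext u
      by_cases hK : u ∈ K <;> simp [hS', hK]
    have hout : ∀ l, N.filter (l ∈ S' ·) \ K = N.filter (l ∈ S ·) \ K := by
      intro l
      ext u
      by_cases hK : u ∈ K <;> simp [hS', hK]
    have hj' : j ∈ C.erase i := Finset.mem_erase.2 ⟨hne.symm, hj⟩
    rw [← Finset.add_sum_erase _ _ hi, ← Finset.add_sum_erase _ _ hj',
      ← Finset.add_sum_erase C _ hi, ← Finset.add_sum_erase (C.erase i) _ hj', ← add_assoc,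
      ← add_assoc]
    refine add_lt_add_of_lt_of_le ?_ (Finset.sum_le_sum fun l hl => ?_)
    · rw [hcard S i, hcard S j] at hij ⊢
      rw [hcard S' i, hcard S' j, hin, hin, hout, hout, hσi, hσj]
      generalize (N.filter (i ∈ S ·) ∩ K).card = p at *
      generalize (N.filter (j ∈ S ·) ∩ K).card = r at *
      interval_cases p <;> interval_cases r <;> nlinarith
    · simp only [Finset.mem_erase] at hl
      rw [hcard S', hin, hout, hσl l hl.2.1 hl.1, ← hcard]

theorem IsReservation.exists_card_eq_one {V ι : Type*} [Fintype V] [DecidableEq V] [DecidableEq ι]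
    {C : Finset ι} {N : Finset V} {u₀ : V} {m : ι → V → V} {S : V → Finset ι}
    (h : IsReservation C N u₀ m S) (hu₀ : u₀ ∈ N) (hN : N.card ≤ C.card) :
    ∃ m' S', IsReservation C N u₀ m' S' ∧
      (∀ u v, (C.filter (m' · u = v)).card = (C.filter (m · u = v)).card) ∧
      ∃ i ∈ C, (N.filter (i ∈ S' ·)).card = 1 := by
  induction hn : ∑ l ∈ C, (N.filter (l ∈ S ·)).card ^ 2 using Nat.strong_induction_on
    generalizing m S with
  | _ n ih =>
  subst hn
  have hsum : ∑ l ∈ C, (N.filter (l ∈ S ·)).card + 1 = 2 * N.card := by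
    have h1 : ∑ l ∈ C, (N.filter (l ∈ S ·)).card = ∑ u ∈ N, (S u).card := by
      rw [Finset.sum_congr rfl fun l _ => Finset.card_filter (l ∈ S ·) N, Finset.sum_comm]
      refine Finset.sum_congr rfl fun u hu => ?_
      rw [← Finset.card_filter, Finset.filter_mem_eq_inter,
        Finset.inter_eq_right.2 (h.subset u hu)]
    rw [h1, Finset.sum_congr rfl h.card_eq, ← Finset.add_sum_erase _ _ hu₀, if_pos rfl,
      Finset.sum_congr rfl (g := fun _ => 2) fun u hu => if_neg (Finset.ne_of_mem_erase hu),
      Finset.sum_const, Finset.card_erase_of_mem hu₀, smul_eq_mul]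
    have := Finset.card_pos.2 ⟨u₀, hu₀⟩
    omega
  rcases exists_eq_one_or_add_three_le C (fun l => (N.filter (l ∈ S ·)).card)
    (by rw [← Nat.not_even_iff_odd]; rintro ⟨k, hk⟩; omega) (by omega) with h1 | h3
  · exact ⟨m, S, h, fun _ _ => rfl, h1⟩
  · obtain ⟨i, hi, j, hj, hij⟩ := h3
    obtain ⟨m₁, S₁, h₁, hc₁, hlt⟩ := h.exists_kempe_change hi hj hij
    obtain ⟨m₂, S₂, h₂, hc₂, h⟩ := ih _ hlt h₁ rfl
    exact ⟨m₂, S₂, h₂, fun u v => (hc₂ u v).trans (hc₁ u v), h⟩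

/-- Permuting the colors at each vertex, an edge coloring can be changed so that the vertices of `N`
miss pairwise distinct colors. -/
theorem exists_recoloring {V ι : Type*} [Fintype V] [DecidableEq V] [DecidableEq ι] [Nonempty ι]
    {C : Finset ι} {N : Finset V} (u₀ : V) {m : ι → V → V} {S : V → Finset ι}
    (hm : ∀ i, Function.Involutive (m i)) (hN : N.card ≤ C.card) (hSC : ∀ u ∈ N, S u ⊆ C)
    (hS : ∀ u ∈ N, ∀ i ∈ S u, m i u = u)
    (hcard : ∀ u ∈ N, (if u = u₀ then 1 else 2) ≤ (S u).card) :
    ∃ (m' : ι → V → V) (f : V → ι), (∀ i, Function.Involutive (m' i)) ∧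
      (∀ u v, (C.filter (m' · u = v)).card = (C.filter (m · u = v)).card) ∧
      Set.InjOn f N ∧ ∀ u ∈ N, f u ∈ C ∧ m' (f u) u = u := by
  induction N using Finset.strongInduction generalizing C u₀ m S with
  | _ N ih =>
  rcases N.eq_empty_or_nonempty with rfl | hne
  · exact ⟨m, fun _ => Classical.arbitrary ι, hm, fun _ _ => rfl, by simp, by simp⟩
  obtain ⟨u₁, hu₁, hcard₁⟩ : ∃ u₁ ∈ N, ∀ u ∈ N, (if u = u₁ then 1 else 2) ≤ (S u).card := by
    by_cases hu₀ : u₀ ∈ N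
    · exact ⟨u₀, hu₀, hcard⟩
    · refine ⟨hne.choose, hne.choose_spec, fun u hu => ?_⟩
      have := hcard u hu
      rw [if_neg (by rintro rfl; exact hu₀ hu)] at this
      split_ifs <;> omega
  have hS₁ : ∀ u, ∃ T ⊆ S u, u ∈ N → T.card = if u = u₁ then 1 else 2 := by
    intro u
    by_cases hu : u ∈ N
    · obtain ⟨T, hT, hT'⟩ := Finset.exists_subset_card_eq (hcard₁ u hu)
      exact ⟨T, hT, fun _ => hT'⟩
    · exact ⟨S u, subset_rfl, fun h => absurd h hu⟩
  choose S₁ hS₁ hcS₁ using hS₁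
  have hres : IsReservation C N u₁ m S₁ :=
    ⟨hm, fun u hu => (hS₁ u).trans (hSC u hu), fun u hu i hi => hS u hu i (hS₁ u hi), hcS₁⟩
  obtain ⟨m₂, S₂, hres₂, hc₂, i, hi, hone⟩ := hres.exists_card_eq_one hu₁ hN
  obtain ⟨w, hw⟩ := Finset.card_eq_one.1 hone
  have hwi : ∀ u ∈ N, i ∈ S₂ u ↔ u = w := by
    intro u hu
    simpa [hu] using Finset.ext_iff.1 hw u
  have hwN : w ∈ N := (Finset.mem_filter.1 (hw.ge (Finset.mem_singleton_self w))).1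
  obtain ⟨m₃, f, hm₃, hc₃, hf, hf'⟩ := ih (N.erase w) (Finset.erase_ssubset hwN) (C := C.erase i)
    u₁ (m := m₂) (S := S₂) hres₂.involutive
    (by rw [Finset.card_erase_of_mem hwN, Finset.card_erase_of_mem hi]; omega)
    (fun u hu l hl => by
      obtain ⟨huw, hu⟩ := Finset.mem_erase.1 hu
      refine Finset.mem_erase.2 ⟨?_, hres₂.subset u hu hl⟩
      rintro rfl
      exact huw ((hwi u hu).1 hl))
    (fun u hu => hres₂.fixed u (Finset.mem_of_mem_erase hu))
    (fun u hu => (hres₂.card_eq u (Finset.mem_of_mem_erase hu)).ge)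
  refine ⟨fun l => if l = i then m₂ i else m₃ l, fun u => if u = w then i else f u, ?_, ?_, ?_, ?_⟩
  · intro l
    dsimp only
    split_ifs
    · exact hres₂.involutive i
    · exact hm₃ l
  · intro u v
    rw [← hc₂, Finset.card_filter, Finset.card_filter, ← Finset.add_sum_erase _ _ hi,
      ← Finset.add_sum_erase C _ hi]
    have := hc₃ u v
    rw [Finset.card_filter, Finset.card_filter] at this
    simp only [← this, if_true]
    congr 1
    exact Finset.sum_congr rfl fun l hl => by simp only [if_neg (Finset.ne_of_mem_erase hl)]
  · intro u hu v hv huv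
    have h1 : ∀ u ∈ N, u ≠ w → f u ≠ i := fun u hu huw =>
      Finset.ne_of_mem_erase (hf' u (Finset.mem_erase.2 ⟨huw, hu⟩)).1
    by_cases huw : u = w
    · by_cases hvw : v = w
      · rw [huw, hvw]
      · simp only [if_pos huw, if_neg hvw] at huv
        exact absurd huv.symm (h1 v hv hvw)
    · by_cases hvw : v = w
      · simp only [if_neg huw, if_pos hvw] at huv
        exact absurd huv (h1 u hu huw)
      · simp only [if_neg huw, if_neg hvw] at huv
        exact hf (by simpa [huw] using hu) (by simpa [hvw] using hv) huv
  · intro u hu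
    by_cases huw : u = w
    · simp only [if_pos huw, if_true]
      exact ⟨hi, hres₂.fixed u hu i ((hwi u hu).2 huw)⟩
    · obtain ⟨h1, h2⟩ := hf' u (Finset.mem_erase.2 ⟨huw, hu⟩)
      simp only [if_neg huw, if_neg (Finset.ne_of_mem_erase h1)]
      exact ⟨Finset.mem_of_mem_erase h1, h2⟩

/-- **Vizing's theorem**. The color classes are given as involutions, where `m i u = v ≠ u` means
that `uv` is an edge of color `i`. -/
theorem exists_involutive_edge_coloring {V : Type*} [Fintype V] [DecidableEq V] (G : SimpleGraph V)
    [DecidableRel G.Adj] :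
    ∃ m : ℕ → V → V, (∀ i, Function.Involutive (m i)) ∧
      ∀ u v, u ≠ v → ((Finset.range (G.maxDegree + 1)).filter (m · u = v)).card =
        if G.Adj u v then 1 else 0 := by
  set C := Finset.range (G.maxDegree + 1) with hC
  suffices h : ∀ A : Finset V, ∃ m : ℕ → V → V, (∀ i, Function.Involutive (m i)) ∧
      ∀ u v, u ≠ v → (C.filter (m · u = v)).card =
        if G.Adj u v ∧ u ∈ A ∧ v ∈ A then 1 else 0 by
    simpa using h Finset.univ
  intro A
  induction A using Finset.induction_on with
  | empty => exact ⟨fun _ => id, fun _ _ => rfl, fun u v h => by simp [h]⟩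
  | insert x A hx ih =>
  obtain ⟨m, hm, hmA⟩ := ih
  have hS : ∀ u ∈ A.filter (G.Adj x), 2 ≤ (C.filter (m · u = u)).card := by
    intro u hu
    obtain ⟨huA, hxu⟩ := Finset.mem_filter.1 hu
    have h1 : C.card = ∑ v, (C.filter (m · u = v)).card :=
      Finset.card_eq_sum_card_fiberwise (by simp)
    rw [← Finset.add_sum_erase _ _ (Finset.mem_univ u),
      Finset.sum_congr rfl fun v hv => hmA u v (Finset.ne_of_mem_erase hv).symm,
      ← Finset.card_filter] at h1
    have h2 : ((Finset.univ.erase u).filter fun v => G.Adj u v ∧ u ∈ A ∧ v ∈ A) ⊆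
        (G.neighborFinset u).erase x := by
      intro v hv
      simp only [Finset.mem_filter, Finset.mem_erase, SimpleGraph.mem_neighborFinset] at hv ⊢
      exact ⟨by rintro rfl; exact hx hv.2.2.2, hv.2.1⟩
    have h3 := Finset.card_le_card h2
    have h4 : x ∈ G.neighborFinset u := by simpa using hxu.symm
    have h5 := Finset.card_pos.2 ⟨x, h4⟩
    rw [Finset.card_erase_of_mem h4] at h3
    rw [SimpleGraph.card_neighborFinset_eq_degree] at h3 h5
    have h6 := G.degree_le_maxDegree u
    have h7 : C.card = G.maxDegree + 1 := Finset.card_range _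
    omega
  obtain ⟨m', f, hm', hc, hf, hfN⟩ := exists_recoloring (C := C) (N := A.filter (G.Adj x)) x hm
    (by
      refine (Finset.card_le_card (t := G.neighborFinset x) fun v hv => ?_).trans ?_
      · simpa using (Finset.mem_filter.1 hv).2
      · rw [SimpleGraph.card_neighborFinset_eq_degree, hC, Finset.card_range]
        exact (G.degree_le_maxDegree x).trans (Nat.le_succ _))
    (S := fun u => C.filter (m · u = u)) (fun u _ => Finset.filter_subset _ _)
    (fun u _ i hi => (Finset.mem_filter.1 hi).2)
    (fun u hu => le_trans (by split_ifs <;> omega) (hS u hu))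
  have hx' : ∀ i ∈ C, m' i x = x := by
    intro i hi
    by_contra h
    have h1 := (hc x (m' i x)).trans (hmA x _ (Ne.symm h))
    rw [if_neg (by simp [hx]), Finset.card_eq_zero] at h1
    exact Finset.notMem_empty i (h1 ▸ Finset.mem_filter.2 ⟨hi, rfl⟩)
  have hg : ∀ i, ∃ w, (∀ v, v ≠ x → (w = v ↔ v ∈ A.filter (G.Adj x) ∧ f v = i)) := by
    intro i
    by_cases h : ∃ w ∈ A.filter (G.Adj x), f w = i
    · obtain ⟨w, hw, rfl⟩ := h
      refine ⟨w, fun v _ => ⟨?_, fun hv => hf hw hv.1 hv.2.symm⟩⟩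
      rintro rfl
      exact ⟨hw, rfl⟩
    · exact ⟨x, fun v hv => ⟨fun hxv => absurd hxv.symm hv, fun hv => absurd ⟨v, hv⟩ h⟩⟩
  choose g hg using hg
  have hgC : ∀ i, g i = x ∨ i ∈ C ∧ m' i (g i) = g i ∧ m' i x = x := by
    intro i
    by_cases h : g i = x
    · exact .inl h
    · obtain ⟨h1, h2⟩ := (hg i _ h).1 rfl
      have h3 := hfN _ h1
      rw [h2] at h3
      exact .inr ⟨h3.1, h3.2, hx' i h3.1⟩
  let m'' : ℕ → V → V := fun i u => m' i (Equiv.swap x (g i) u)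
  have hm'' : ∀ i, Function.Involutive (m'' i) := by
    intro i u
    rcases hgC i with h | ⟨-, h1, h2⟩
    · simp [m'', h, hm' i u]
    · by_cases hux : u = x
      · simp [m'', hux, h1, h2]
      by_cases hug : u = g i
      · simp [m'', hug, h1, h2]
      have h3 : m' i u ≠ x := fun h => hux (by rw [← hm' i u, h, h2])
      have h4 : m' i u ≠ g i := fun h => hug (by rw [← hm' i u, h, h1])
      simp [m'', Equiv.swap_apply_of_ne_of_ne, hux, hug, h3, h4, hm' i u]
  have hcx : ∀ v, v ≠ x → (C.filter (m'' · x = v)).card =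
      if G.Adj x v ∧ v ∈ A then 1 else 0 := by
    intro v hv
    have h1 : C.filter (m'' · x = v) =
        if G.Adj x v ∧ v ∈ A then {f v} else ∅ := by
      ext i
      have h2 : i ∈ C → m'' i x = g i := by
        intro hi
        simp only [m'', Equiv.swap_apply_left]
        rcases hgC i with h | ⟨-, h, -⟩
        · rw [h, hx' i hi]
        · exact h
      have h3 : v ∈ A.filter (G.Adj x) ↔ G.Adj x v ∧ v ∈ A := by simp [and_comm]
      simp only [← h3, Finset.mem_filter (p := (m'' · x = v))]
      constructor
      · rintro ⟨hi, h⟩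
        rw [h2 hi, hg i v hv] at h
        rw [if_pos h.1, h.2]
        simp
      · split_ifs with h
        · intro hi
          obtain rfl := Finset.mem_singleton.1 hi
          have := (hfN v h).1
          exact ⟨this, by rw [h2 this, hg _ v hv]; exact ⟨h, rfl⟩⟩
        · simp
    rw [h1]
    split_ifs <;> simp
  refine ⟨m'', hm'', fun u v huv => ?_⟩
  by_cases hux : u = x
  · subst hux
    rw [hcx v huv.symm]
    simp [huv.symm]
  by_cases hvx : v = x
  · subst hvx
    have h1 : ∀ i, m'' i u = v ↔ m'' i v = u := fun i => (hm'' i).eq_iff.trans eq_comm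
    simp only [h1, hcx u hux]
    simp [hux, G.adj_comm]
  · have h1 : ∀ i, m'' i u = v ↔ m' i u = v := by
      intro i
      by_cases hug : u = g i
      · rcases hgC i with h | ⟨-, h1, h2⟩
        · exact absurd (hug.trans h) hux
        · simp only [m'']
          rw [hug, Equiv.swap_apply_right, h1, h2, ← hug]
          exact ⟨fun h => absurd h.symm hvx, fun h => absurd h huv⟩
      · simp only [m'', Equiv.swap_apply_of_ne_of_ne hux hug]
    simp only [h1, hc, hmA u v huv, Finset.mem_insert, hux, hvx, false_or]

/-- every simple finite graph with chromatic number at most `4` has total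
chromatic number at most `Δ(G) + 3`. -/
theorem weakTCC_of_four_colorable {V : Type*} [Fintype V] (G : SimpleGraph V)
    [DecidableRel G.Adj] (h : G.chromaticNumber ≤ 4) :
    totalChromaticNumber G ≤ G.maxDegree + 3 := by
  classical
  apply Nat.sInf_le
  rcases Nat.eq_zero_or_pos G.maxDegree with h0 | hpos
  · have hG : ∀ u v, ¬ G.Adj u v := by
      intro u v huv
      have h1 := (G.degree_pos_iff_exists_adj u).2 ⟨v, huv⟩
      have h2 := G.degree_le_maxDegree u
      omega
    exact ⟨fun _ => 0, fun _ => 0, ⟨fun u v huv => absurd huv (hG u v),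
      fun u v w huv => absurd huv (hG u v), fun u v huv => absurd huv (hG u v)⟩,
      fun _ => Nat.succ_pos _, fun _ _ => Nat.succ_pos _⟩
  obtain ⟨c⟩ : G.Colorable 4 := SimpleGraph.chromaticNumber_le_iff_colorable.1 (by exact_mod_cast h)
  obtain ⟨m, hm, hmG⟩ := exists_involutive_edge_coloring G
  let L : ℕ → V → Finset (Fin 4) := fun i v =>
    if c v = c (m i v) then {0, 1} else {c v, c (m i v)}ᶜ
  have hL : ∀ i v, (L i v).card = 2 := by
    intro i v
    simp only [L]
    split_ifs with h
    · rfl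
    · rw [Finset.card_compl, Finset.card_pair h, Fintype.card_fin]
  have hLm : ∀ i v, L i (m i v) = L i v := by
    intro i v
    simp only [L, hm i v, eq_comm (a := c (m i v)), Finset.pair_comm (c (m i v))]
  obtain ⟨a₀, a₁, ha⟩ := exists_choice_ne_of_involutive (hm 0) (hm 1) (L 0) (L 1) (hL 0) (hL 1)
    (hLm 0) (hLm 1)
  let col : ℕ → V → ℕ := fun i v => if i = 0 then a₀ v else if i = 1 then a₁ v else i + 2
  have hcol : ∀ i v, col i (m i v) = col i v := by
    intro i v
    simp only [col]
    split_ifs with h0 h1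
    · rw [h0, (ha v).2.2.1]
    · rw [h1, (ha v).2.2.2.1]
    · rfl
  have hcol_ne : ∀ i j v, i ≠ j → col i v ≠ col j v := by
    intro i j v hij
    have h1 := Fin.val_ne_of_ne (ha v).2.2.2.2
    have h2 := (a₀ v).isLt
    have h3 := (a₁ v).isLt
    simp only [col]
    split_ifs <;> omega
  have hcol_vertex : ∀ i v, G.Adj v (m i v) → col i v ≠ c v := by
    intro i v hv
    have hLv : c v ∉ L i v := by
      simp only [L, if_neg (c.valid hv)]
      simp
    have h2 := (c v).isLt
    simp only [col]
    split_ifs with h0 h1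
    · subst h0
      exact Fin.val_ne_of_ne fun h => hLv (h ▸ (ha v).1)
    · subst h1
      exact Fin.val_ne_of_ne fun h => hLv (h ▸ (ha v).2.1)
    · omega
  have hcol_lt : ∀ i v, i < G.maxDegree + 1 → col i v < G.maxDegree + 3 := by
    intro i v hi
    have h2 := (a₀ v).isLt
    have h3 := (a₁ v).isLt
    simp only [col]
    split_ifs <;> omega
  have hce : ∀ e : Sym2 V, ∃ k, ∀ u v, e = s(u, v) → G.Adj u v →
      ∃ i < G.maxDegree + 1, m i u = v ∧ k = col i u := by
    intro e
    induction e with | _ x y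
    by_cases hxy : G.Adj x y
    · have h1 := hmG x y hxy.ne
      rw [if_pos hxy] at h1
      obtain ⟨i, hi⟩ := Finset.card_pos.1 (h1 ▸ Nat.one_pos)
      obtain ⟨hi, hixy⟩ := Finset.mem_filter.1 hi
      refine ⟨col i x, fun u v huv _ => ⟨i, Finset.mem_range.1 hi, ?_⟩⟩
      obtain ⟨rfl, rfl⟩ | ⟨rfl, rfl⟩ := Sym2.eq_iff.1 huv
      · exact ⟨hixy, rfl⟩
      · exact ⟨by rw [← hixy, hm], by rw [← hixy, hcol]⟩
    · refine ⟨0, fun u v huv h => absurd ?_ hxy⟩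
      rwa [← SimpleGraph.mem_edgeSet, huv]
  choose ce hce using hce
  have hce_left : ∀ u v, G.Adj u v → ce s(u, v) ≠ c u := by
    intro u v huv
    obtain ⟨i, -, rfl, hi⟩ := hce _ u v rfl huv
    rw [hi]
    exact hcol_vertex i u huv
  refine ⟨fun v => c v, ce, ⟨fun u v huv => Fin.val_ne_of_ne (c.valid huv), ?_, ?_⟩, ?_, ?_⟩
  · intro u v w huv huw hvw
    obtain ⟨i, -, rfl, hi⟩ := hce _ u v rfl huv
    obtain ⟨j, -, rfl, hj⟩ := hce _ u w rfl huw
    rw [hi, hj]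
    exact hcol_ne i j u fun hij => hvw (by rw [hij])
  · intro u v huv
    exact ⟨hce_left u v huv, Sym2.eq_swap (a := u) ▸ hce_left v u huv.symm⟩
  · intro v
    have := (c v).isLt
    change (c v : ℕ) < _
    omega
  · intro e he
    induction e with | _ u v
    obtain ⟨i, hi, -, h⟩ := hce _ u v rfl he
    rw [h]
    exact hcol_lt i u hi
end

section
/- Let F be a class of simple finite graphs closed under taking subgraphs. If every graph G in F satisfies χ''(G) ≤ Δ(G) + 3 (i.e., the weak Total Coloring Conjecture holds for F), then every total graph T(G) with G in F satisfies Hadwiger's conjecture, i.e., χ(T(G)) ≤ η(T(G)). -/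
open SimpleGraph

universe u

section TotalColoring

variable {V : Type*} {α : Type*}

/-- `cv`, `ce` form a total coloring of `G` with colors in an arbitrary type. -/
structure TotalColoringPair (G : SimpleGraph V) (cv : V → α) (ce : Sym2 V → α) : Prop where
  vertex : ∀ ⦃u v⦄, G.Adj u v → cv u ≠ cv v
  edge : ∀ ⦃u v w⦄, G.Adj u v → G.Adj u w → v ≠ w → ce s(u, v) ≠ ce s(u, w)
  incident : ∀ ⦃u v⦄, G.Adj u v → ce s(u, v) ≠ cv u

lemma TotalColoringPair.comp {β : Type*} {G : SimpleGraph V} {cv : V → α} {ce : Sym2 V → α}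
    (h : TotalColoringPair G cv ce) {σ : α → β} (hσ : Function.Injective σ) :
    TotalColoringPair G (σ ∘ cv) (σ ∘ ce) :=
  ⟨fun _ _ huv => hσ.ne (h.vertex huv), fun _ _ _ huv huw hvw => hσ.ne (h.edge huv huw hvw),
    fun _ _ huv => hσ.ne (h.incident huv)⟩

/-- `G` has a total coloring with colors in `α`. -/
def TotalColorable (G : SimpleGraph V) (α : Type*) : Prop :=
  ∃ (cv : V → α) (ce : Sym2 V → α), TotalColoringPair G cv ce

lemma totalGraph_adj_inl_inl {G : SimpleGraph V} {u v : V} :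
    (totalGraph G).Adj (Sum.inl u) (Sum.inl v) ↔ G.Adj u v := by
  simp only [totalGraph, fromRel_adj, ne_eq, Sum.inl.injEq]
  exact ⟨fun h => h.2.elim id fun h => h.symm, fun h => ⟨h.ne, Or.inl h⟩⟩

lemma totalGraph_adj_inl_inr {G : SimpleGraph V} {u : V} {e : G.edgeSet} :
    (totalGraph G).Adj (Sum.inl u) (Sum.inr e) ↔ u ∈ (e : Sym2 V) := by
  simp [totalGraph]

lemma totalGraph_adj_inr_inl {G : SimpleGraph V} {u : V} {e : G.edgeSet} :
    (totalGraph G).Adj (Sum.inr e) (Sum.inl u) ↔ u ∈ (e : Sym2 V) := by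
  simp [totalGraph]

lemma totalGraph_adj_inr_inr {G : SimpleGraph V} {e f : G.edgeSet} :
    (totalGraph G).Adj (Sum.inr e) (Sum.inr f) ↔
      e ≠ f ∧ ∃ u, u ∈ (e : Sym2 V) ∧ u ∈ (f : Sym2 V) := by
  simp only [totalGraph, fromRel_adj, ne_eq, Sum.inr.injEq]
  refine and_congr_right fun _ => ⟨fun h => h.elim id ?_, Or.inl⟩
  rintro ⟨u, h₁, h₂⟩
  exact ⟨u, h₂, h₁⟩

lemma TotalColorable.colorable_totalGraph {G : SimpleGraph V} {m : ℕ}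
    (h : TotalColorable G (Fin m)) : (totalGraph G).Colorable m := by
  obtain ⟨cv, ce, h⟩ := h
  refine ⟨Coloring.mk (Sum.elim cv fun e => ce e) ?_⟩
  rintro (u | ⟨e, he⟩) (v | ⟨f, hf⟩) hadj
  · exact h.vertex (totalGraph_adj_inl_inl.1 hadj)
  · obtain ⟨x, rfl⟩ := Sym2.mem_iff_exists.1 (totalGraph_adj_inl_inr.1 hadj)
    exact (h.incident hf).symm
  · obtain ⟨x, rfl⟩ := Sym2.mem_iff_exists.1 (totalGraph_adj_inr_inl.1 hadj)
    exact h.incident he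
  · obtain ⟨hne, u, hu, hu'⟩ := totalGraph_adj_inr_inr.1 hadj
    obtain ⟨x, rfl⟩ := Sym2.mem_iff_exists.1 hu
    obtain ⟨y, rfl⟩ := Sym2.mem_iff_exists.1 hu'
    refine h.edge he hf ?_
    rintro rfl
    exact hne rfl

lemma totalColorable_spanningCoe {G : SimpleGraph V} {H : G.Subgraph} {m : ℕ} (hm : 0 < m)
    (h : (totalGraph H.coe).Colorable m) : TotalColorable H.spanningCoe (Fin m) := by
  classical
  obtain ⟨c⟩ := h
  let z : Fin m := ⟨0, hm⟩
  let cv : V → Fin m := fun x => if h : x ∈ H.verts then c (Sum.inl ⟨x, h⟩) else z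
  let ce : Sym2 V → Fin m := fun e =>
    if h : ∃ e' : H.coe.edgeSet, Sym2.map Subtype.val e'.1 = e then c (Sum.inr h.choose) else z
  have hcv : ∀ x (hx : x ∈ H.verts), cv x = c (Sum.inl ⟨x, hx⟩) := fun x hx => by simp [cv, hx]
  have hce : ∀ x y (hxy : H.Adj x y), ce s(x, y) =
      c (Sum.inr ⟨s(⟨x, hxy.fst_mem⟩, ⟨y, hxy.snd_mem⟩), hxy.coe⟩) := by
    intro x y hxy
    have hex : ∃ e' : H.coe.edgeSet, Sym2.map Subtype.val e'.1 = s(x, y) :=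
      ⟨⟨s(⟨x, hxy.fst_mem⟩, ⟨y, hxy.snd_mem⟩), hxy.coe⟩, rfl⟩
    have hval : hex.choose = ⟨s(⟨x, hxy.fst_mem⟩, ⟨y, hxy.snd_mem⟩), hxy.coe⟩ :=
      Subtype.ext (Sym2.map.injective Subtype.val_injective hex.choose_spec)
    simp only [ce, dif_pos hex, hval]
  refine ⟨cv, ce, ?_, ?_, ?_⟩
  · intro u v huv
    replace huv : H.Adj u v := huv
    rw [hcv u huv.fst_mem, hcv v huv.snd_mem]
    exact c.valid (totalGraph_adj_inl_inl.2 huv.coe)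
  · intro u v w huv huw hvw
    replace huv : H.Adj u v := huv
    replace huw : H.Adj u w := huw
    rw [hce u v huv, hce u w huw]
    refine c.valid (totalGraph_adj_inr_inr.2 ⟨?_, ⟨u, huv.fst_mem⟩, by simp, by simp⟩)
    intro heq
    apply hvw
    exact congrArg Subtype.val (Sym2.congr_right.1 (congrArg Subtype.val heq))
  · intro u v huv
    replace huv : H.Adj u v := huv
    rw [hce u v huv, hcv u huv.fst_mem]
    exact c.valid (totalGraph_adj_inr_inl.2 (by simp))

lemma totalColorable_of_totalChromaticNumber_le [Finite V] {G : SimpleGraph V} {k : ℕ}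
    (hk : totalChromaticNumber G ≤ k + 1) : TotalColorable G (Fin (k + 1)) := by
  have hne : {k | ∃ cv ce, IsTotalColoring G cv ce ∧ (∀ v, cv v < k) ∧
      ∀ e ∈ G.edgeSet, ce e < k}.Nonempty := by
    obtain ⟨n, ⟨f⟩⟩ := Finite.exists_equiv_fin (V ⊕ Sym2 V)
    refine ⟨n, fun v => f (Sum.inl v), fun e => f (Sum.inr e), ⟨?_, ?_, ?_⟩,
      fun v => (f _).isLt, fun e _ => (f _).isLt⟩
    · intro u v h
      simpa [Fin.val_inj] using h.ne
    · intro u v w _ _ h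
      simpa only [ne_eq, Fin.val_inj, EmbeddingLike.apply_eq_iff_eq, Sum.inr.injEq,
        Sym2.congr_right] using h
    · intro u v _
      simp [Fin.val_inj]
  obtain ⟨cv, ce, ⟨h₁, h₂, h₃⟩, hv, he⟩ := Nat.sInf_mem hne
  replace hv : ∀ v, cv v < k + 1 := fun v => (hv v).trans_le hk
  replace he : ∀ ⦃u v⦄, G.Adj u v → ce s(u, v) < k + 1 := fun u v h => (he _ h).trans_le hk
  refine ⟨fun v => Fin.ofNat (k + 1) (cv v), fun e => Fin.ofNat (k + 1) (ce e), ?_, ?_, ?_⟩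
  · intro u v h
    simpa [Fin.ext_iff, Nat.mod_eq_of_lt (hv _)] using h₁ h
  · intro u v w h h' hne
    simpa [Fin.ext_iff, Nat.mod_eq_of_lt (he h), Nat.mod_eq_of_lt (he h')] using h₂ h h' hne
  · intro u v h
    simpa [Fin.ext_iff, Nat.mod_eq_of_lt (he h), Nat.mod_eq_of_lt (hv _)] using (h₃ h).1

end TotalColoring

section CliqueMinor

variable {V W W' : Type*}

lemma connected_induce_of_closed {H : SimpleGraph W} {s : Set W} {r : W} (hr : r ∈ s)
    (h : ∀ Q : W → Prop, Q r → (∀ x ∈ s, ∀ y ∈ s, H.Adj x y → Q x → Q y) → ∀ x ∈ s, Q x) :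
    (H.induce s).Connected := by
  rw [connected_iff_exists_forall_reachable]
  refine ⟨⟨r, hr⟩, fun ⟨w, hw⟩ => ?_⟩
  obtain ⟨_, hreach⟩ := h (fun x => ∃ hx : x ∈ s, (H.induce s).Reachable ⟨r, hr⟩ ⟨x, hx⟩)
    ⟨hr, Reachable.refl _⟩
    (fun x _ y hy hxy ⟨hx, hrx⟩ => ⟨hy, hrx.trans (Adj.reachable (by simpa using hxy))⟩) w hw
  exact hreach

lemma HasCliqueMinor.of_fintype {H : SimpleGraph W} {ι : Type*} [Fintype ι] (B : ι → Set W)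
    (hdisj : Pairwise fun i j => Disjoint (B i) (B j))
    (hconn : ∀ i, (H.induce (B i)).Connected)
    (hadj : Pairwise fun i j => ∃ u ∈ B i, ∃ v ∈ B j, H.Adj u v) :
    HasCliqueMinor H (Fintype.card ι) := by
  let f := (Fintype.equivFin ι).symm
  refine ⟨B ∘ f, fun i => ?_, fun i j hij => hdisj (f.injective.ne hij), fun i => hconn _,
    fun i j hij => hadj (f.injective.ne hij)⟩
  obtain ⟨x⟩ := (hconn (f i)).nonempty
  exact ⟨x.1, x.2⟩

lemma HasCliqueMinor.map {H : SimpleGraph W} {H' : SimpleGraph W'} (f : H →g H')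
    (hf : Function.Injective f) {t : ℕ} (h : HasCliqueMinor H t) : HasCliqueMinor H' t := by
  obtain ⟨B, hne, hdisj, hconn, hadj⟩ := h
  refine ⟨fun i => f '' B i, fun i => (hne i).image f,
    fun i j hij => (Set.disjoint_image_iff hf).2 (hdisj hij), fun i => ?_, fun i j hij => ?_⟩
  · refine (hconn i).map (induceHom f (Set.mapsTo_image f (B i))) ?_
    rintro ⟨_, x, hx, rfl⟩
    exact ⟨⟨x, hx⟩, rfl⟩
  · obtain ⟨u, hu, v, hv, huv⟩ := hadj hij
    exact ⟨f u, ⟨u, hu, rfl⟩, f v, ⟨v, hv, rfl⟩, f.map_adj huv⟩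

lemma bddAbove_hasCliqueMinor [Finite W] (H : SimpleGraph W) :
    BddAbove {t | HasCliqueMinor H t} := by
  refine ⟨Nat.card W, ?_⟩
  rintro t ⟨B, hne, hdisj, -⟩
  choose f hf using hne
  have hinj : Function.Injective f := by
    intro i j hij
    by_contra hne
    exact Set.disjoint_left.1 (hdisj hne) (hf i) (hij ▸ hf j)
  simpa using Nat.card_le_card_of_injective f hinj

lemma HasCliqueMinor.le_hadwigerNumber [Finite W] {H : SimpleGraph W} {t : ℕ}
    (h : HasCliqueMinor H t) : t ≤ hadwigerNumber H :=
  le_csSup (bddAbove_hasCliqueMinor H) h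

lemma hasCliqueMinor_hadwigerNumber [Finite W] (H : SimpleGraph W) :
    HasCliqueMinor H (hadwigerNumber H) :=
  Nat.sSup_mem (s := {t | HasCliqueMinor H t})
    ⟨0, fun i => i.elim0, fun i => i.elim0, fun i => i.elim0, fun i => i.elim0, fun i => i.elim0⟩
    (bddAbove_hasCliqueMinor H)

/-- The total graph of a subgraph embeds into the total graph. -/
def totalGraphHom {G : SimpleGraph V} (H : G.Subgraph) : totalGraph H.coe →g totalGraph G where
  toFun := Sum.map Subtype.val fun e => ⟨Sym2.map Subtype.val e.1, H.hom.map_mem_edgeSet e.2⟩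
  map_rel' := by
    rintro (u | e) (v | f) h
    · exact totalGraph_adj_inl_inl.2 (H.hom.map_adj (totalGraph_adj_inl_inl.1 h))
    · exact totalGraph_adj_inl_inr.2 (Sym2.mem_map.2 ⟨_, totalGraph_adj_inl_inr.1 h, rfl⟩)
    · exact totalGraph_adj_inr_inl.2 (Sym2.mem_map.2 ⟨_, totalGraph_adj_inr_inl.1 h, rfl⟩)
    · obtain ⟨hne, u, hu, hu'⟩ := totalGraph_adj_inr_inr.1 h
      refine totalGraph_adj_inr_inr.2 ⟨fun heq => hne (Subtype.ext ?_), u.1,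
        Sym2.mem_map.2 ⟨_, hu, rfl⟩, Sym2.mem_map.2 ⟨_, hu', rfl⟩⟩
      exact Sym2.map.injective Subtype.val_injective (congrArg Subtype.val heq)

lemma totalGraphHom_injective {G : SimpleGraph V} (H : G.Subgraph) :
    Function.Injective (totalGraphHom H) :=
  Function.Injective.sumMap Subtype.val_injective fun _ _ h =>
    Subtype.ext (Sym2.map.injective Subtype.val_injective (congrArg Subtype.val h))

lemma hadwigerNumber_totalGraph_coe_le [Finite V] {G : SimpleGraph V} (H : G.Subgraph) :
    hadwigerNumber (totalGraph H.coe) ≤ hadwigerNumber (totalGraph G) :=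
  ((hasCliqueMinor_hadwigerNumber _).map (totalGraphHom H)
    (totalGraphHom_injective H)).le_hadwigerNumber

/-- A vertex `v` and its incident edges form a clique of `T(G)`; together with further branch sets
that avoid this clique and touch all of it, they form a clique minor. -/
lemma hasCliqueMinor_totalGraph_star (G : SimpleGraph V) (v : V) [Fintype (G.neighborSet v)]
    {ι : Type*} [Fintype ι] (B : ι → Set (V ⊕ G.edgeSet))
    (hdisj : Pairwise fun i j => Disjoint (B i) (B j))
    (hconn : ∀ i, ((totalGraph G).induce (B i)).Connected)
    (hadj : Pairwise fun i j => ∃ x ∈ B i, ∃ y ∈ B j, (totalGraph G).Adj x y)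
    (hv : ∀ i, Sum.inl v ∉ B i)
    (hev : ∀ i (e : G.edgeSet), v ∈ (e : Sym2 V) → Sum.inr e ∉ B i)
    (hnbr : ∀ i, ∃ u, G.Adj v u ∧ Sum.inl u ∈ B i)
    (hcover : ∀ i u, G.Adj v u →
      Sum.inl u ∈ B i ∨ ∃ e : G.edgeSet, u ∈ (e : Sym2 V) ∧ Sum.inr e ∈ B i) :
    HasCliqueMinor (totalGraph G) (G.degree v + 1 + Fintype.card ι) := by
  let c : Option (G.neighborSet v) → V ⊕ G.edgeSet := fun o =>
    o.elim (Sum.inl v) fun u => Sum.inr ⟨s(v, u.1), u.2⟩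
  have hc_adj : ∀ o o', o ≠ o' → (totalGraph G).Adj (c o) (c o') := by
    rintro (_ | u) (_ | w) hne
    · exact absurd rfl hne
    · exact totalGraph_adj_inl_inr.2 (by simp)
    · exact totalGraph_adj_inr_inl.2 (by simp)
    · refine totalGraph_adj_inr_inr.2 ⟨fun h => hne ?_, v, by simp, by simp⟩
      exact congrArg some (Subtype.ext (Sym2.congr_right.1 (congrArg Subtype.val h)))
  have hc_notMem : ∀ i o, c o ∉ B i := by
    rintro i (_ | u)
    · exact hv i
    · exact hev i _ (by simp)
  have hc_touch : ∀ i o, ∃ x ∈ B i, (totalGraph G).Adj (c o) x := by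
    rintro i (_ | u)
    · obtain ⟨u, hu, hmem⟩ := hnbr i
      exact ⟨_, hmem, totalGraph_adj_inl_inl.2 hu⟩
    · obtain h | ⟨e, hue, he⟩ := hcover i u u.2
      · exact ⟨_, h, totalGraph_adj_inr_inl.2 (by simp)⟩
      · refine ⟨_, he, totalGraph_adj_inr_inr.2 ⟨?_, u, by simp, hue⟩⟩
        rintro rfl
        exact hc_notMem i (some u) he
  have hcard : Fintype.card (Option (G.neighborSet v) ⊕ ι) = G.degree v + 1 + Fintype.card ι := by
    rw [Fintype.card_sum, Fintype.card_option, card_neighborSet_eq_degree]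
  rw [← hcard]
  refine HasCliqueMinor.of_fintype (Sum.elim (fun o => {c o}) B) ?_ ?_ ?_
  · rintro (o | i) (o' | j) hne
    · simpa using (hc_adj o o' (fun h => hne (congrArg _ h))).ne
    · simpa using hc_notMem j o
    · simpa using hc_notMem i o'
    · exact hdisj fun h => hne (congrArg _ h)
  · rintro (o | i)
    · exact connected_induce_of_closed (Set.mem_singleton (c o)) fun Q hQ _ x hx => hx ▸ hQ
    · exact hconn i
  · rintro (o | i) (o' | j) hne
    · exact ⟨_, rfl, _, rfl, hc_adj o o' fun h => hne (congrArg _ h)⟩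
    · obtain ⟨x, hx, h⟩ := hc_touch j o
      exact ⟨_, rfl, x, hx, h⟩
    · obtain ⟨x, hx, h⟩ := hc_touch i o'
      exact ⟨x, hx, _, rfl, h.symm⟩
    · exact hadj fun h => hne (congrArg _ h)

/-- The graph `G - S` is connected, expressed as an induction principle. -/
def ConnectedOff (G : SimpleGraph V) (S : Set V) : Prop :=
  ∀ P : V → Prop, (∀ x y, G.Adj x y → x ∉ S → y ∉ S → P x → P y) →
    ∀ a b, a ∉ S → b ∉ S → P a → P b

lemma hasCliqueMinor_degree_add_one (G : SimpleGraph V) (v : V) [Fintype (G.neighborSet v)] :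
    HasCliqueMinor (totalGraph G) (G.degree v + 1) :=
  hasCliqueMinor_totalGraph_star G v (ι := Empty) (fun i => i.elim) (fun i => i.elim)
    (fun i => i.elim) (fun i => i.elim) (fun i => i.elim) (fun i => i.elim) (fun i => i.elim)
    (fun i => i.elim)

lemma hasCliqueMinor_degree_add_two (G : SimpleGraph V) (v : V) [Fintype (G.neighborSet v)]
    (hv : ∃ u, G.Adj v u) (hconn : ConnectedOff G {v}) :
    HasCliqueMinor (totalGraph G) (G.degree v + 2) := by
  obtain ⟨r, hr⟩ := hv
  refine hasCliqueMinor_totalGraph_star G v (ι := Unit) (fun _ => Sum.inl '' {v}ᶜ)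
    (fun i j h => absurd rfl h) (fun _ => ?_) (fun i j h => absurd rfl h) (by simp) (by simp)
    (fun _ => ⟨r, hr, by simpa using hr.ne'⟩) (fun _ u hu => Or.inl (by simpa using hu.ne'))
  refine connected_induce_of_closed (r := Sum.inl r) (by simpa using hr.ne') ?_
  rintro Q hQ hstep _ ⟨x, hx, rfl⟩
  refine hconn (fun x => Q (Sum.inl x)) (fun x y hxy hx hy => ?_) r x hr.ne' hx hQ
  exact hstep _ ⟨x, hx, rfl⟩ _ ⟨y, hy, rfl⟩ (totalGraph_adj_inl_inl.2 hxy)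

lemma hasCliqueMinor_degree_add_three [DecidableEq V] (G : SimpleGraph V) [G.LocallyFinite] (v : V)
    (hdeg : ∀ x, 3 ≤ G.degree x) {u : V} (huv : G.Adj v u) (hconn : ConnectedOff G {v, u}) :
    HasCliqueMinor (totalGraph G) (G.degree v + 3) := by
  have hthird : ∀ x p q, ∃ y, G.Adj x y ∧ y ≠ p ∧ y ≠ q := by
    intro x p q
    have hlt : ({p, q} : Finset V).card < (G.neighborFinset x).card :=
      Finset.card_le_two.trans_lt (hdeg x)
    obtain ⟨y, hy, hy'⟩ := Finset.exists_mem_notMem_of_card_lt_card hlt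
    exact ⟨y, by simpa using hy, by simpa using hy'⟩
  obtain ⟨w, huw, hwv, -⟩ := hthird u v v
  let f : G.edgeSet := ⟨s(u, w), huw⟩
  let A : Set (V ⊕ G.edgeSet) := Sum.elim (fun x => x ≠ v ∧ x ≠ u) (fun e => e = f)
  let B : Set (V ⊕ G.edgeSet) :=
    Sum.elim (fun x => x = u) (fun e => v ∉ (e : Sym2 V) ∧ e ≠ f)
  have hAl : ∀ {x}, Sum.inl x ∈ A ↔ x ≠ v ∧ x ≠ u := Iff.rfl
  have hAr : ∀ {e}, Sum.inr e ∈ A ↔ e = f := Iff.rfl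
  have hBl : ∀ {x}, Sum.inl x ∈ B ↔ x = u := Iff.rfl
  have hBr : ∀ {e : G.edgeSet}, Sum.inr e ∈ B ↔ v ∉ (e : Sym2 V) ∧ e ≠ f := Iff.rfl
  have hAB : Disjoint A B := by
    rw [Set.disjoint_left]
    rintro (x | e) h h'
    · exact h.2 h'
    · exact h'.2 h
  have hadj : (totalGraph G).Adj (Sum.inr f) (Sum.inl u) :=
    totalGraph_adj_inr_inl.2 (by simp [f])
  have hA : ((totalGraph G).induce A).Connected := by
    have hw : Sum.inl w ∈ A := hAl.2 ⟨hwv, huw.ne'⟩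
    refine connected_induce_of_closed hw ?_
    rintro Q hQ hstep (x | e) hx
    · refine hconn (fun x => Q (Sum.inl x)) (fun x y hxy hx hy => ?_) w x
        (by simp [hwv, huw.ne']) (by simpa using hAl.1 hx) hQ
      exact hstep _ (by simpa [hAl] using hx) _ (by simpa [hAl] using hy)
        (totalGraph_adj_inl_inl.2 hxy)
    · obtain rfl := hAr.1 hx
      exact hstep _ hw _ hx (totalGraph_adj_inl_inr.2 (by simp [f])) hQ
  have hB : ((totalGraph G).induce B).Connected := by
    have hu : Sum.inl u ∈ B := hBl.2 rfl
    refine connected_induce_of_closed hu ?_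
    intro Q hQ hstep
    have hstep' : ∀ e e' : G.edgeSet, Sum.inr e ∈ B → Sum.inr e' ∈ B →
        (∃ x, x ∈ (e : Sym2 V) ∧ x ∈ (e' : Sym2 V)) → Q (Sum.inr e) → Q (Sum.inr e') := by
      intro e e' he he' hx hQe
      by_cases heq : e = e'
      · exact heq ▸ hQe
      · exact hstep _ he _ he' (totalGraph_adj_inr_inr.2 ⟨heq, hx⟩) hQe
    have hQu : ∀ e : G.edgeSet, Sum.inr e ∈ B → u ∈ (e : Sym2 V) → Q (Sum.inr e) :=
      fun e he hue => hstep _ hu _ he (totalGraph_adj_inl_inr.2 hue) hQ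
    obtain ⟨y, huy, hyv, hyw⟩ := hthird u v w
    have hmem : ∀ p q (h : G.Adj p q), p ≠ v → q ≠ v → s(p, q) ≠ s(u, w) →
        Sum.inr ⟨s(p, q), h⟩ ∈ B := fun p q h hp hq hne =>
      hBr.2 ⟨by simp [hp.symm, hq.symm], fun h' => hne (congrArg Subtype.val h')⟩
    have huy_mem : Sum.inr ⟨s(u, y), huy⟩ ∈ B :=
      hmem u y huy huv.ne' hyv fun h => hyw (Sym2.congr_right.1 h)
    let P : V → Prop := fun x => ∀ e : G.edgeSet, Sum.inr e ∈ B → x ∈ (e : Sym2 V) → Q (Sum.inr e)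
    have hPy : P y := fun e he hye =>
      hstep' _ _ huy_mem he ⟨y, by simp, hye⟩ (hQu _ huy_mem (by simp))
    have hP : ∀ x, x ≠ v → x ≠ u → P x := by
      intro x hxv hxu
      refine hconn P (fun p q hpq hp hq hPp e he hqe => ?_) y x (by simp [hyv, huy.ne'])
        (by simp [hxv, hxu]) hPy
      simp only [Set.mem_insert_iff, Set.mem_singleton_iff, not_or] at hp hq
      have hpq_mem := hmem p q hpq hp.1 hq.1 (by
        simp only [ne_eq, Sym2.eq_iff, not_or]
        exact ⟨fun h => hp.2 h.1, fun h => hq.2 h.2⟩)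
      exact hstep' _ _ hpq_mem he ⟨q, by simp, hqe⟩ (hPp _ hpq_mem (by simp))
    rintro (x | ⟨e, he⟩) hx
    · exact (hBl.1 hx) ▸ hQ
    · induction e with
      | _ p q =>
        by_cases hpu : p = u
        · exact hQu _ hx (by simp [hpu])
        · refine hP p (fun hpv => (hBr.1 hx).1 (by simp [hpv])) hpu _ hx (by simp)
  refine hasCliqueMinor_totalGraph_star G v (ι := Bool) (fun b => cond b A B) ?_ ?_ ?_ ?_ ?_ ?_ ?_
  · rintro (_ | _) (_ | _) h
    exacts [absurd rfl h, hAB.symm, hAB, absurd rfl h]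
  · rintro (_ | _)
    exacts [hB, hA]
  · rintro (_ | _) (_ | _) h
    · exact absurd rfl h
    · exact ⟨_, hBl.2 rfl, _, hAr.2 rfl, hadj.symm⟩
    · exact ⟨_, hAr.2 rfl, _, hBl.2 rfl, hadj⟩
    · exact absurd rfl h
  · rintro (_ | _) h
    · exact huv.ne (hBl.1 h)
    · exact (hAl.1 h).1 rfl
  · rintro (_ | _) e hve h
    · exact (hBr.1 h).1 hve
    · rw [hAr.1 h] at hve
      simp [f, huv.ne, hwv.symm] at hve
  · rintro (_ | _)
    · exact ⟨u, huv, hBl.2 rfl⟩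
    · obtain ⟨y, hvy, hyu, -⟩ := hthird v u u
      exact ⟨y, hvy, hAl.2 ⟨hvy.ne', hyu⟩⟩
  · rintro (_ | _) x hvx
    · by_cases hxu : x = u
      · exact Or.inl (hBl.2 hxu)
      · obtain ⟨y, hxy, hyv, hyu⟩ := hthird x v u
        refine Or.inr ⟨⟨s(x, y), hxy⟩, by simp, hBr.2 ⟨by simp [hvx.ne, hyv.symm], fun h => ?_⟩⟩
        have h' : s(x, y) = s(u, w) := congrArg Subtype.val h
        have h'' : u ∈ s(x, y) := h' ▸ Sym2.mem_mk_left u w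
        rcases Sym2.mem_iff.1 h'' with h | h
        exacts [hxu h.symm, hyu h.symm]
    · by_cases hxu : x = u
      · exact Or.inr ⟨f, by simp [f, hxu], hAr.2 rfl⟩
      · exact Or.inl (hAl.2 ⟨hvx.ne', hxu⟩)

/-- If no single vertex separates `G`, then some neighbor `u` of `v` can be deleted along with `v`
without disconnecting the rest: take `u` farthest from a fixed neighbor in `G - v`. -/
lemma exists_adj_connectedOff_pair (G : SimpleGraph V) (v : V) [Fintype (G.neighborSet v)]
    (hdeg : 2 ≤ G.degree v) (hconn : ∀ x, ConnectedOff G {x}) :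
    ∃ u, G.Adj v u ∧ ConnectedOff G {v, u} := by
  classical
  have hne : (G.neighborFinset v).Nonempty := Finset.card_pos.1 (by
    rw [card_neighborFinset_eq_degree]; omega)
  obtain ⟨r, hr⟩ := hne
  let H := G.deleteIncidenceSet v
  obtain ⟨u, hu, hmax⟩ := Finset.exists_max_image (G.neighborFinset v) (fun x => H.dist x r) ⟨r, hr⟩
  rw [mem_neighborFinset] at hr hu
  have hreach : ∀ x, x ≠ v → H.Reachable x r := fun x hx =>
    hconn v (fun x => H.Reachable x r)
      (fun p q hpq hp hq h =>
        (Adj.reachable (deleteIncidenceSet_adj.2 ⟨hpq.symm, hq, hp⟩)).trans h)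
      r x hr.ne' hx (Reachable.refl r)
  have hru : r ≠ u := by
    rintro rfl
    obtain ⟨y, hy, hyr⟩ : ∃ y ∈ G.neighborFinset v, y ≠ r :=
      Finset.exists_mem_ne (by rw [card_neighborFinset_eq_degree]; omega) r
    have h0 := hmax y hy
    rw [dist_self, Nat.le_zero] at h0
    have hyv : y ≠ v := ((G.mem_neighborFinset v y).1 hy).ne'
    exact hyr ((hreach y hyv).dist_eq_zero_iff.1 h0)
  refine ⟨u, hu, fun P hP a b ha hb hPa => ?_⟩
  simp only [Set.mem_insert_iff, Set.mem_singleton_iff, not_or] at hP ha hb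
  have hP' : ∀ x y, G.Adj x y → x ≠ v → x ≠ u → y ≠ v → y ≠ u → (P x ↔ P y) :=
    fun x y h h₁ h₂ h₃ h₄ => ⟨hP x y h ⟨h₁, h₂⟩ ⟨h₃, h₄⟩, hP y x h.symm ⟨h₃, h₄⟩ ⟨h₁, h₂⟩⟩
  have hwalk : ∀ x y (p : H.Walk x y), y = r → p.length ≤ H.dist u r → x ≠ u → (P x ↔ P r) := by
    intro x y p
    induction p with
    | nil => rintro rfl _ _; rfl
    | @cons x z y h p ih =>
      rintro rfl hlen hxu
      rw [Walk.length_cons] at hlen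
      have hzu : z ≠ u := by
        rintro rfl
        have := dist_le p
        omega
      obtain ⟨hadj, hxv, hzv⟩ := deleteIncidenceSet_adj.1 h
      exact (hP' x z hadj hxv hxu hzv hzu).trans (ih rfl (by omega) hzu)
  have hnbr : ∀ x, G.Adj v x → x ≠ u → (P x ↔ P r) := by
    intro x hx hxu
    obtain ⟨p, hp⟩ := (hreach x hx.ne').exists_walk_length_eq_dist
    exact hwalk x r p rfl (hp ▸ hmax x (by simpa using hx)) hxu
  have hall : ∀ x, x ≠ u → x = v ∨ (P x ↔ P r) := by
    intro x hx
    refine hconn u (fun x => x = v ∨ (P x ↔ P r)) (fun p q hpq hp hq h => ?_) r x hru hx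
      (Or.inr Iff.rfl)
    by_cases hqv : q = v
    · exact Or.inl hqv
    · obtain rfl | h := h
      · exact Or.inr (hnbr q hpq hq)
      · by_cases hpv : p = v
        · exact Or.inr (hnbr q (hpv ▸ hpq) hq)
        · exact Or.inr ((hP' p q hpq hpv hp hqv hq).symm.trans h)
  exact ((hall b hb.2).resolve_left hb.1).2 (((hall a ha.2).resolve_left ha.1).1 hPa)

end CliqueMinor

section Critical

variable {V α : Type*}

lemma exists_perm_apply_eq_and_notMem [Fintype α] {s t : Finset α} {p q : α} (hq : q ∉ s)
    (hp : p ∉ t) (hcard : s.card + t.card < Fintype.card α) :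
    ∃ σ : Equiv.Perm α, σ q = p ∧ ∀ x ∈ s, σ x ∉ t := by
  classical
  have hle : Fintype.card s ≤ Fintype.card ↥(insert p t)ᶜ := by
    rw [Fintype.card_coe, Fintype.card_coe, Finset.card_compl, Finset.card_insert_of_notMem hp]
    omega
  obtain ⟨e⟩ := Function.Embedding.nonempty_of_card_le hle
  have he : ∀ x, (e x : α) ≠ p ∧ (e x : α) ∉ t := fun x => by
    simpa using Finset.mem_compl.1 (e x).2
  let f : α → α := fun x => if h : x ∈ s then e ⟨x, h⟩ else p
  have hfs : ∀ x (h : x ∈ s), f x = e ⟨x, h⟩ := fun x h => dif_pos h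
  have hfq : f q = p := dif_neg hq
  have hinj : Set.InjOn f (insert q s : Finset α) := by
    intro x hx y hy hxy
    simp only [Finset.coe_insert, Set.mem_insert_iff, Finset.mem_coe] at hx hy
    rcases hx with rfl | hx <;> rcases hy with rfl | hy
    · rfl
    · rw [hfq, hfs y hy] at hxy
      exact absurd hxy.symm (he _).1
    · rw [hfq, hfs x hx] at hxy
      exact absurd hxy (he _).1
    · rw [hfs x hx, hfs y hy] at hxy
      exact congrArg Subtype.val (e.injective (Subtype.ext hxy))
  obtain ⟨g, hg⟩ := Finset.exists_equiv_extend_of_card_eq (t := Finset.univ) rfl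
    (Finset.subset_univ _) hinj
  refine ⟨g.trans (Equiv.subtypeUnivEquiv Finset.mem_univ), ?_, fun x hx => ?_⟩
  · exact (hg q (Finset.mem_insert_self q s)).trans hfq
  · have := hg x (Finset.mem_insert_of_mem hx)
    rw [hfs x hx] at this
    exact fun h => (he ⟨x, hx⟩).2 (this ▸ h)

/-- Total colorings of two edge-disjoint pieces of `G` that meet only in the vertex `v` can be
combined into a total coloring of `G` if there are more colors than edges at `v`. -/
lemma totalColorable_of_cutVertex [Fintype α] {G : SimpleGraph V} {v : V}
    [Fintype (G.neighborSet v)] (hα : G.degree v < Fintype.card α) {P : V → Prop}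
    (hP : ∀ x y, G.Adj x y → x ≠ v → y ≠ v → P x → P y) {G₁ G₂ : SimpleGraph V}
    (hG₁ : ∀ x y, G₁.Adj x y ↔ G.Adj x y ∧ (x = v ∨ P x) ∧ (y = v ∨ P y))
    (hG₂ : ∀ x y, G₂.Adj x y ↔ G.Adj x y ∧ (x = v ∨ ¬ P x) ∧ (y = v ∨ ¬ P y))
    (h₁ : TotalColorable G₁ α) (h₂ : TotalColorable G₂ α) : TotalColorable G α := by
  classical
  obtain ⟨cv₁, ce₁, h₁⟩ := h₁
  obtain ⟨cv₂, ce₂, h₂⟩ := h₂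
  let N₁ := {x ∈ G.neighborFinset v | P x}
  let N₂ := {x ∈ G.neighborFinset v | ¬ P x}
  have hN₁ : ∀ x, x ∈ N₁ ↔ G₁.Adj v x := fun x => by
    have : G.Adj v x → x ≠ v := fun h => h.ne'
    simp only [N₁, Finset.mem_filter, mem_neighborFinset, hG₁]
    tauto
  have hN₂ : ∀ x, x ∈ N₂ ↔ G₂.Adj v x := fun x => by
    have : G.Adj v x → x ≠ v := fun h => h.ne'
    simp only [N₂, Finset.mem_filter, mem_neighborFinset, hG₂]
    tauto
  have hcard : N₂.card + N₁.card = G.degree v := by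
    rw [add_comm, Finset.card_filter_add_card_filter_not, card_neighborFinset_eq_degree]
  obtain ⟨σ, hσv, hσ⟩ := exists_perm_apply_eq_and_notMem
    (s := N₂.image fun x => ce₂ s(v, x)) (t := N₁.image fun x => ce₁ s(v, x))
    (q := cv₂ v) (p := cv₁ v)
    (by
      simp only [Finset.mem_image, not_exists, not_and]
      exact fun x hx => h₂.incident ((hN₂ x).1 hx))
    (by
      simp only [Finset.mem_image, not_exists, not_and]
      exact fun x hx => h₁.incident ((hN₁ x).1 hx))
    (lt_of_le_of_lt (Nat.add_le_add Finset.card_image_le Finset.card_image_le) (hcard ▸ hα))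
  replace h₂ := h₂.comp σ.injective
  have hσ' : ∀ x y, G₁.Adj v x → G₂.Adj v y → ce₁ s(v, x) ≠ σ (ce₂ s(v, y)) :=
    fun x y hx hy h => hσ _ (Finset.mem_image_of_mem _ ((hN₂ y).2 hy))
      (h ▸ Finset.mem_image_of_mem _ ((hN₁ x).2 hx))
  let cv : V → α := fun x => if x = v ∨ P x then cv₁ x else σ (cv₂ x)
  let ce : Sym2 V → α := fun e => if e ∈ G₁.edgeSet then ce₁ e else σ (ce₂ e)
  have hcv₁ : ∀ x, x = v ∨ P x → cv x = cv₁ x := fun x hx => if_pos hx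
  have hcv₂ : ∀ x, x = v ∨ ¬ P x → cv x = σ (cv₂ x) := by
    intro x hx
    by_cases hxv : x = v
    · rw [hcv₁ x (Or.inl hxv), hxv, hσv]
    · exact if_neg (not_or.2 ⟨hxv, hx.resolve_left hxv⟩)
  have hce₁ : ∀ x y, G₁.Adj x y → ce s(x, y) = ce₁ s(x, y) := fun x y h => if_pos h
  have hce₂ : ∀ x y, G₂.Adj x y → ce s(x, y) = σ (ce₂ s(x, y)) := by
    intro x y h
    refine if_neg fun h' => ?_
    rw [mem_edgeSet, hG₁] at h'
    rw [hG₂] at h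
    have : x = v ∨ y = v := by tauto
    have := h.1.ne
    grind
  have hside : ∀ x y, G.Adj x y → G₁.Adj x y ∨ G₂.Adj x y := by
    intro x y h
    rw [hG₁, hG₂]
    have := hP x y h
    have := hP y x h.symm
    tauto
  have hmixed : ∀ x y z, G₁.Adj x y → G₂.Adj x z → x = v := by
    intro x y z h h'
    rw [hG₁] at h
    rw [hG₂] at h'
    tauto
  refine ⟨cv, ce, ?_, ?_, ?_⟩
  · intro x y h
    obtain h | h := hside x y h
    · have h' := (hG₁ x y).1 h
      rw [hcv₁ x h'.2.1, hcv₁ y h'.2.2]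
      exact h₁.vertex h
    · have h' := (hG₂ x y).1 h
      rw [hcv₂ x h'.2.1, hcv₂ y h'.2.2]
      exact h₂.vertex h
  · intro x y z hy hz hyz
    obtain hy | hy := hside x y hy <;> obtain hz | hz := hside x z hz
    · rw [hce₁ x y hy, hce₁ x z hz]
      exact h₁.edge hy hz hyz
    · obtain rfl := hmixed x y z hy hz
      rw [hce₁ x y hy, hce₂ x z hz]
      exact hσ' y z hy hz
    · obtain rfl := hmixed x z y hz hy
      rw [hce₂ x y hy, hce₁ x z hz]
      exact (hσ' z y hz hy).symm
    · rw [hce₂ x y hy, hce₂ x z hz]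
      exact h₂.edge hy hz hyz
  · intro x y h
    obtain h | h := hside x y h
    · rw [hce₁ x y h, hcv₁ x ((hG₁ x y).1 h).2.1]
      exact h₁.incident h
    · rw [hce₂ x y h, hcv₂ x ((hG₂ x y).1 h).2.1]
      exact h₂.incident h

/-- `G` is critical for total colorings with colors in `α`: it has none, but each of its proper
spanning subgraphs has one, and `G` has no isolated vertices. -/
structure TotalCritical (G : SimpleGraph V) (α : Type*) : Prop where
  not_totalColorable : ¬ TotalColorable G α
  totalColorable_of_lt : ∀ G', G' < G → TotalColorable G' α
  exists_adj : ∀ x, ∃ y, G.Adj x y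

lemma TotalCritical.connectedOff [Fintype α] {G : SimpleGraph V} (hG : TotalCritical G α) (v : V)
    [Fintype (G.neighborSet v)] (hα : G.degree v < Fintype.card α) : ConnectedOff G {v} := by
  intro P hP a b ha hb hPa
  simp only [Set.mem_singleton_iff] at hP ha hb
  by_contra hPb
  let G₁ : SimpleGraph V :=
    { Adj := fun x y => G.Adj x y ∧ (x = v ∨ P x) ∧ (y = v ∨ P y)
      symm := ⟨fun x y h => ⟨h.1.symm, h.2.2, h.2.1⟩⟩
      loopless := ⟨fun x h => h.1.ne rfl⟩ }
  let G₂ : SimpleGraph V :=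
    { Adj := fun x y => G.Adj x y ∧ (x = v ∨ ¬ P x) ∧ (y = v ∨ ¬ P y)
      symm := ⟨fun x y h => ⟨h.1.symm, h.2.2, h.2.1⟩⟩
      loopless := ⟨fun x h => h.1.ne rfl⟩ }
  have h₁ : G₁ < G := by
    obtain ⟨y, hy⟩ := hG.exists_adj b
    refine lt_of_le_not_ge (fun x y h => h.1) fun hle => ?_
    exact (hle hy).2.1.elim hb hPb
  have h₂ : G₂ < G := by
    obtain ⟨y, hy⟩ := hG.exists_adj a
    refine lt_of_le_not_ge (fun x y h => h.1) fun hle => ?_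
    exact (hle hy).2.1.elim ha fun h => h hPa
  exact hG.not_totalColorable (totalColorable_of_cutVertex hα hP (fun _ _ => Iff.rfl)
    (fun _ _ => Iff.rfl) (hG.totalColorable_of_lt _ h₁) (hG.totalColorable_of_lt _ h₂))

lemma deleteEdges_lt_of_mem {G : SimpleGraph V} {e : Sym2 V} {s : Set (Sym2 V)}
    (he : e ∈ G.edgeSet) (hes : e ∈ s) : G.deleteEdges s < G := by
  refine lt_of_le_not_ge (deleteEdges_le s) fun hle => ?_
  have := edgeSet_subset_edgeSet.2 hle he
  rw [edgeSet_deleteEdges] at this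
  exact this.2 hes

lemma TotalCritical.three_le_degree [Fintype α] {G : SimpleGraph V} [G.LocallyFinite]
    (hG : TotalCritical G α) (hα : ∀ x, G.degree x + 2 ≤ Fintype.card α) (u : V)
    (hu : 2 * G.degree u < Fintype.card α) : 3 ≤ G.degree u := by
  classical
  by_contra! hlt
  obtain ⟨v, huv⟩ := hG.exists_adj u
  obtain ⟨cv, ce, h⟩ := hG.totalColorable_of_lt _
    (deleteEdges_lt_of_mem (s := {s(u, v)}) huv rfl)
  have hadj : ∀ {x y}, G.Adj x y → s(x, y) ≠ s(u, v) → (G.deleteEdges {s(u, v)}).Adj x y :=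
    fun h hne => deleteEdges_adj.2 ⟨h, hne⟩
  have hSE : (insert (cv v) (((G.neighborFinset u).erase v).image (fun x => ce s(u, x)) ∪
      ((G.neighborFinset v).erase u).image (fun x => ce s(v, x)))).card < Fintype.card α := by
    have h₁ : (((G.neighborFinset u).erase v).image (fun x => ce s(u, x))).card + 1 ≤
        G.degree u := by
      rw [← card_neighborFinset_eq_degree,
        ← Finset.card_erase_add_one ((G.mem_neighborFinset u v).2 huv)]
      exact Nat.add_le_add_right Finset.card_image_le 1
    have h₂ : (((G.neighborFinset v).erase u).image (fun x => ce s(v, x))).card + 1 ≤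
        G.degree v := by
      rw [← card_neighborFinset_eq_degree,
        ← Finset.card_erase_add_one ((G.mem_neighborFinset v u).2 huv.symm)]
      exact Nat.add_le_add_right Finset.card_image_le 1
    have h₃ := Finset.card_insert_le (cv v) (((G.neighborFinset u).erase v).image
      (fun x => ce s(u, x)) ∪ ((G.neighborFinset v).erase u).image (fun x => ce s(v, x)))
    have h₄ := Finset.card_union_le (((G.neighborFinset u).erase v).image (fun x => ce s(u, x)))
      (((G.neighborFinset v).erase u).image (fun x => ce s(v, x)))
    have := hα v
    omega
  obtain ⟨c, -, hc⟩ := Finset.exists_mem_notMem_of_card_lt_card (hSE.trans_eq Finset.card_univ.symm)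
  simp only [Finset.mem_insert, Finset.mem_union, Finset.mem_image, Finset.mem_erase,
    mem_neighborFinset, not_or, not_exists, not_and, and_imp] at hc
  obtain ⟨hcv, hcu, hcv'⟩ := hc
  let ce' := Function.update ce s(u, v) c
  have hce_self : ce' s(u, v) = c := Function.update_self ..
  have hce_ne : ∀ {e}, e ≠ s(u, v) → ce' e = ce e := fun h => Function.update_of_ne h ..
  have hSV : ((G.neighborFinset u).image cv ∪
      (G.neighborFinset u).image (fun x => ce' s(u, x))).card < Fintype.card α := by
    refine (Finset.card_union_le _ _).trans_lt (lt_of_le_of_lt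
      (Nat.add_le_add Finset.card_image_le Finset.card_image_le) ?_)
    rw [card_neighborFinset_eq_degree]
    omega
  obtain ⟨d, -, hd⟩ := Finset.exists_mem_notMem_of_card_lt_card (hSV.trans_eq Finset.card_univ.symm)
  simp only [Finset.mem_union, Finset.mem_image, mem_neighborFinset, not_or, not_exists,
    not_and] at hd
  obtain ⟨hdv, hde⟩ := hd
  let cv' := Function.update cv u d
  have hcv_self : cv' u = d := Function.update_self ..
  have hcv_ne : ∀ {x}, x ≠ u → cv' x = cv x := fun h => Function.update_of_ne h ..
  have hfresh : ∀ x y z, G.Adj x y → G.Adj x z → y ≠ z → s(x, z) = s(u, v) →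
      ce s(x, y) ≠ c := by
    intro x y z hy hz hyz heq
    obtain ⟨rfl, rfl⟩ | ⟨rfl, rfl⟩ := Sym2.eq_iff.1 heq
    · exact hcu y hyz hy
    · exact hcv' y hyz hy
  refine hG.not_totalColorable ⟨cv', ce', ?_, ?_, ?_⟩
  · intro x y hxy
    by_cases hx : x = u
    · subst hx
      rw [hcv_self, hcv_ne hxy.ne']
      exact Ne.symm (hdv y hxy)
    · by_cases hy : y = u
      · subst hy
        rw [hcv_self, hcv_ne hx]
        exact hdv x hxy.symm
      · rw [hcv_ne hx, hcv_ne hy]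
        refine h.vertex (hadj hxy fun h => ?_)
        exact (Sym2.eq_iff.1 h).elim (fun h => hx h.1) fun h => hy h.2
  · intro x y z hy hz hyz
    have hne : s(x, y) ≠ s(x, z) := fun h => hyz (Sym2.congr_right.1 h)
    by_cases hey : s(x, y) = s(u, v)
    · rw [hey] at hne
      rw [hce_ne hne.symm, hey, hce_self]
      exact (hfresh x z y hz hy hyz.symm hey).symm
    · by_cases hez : s(x, z) = s(u, v)
      · rw [hce_ne hey, hez, hce_self]
        exact hfresh x y z hy hz hyz hez
      · rw [hce_ne hey, hce_ne hez]
        exact h.edge (hadj hy hey) (hadj hz hez) hyz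
  · intro x y hxy
    by_cases hx : x = u
    · subst hx
      rw [hcv_self]
      exact hde y hxy
    · rw [hcv_ne hx]
      by_cases he : s(x, y) = s(u, v)
      · rw [he, hce_self]
        obtain ⟨rfl, -⟩ | ⟨rfl, -⟩ := Sym2.eq_iff.1 he
        exacts [absurd rfl hx, hcv]
      · rw [hce_ne he]
        exact h.incident (hadj hxy he)

set_option synthInstance.maxSize 1000 in
set_option synthInstance.maxHeartbeats 400000 in
lemma exists_four_colors : ∀ b g a' f : Fin 4, b ≠ g → a' ≠ f → ∃ a aw w wb : Fin 4,
    (a ≠ a' ∧ a ≠ f) ∧ (aw ≠ a ∧ aw ≠ w ∧ aw ≠ wb ∧ aw ≠ f) ∧ (w ≠ a ∧ w ≠ b) ∧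
      wb ≠ b ∧ wb ≠ g ∧ wb ≠ w := by
  decide

lemma TotalCritical.not_two_regular [Nonempty V] {G : SimpleGraph V} [G.LocallyFinite]
    (hG : TotalCritical G (Fin 4)) : ¬ ∀ x, G.degree x = 2 := by
  classical
  intro hdeg
  have hother : ∀ x y, G.Adj x y → ∃ z, z ≠ y ∧ ∀ t, G.Adj x t ↔ t = y ∨ t = z := by
    intro x y hxy
    have hcard : ((G.neighborFinset x).erase y).card = 1 := by
      rw [Finset.card_erase_of_mem (by simpa using hxy), card_neighborFinset_eq_degree, hdeg]
    obtain ⟨z, hz⟩ := Finset.card_eq_one.1 hcard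
    have hz' : ∀ t, (t ≠ y ∧ G.Adj x t) ↔ t = z := fun t => by
      rw [← Finset.mem_singleton, ← hz, Finset.mem_erase, mem_neighborFinset]
    refine ⟨z, ((hz' z).2 rfl).1, fun t => ?_⟩
    rw [← hz']
    by_cases ht : t = y
    · simp [ht, hxy]
    · simp [ht]
  obtain ⟨w⟩ := ‹Nonempty V›
  obtain ⟨a, hwa⟩ := hG.exists_adj w
  obtain ⟨b, hba, hNw⟩ := hother w a hwa
  have hwb : G.Adj w b := (hNw b).2 (Or.inr rfl)
  obtain ⟨a', ha'w, hNa⟩ := hother a w hwa.symm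
  obtain ⟨b', hb'w, hNb⟩ := hother b w hwb.symm
  have haa' : G.Adj a a' := (hNa a').2 (Or.inr rfl)
  have hbb' : G.Adj b b' := (hNb b').2 (Or.inr rfl)
  obtain ⟨cv, ce, h⟩ := hG.totalColorable_of_lt _
    (deleteEdges_lt_of_mem (s := {s(w, a), s(w, b)}) hwa (Or.inl rfl))
  have hadj : ∀ {x y}, G.Adj x y → x ≠ w → y ≠ w →
      (G.deleteEdges {s(w, a), s(w, b)}).Adj x y := by
    intro x y hxy hx hy
    refine deleteEdges_adj.2 ⟨hxy, ?_⟩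
    simp only [Set.mem_insert_iff, Set.mem_singleton_iff, Sym2.eq_iff]
    tauto
  have hbb'G := hadj hbb' hwb.ne' hb'w
  have haa'G := hadj haa' hwa.ne' ha'w
  obtain ⟨ca, caw, cw, cwb, ⟨ha₁, ha₂⟩, ⟨haw₁, haw₂, haw₃, haw₄⟩, ⟨hw₁, hw₂⟩, hwb₁, hwb₂, hwb₃⟩ :=
    exists_four_colors (cv b) (ce s(b, b')) (cv a') (ce s(a, a')) (h.incident hbb'G).symm
      (by rw [Sym2.eq_swap]; exact (h.incident haa'G.symm).symm)
  let cv' : V → Fin 4 := Function.update (Function.update cv a ca) w cw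
  let ce' : Sym2 V → Fin 4 := Function.update (Function.update ce s(w, a) caw) s(w, b) cwb
  have hcvw : cv' w = cw := Function.update_self ..
  have hcva : cv' a = ca := by simp [cv', hwa.ne']
  have hcv : ∀ {x}, x ≠ w → x ≠ a → cv' x = cv x := fun h₁ h₂ => by simp [cv', h₁, h₂]
  have hcewb : ce' s(w, b) = cwb := Function.update_self ..
  have hcewa : ce' s(w, a) = caw := by
    have hne : s(w, a) ≠ s(w, b) := fun h => hba.symm (Sym2.congr_right.1 h)
    simp only [ce', Function.update_of_ne hne, Function.update_self]
  have hceaw : ce' s(a, w) = caw := by rw [Sym2.eq_swap, hcewa]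
  have hcebw : ce' s(b, w) = cwb := by rw [Sym2.eq_swap, hcewb]
  have hce : ∀ {x y}, x ≠ w → y ≠ w → ce' s(x, y) = ce s(x, y) := by
    intro x y hx hy
    have h₁ : s(x, y) ≠ s(w, a) := by rw [ne_eq, Sym2.eq_iff]; tauto
    have h₂ : s(x, y) ≠ s(w, b) := by rw [ne_eq, Sym2.eq_iff]; tauto
    simp [ce', Function.update_of_ne h₁, Function.update_of_ne h₂]
  have hnotw : ∀ {x y}, G.Adj x y → x ≠ a → x ≠ b → y ≠ w := by
    rintro x y hxy hxa hxb rfl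
    exact ((hNw x).1 hxy.symm).elim hxa hxb
  have hcolor_a : ∀ {x}, G.Adj a x → x ≠ w → ca ≠ cv x := by
    intro x hx hxw
    rw [((hNa x).1 hx).resolve_left hxw]
    exact ha₁
  have hcolor_w : ∀ {x}, G.Adj w x → cv' x ≠ cw := by
    intro x hx
    obtain rfl | rfl := (hNw x).1 hx
    · rw [hcva]; exact hw₁.symm
    · rw [hcv hwb.ne' hba]; exact hw₂.symm
  refine hG.not_totalColorable ⟨cv', ce', ?_, ?_, ?_⟩
  · intro x y hxy
    by_cases hxw : x = w
    · subst hxw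
      rw [hcvw]
      exact (hcolor_w hxy).symm
    by_cases hyw : y = w
    · subst hyw
      rw [hcvw]
      exact hcolor_w hxy.symm
    by_cases hxa : x = a
    · subst hxa
      rw [hcva, hcv hyw hxy.ne']
      exact hcolor_a hxy hyw
    by_cases hya : y = a
    · subst hya
      rw [hcva, hcv hxw hxa]
      exact (hcolor_a hxy.symm hxw).symm
    rw [hcv hxw hxa, hcv hyw hya]
    exact h.vertex (hadj hxy hxw hyw)
  · intro x y z hy hz hyz
    by_cases hxw : x = w
    · subst hxw
      obtain rfl | rfl := (hNw y).1 hy <;> obtain rfl | rfl := (hNw z).1 hz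
      · exact absurd rfl hyz
      · rw [hcewa, hcewb]; exact haw₃
      · rw [hcewa, hcewb]; exact haw₃.symm
      · exact absurd rfl hyz
    by_cases hxa : x = a
    · subst hxa
      obtain rfl | rfl := (hNa y).1 hy <;> obtain rfl | rfl := (hNa z).1 hz
      · exact absurd rfl hyz
      · rw [hceaw, hce hxw ha'w]; exact haw₄
      · rw [hceaw, hce hxw ha'w]; exact haw₄.symm
      · exact absurd rfl hyz
    by_cases hxb : x = b
    · subst hxb
      obtain rfl | rfl := (hNb y).1 hy <;> obtain rfl | rfl := (hNb z).1 hz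
      · exact absurd rfl hyz
      · rw [hcebw, hce hxw hb'w]; exact hwb₂
      · rw [hcebw, hce hxw hb'w]; exact hwb₂.symm
      · exact absurd rfl hyz
    have hyw := hnotw hy hxa hxb
    have hzw := hnotw hz hxa hxb
    rw [hce hxw hyw, hce hxw hzw]
    exact h.edge (hadj hy hxw hyw) (hadj hz hxw hzw) hyz
  · intro x y hxy
    by_cases hxw : x = w
    · subst hxw
      rw [hcvw]
      obtain rfl | rfl := (hNw y).1 hxy
      · rw [hcewa]; exact haw₂
      · rw [hcewb]; exact hwb₃
    by_cases hxa : x = a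
    · subst hxa
      rw [hcva]
      obtain rfl | rfl := (hNa y).1 hxy
      · rw [hceaw]; exact haw₁
      · rw [hce hxw ha'w]; exact ha₂.symm
    rw [hcv hxw hxa]
    by_cases hxb : x = b
    · subst hxb
      obtain rfl | rfl := (hNb y).1 hxy
      · rw [hcebw]; exact hwb₁
      · rw [hce hxw hb'w]; exact h.incident hbb'G
    have hyw := hnotw hxy hxa hxb
    rw [hce hxw hyw]
    exact h.incident (hadj hxy hxw hyw)

lemma TotalCritical.hasCliqueMinor [Fintype V] [Nonempty V] {G : SimpleGraph V}
    [DecidableRel G.Adj] {m : ℕ} (hG : TotalCritical G (Fin m)) (hm : G.maxDegree < m)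
    (hm' : m < G.maxDegree + 3) : HasCliqueMinor (totalGraph G) (m + 1) := by
  classical
  obtain ⟨v, hv⟩ := G.exists_maximal_degree_vertex
  have hconn : ∀ x, ConnectedOff G {x} := fun x => hG.connectedOff x (by
    rw [Fintype.card_fin]
    exact (G.degree_le_maxDegree x).trans_lt hm)
  obtain rfl | rfl : m = G.maxDegree + 1 ∨ m = G.maxDegree + 2 := by omega
  · rw [hv]
    exact hasCliqueMinor_degree_add_two G v (hG.exists_adj v) (hconn v)
  · have hdeg : ∀ u, 2 * G.degree u < G.maxDegree + 2 → 3 ≤ G.degree u := fun u hu =>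
      hG.three_le_degree (fun x => by
        rw [Fintype.card_fin]
        exact Nat.add_le_add_right (G.degree_le_maxDegree x) 2) u (by rwa [Fintype.card_fin])
    obtain hlt | heq | hgt := lt_trichotomy G.maxDegree 2
    · have := hdeg v (by omega)
      omega
    · rw [heq] at hG hdeg
      refine absurd (fun x => ?_) hG.not_two_regular
      have h₁ := G.degree_le_maxDegree x
      have h₂ := hdeg x
      omega
    · have hdeg' : ∀ x, 3 ≤ G.degree x := fun x => by
        have := hdeg x
        omega
      obtain ⟨u, hvu, hu⟩ := exists_adj_connectedOff_pair G v (by omega) hconn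
      rw [hv]
      exact hasCliqueMinor_degree_add_three G v hdeg' hvu hu

/-- A graph none of whose proper subgraphs is an obstruction to `m`-colorability of total graphs
is either totally `m`-colorable or critical. -/
lemma totalCritical_of_subgraph {G : SimpleGraph V} {m : ℕ} (hm : 0 < m)
    (hsub : ∀ H : G.Subgraph, H ≠ ⊤ → (totalGraph H.coe).Colorable m)
    (hG : ¬ TotalColorable G (Fin m)) : TotalCritical G (Fin m) := by
  refine ⟨hG, fun G' hlt => ?_, fun x => ?_⟩
  · refine totalColorable_spanningCoe (H := toSubgraph G' hlt.le) hm (hsub _ fun htop => hlt.ne ?_)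
    ext x y
    exact (congrArg (fun H : G.Subgraph => H.Adj x y) htop).to_iff
  · by_contra! hx
    let H : G.Subgraph := (⊤ : G.Subgraph).deleteVerts {x}
    have hH : H ≠ ⊤ := fun htop => by
      have : x ∈ H.verts := htop ▸ Set.mem_univ x
      simp [H] at this
    have hadj : H.spanningCoe = G := by
      ext a b
      simp only [Subgraph.spanningCoe_adj, H, Subgraph.deleteVerts_adj, Subgraph.verts_top,
        Set.mem_univ, Set.mem_singleton_iff, Subgraph.top_adj, true_and]
      refine ⟨fun h => h.2.2, fun h => ⟨?_, ?_, h⟩⟩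
      · rintro rfl
        exact hx b h
      · rintro rfl
        exact hx a h.symm
    exact hG (hadj ▸ totalColorable_spanningCoe hm (hsub H hH))

lemma card_add_card_coe_lt [Finite V] {G : SimpleGraph V} {H : G.Subgraph} (hH : H ≠ ⊤) :
    Nat.card H.verts + Nat.card H.coe.edgeSet < Nat.card V + Nat.card G.edgeSet := by
  have h := totalGraphHom_injective H
  have hns : ¬ Function.Surjective (totalGraphHom H) := by
    intro hs
    apply hH
    have hverts : ∀ x, x ∈ H.verts := by
      intro x
      obtain ⟨y | e, hy⟩ := hs (Sum.inl x)
      · obtain rfl : y.1 = x := Sum.inl.inj hy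
        exact y.2
      · exact absurd hy Sum.inr_ne_inl
    refine Subgraph.ext (Set.eq_univ_of_forall hverts) ?_
    ext x y
    refine ⟨fun h => h.adj_sub, fun hxy => ?_⟩
    obtain ⟨z | ⟨e, he⟩, hz⟩ := hs (Sum.inr ⟨s(x, y), hxy⟩)
    · exact absurd hz Sum.inl_ne_inr
    · have heq : Sym2.map Subtype.val e = s(x, y) := congrArg Subtype.val (Sum.inr.inj hz)
      induction e with
      | _ p q =>
        have hpq : H.Adj p q := he
        rw [Sym2.map_mk] at heq
        rw [← Subgraph.mem_edgeSet, ← heq]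
        exact hpq
  rw [← Nat.card_sum, ← Nat.card_sum]
  have := Fintype.ofFinite V
  have := Fintype.ofFinite (V ⊕ G.edgeSet)
  have := Fintype.ofFinite (H.verts ⊕ H.coe.edgeSet)
  rw [Nat.card_eq_fintype_card, Nat.card_eq_fintype_card]
  exact Fintype.card_lt_of_injective_not_surjective _ h hns

end Critical

/-- if `F` is a class of simple finite graphs closed under taking subgraphs on
which the weak Total Coloring Conjecture holds (`χ''(G) ≤ Δ(G) + 3`), then Hadwiger's
conjecture holds for the total graph of every member of `F`, i.e. `χ(T(G)) ≤ η(T(G))`. -/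
theorem hadwiger_totalGraph_of_weakTCC (F : ∀ {V : Type u}, SimpleGraph V → Prop)
    (hclosed : ∀ {V : Type u} [Fintype V] (G : SimpleGraph V),
      F G → ∀ G' : G.Subgraph, F G'.coe)
    (hweakTCC : ∀ {V : Type u} [Fintype V] (G : SimpleGraph V) [DecidableRel G.Adj],
      F G → totalChromaticNumber G ≤ G.maxDegree + 3)
    {V : Type u} [Fintype V] (G : SimpleGraph V) (hG : F G) :
    (totalGraph G).chromaticNumber ≤ (hadwigerNumber (totalGraph G) : ℕ∞) := by
  classical
  rw [chromaticNumber_le_iff_colorable]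
  induction hn : Nat.card V + Nat.card G.edgeSet using Nat.strong_induction_on generalizing V with
  | _ n ih =>
    subst hn
    rcases isEmpty_or_nonempty V with hV | hV
    · have : IsEmpty (V ⊕ G.edgeSet) := by
        refine isEmpty_sum.2 ⟨hV, ⟨fun e => ?_⟩⟩
        induction e using Subtype.rec with
        | mk e _ => induction e with | _ x _ => exact hV.elim x
      exact ⟨Coloring.mk isEmptyElim fun {x} => isEmptyElim x⟩
    obtain ⟨v, hv⟩ := G.exists_maximal_degree_vertex
    have hη : G.maxDegree + 1 ≤ hadwigerNumber (totalGraph G) :=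
      hv ▸ (hasCliqueMinor_degree_add_one G v).le_hadwigerNumber
    by_contra hcol
    have hsub : ∀ H : G.Subgraph, H ≠ ⊤ →
        (totalGraph H.coe).Colorable (hadwigerNumber (totalGraph G)) := fun H hH =>
      (ih _ (card_add_card_coe_lt hH) H.coe (hclosed G hG H) rfl).mono
        (hadwigerNumber_totalGraph_coe_le H)
    have hcrit := totalCritical_of_subgraph (by omega) hsub fun h => hcol h.colorable_totalGraph
    have hlt : hadwigerNumber (totalGraph G) < G.maxDegree + 3 := by
      by_contra! hle
      exact hcol ((totalColorable_of_totalChromaticNumber_le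
        (hweakTCC G hG)).colorable_totalGraph.mono hle)
    have := (hcrit.hasCliqueMinor (by omega) hlt).le_hadwigerNumber
    omega
end
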